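/- arXiv:1308.0848 — 7 statements merged into one kernel-verified Lean document; each statement's English description precedes it below -/
import Mathlib

section
/- Let p be a fixed prime. For every positive real number C there exists a positive integer A such that for all integers a ≥ A and all integers r ≥ 2, the p'-part of r^a − 1 satisfies (r^a − 1)_{p'} > C · a · a_p, where a_p denotes the p-part of a. In other words, (r^a − 1)_{p'} / (a · a_p) → ∞ as a → ∞, uniformly in r. -/
/-- The `p`-part of `r ^ a - 1` is bounded by that of `r ^ k - 1` times that of `a`,
for a suitable exponent `0 < k ≤ p`. -/
lemma factorization_pow_sub_one_le {p r a : ℕ} (hp : p.Prime) (hr : 2 ≤ r) (ha : a ≠ 0)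
    (hpr : ¬ p ∣ r) : ∃ k ≤ p, k ≠ 0 ∧
      (r ^ a - 1).factorization p ≤ (r ^ k - 1).factorization p + a.factorization p := by
  have := Fact.mk hp
  have hdvd (k : ℕ) (hk : k ≠ 0) :
      (r ^ a - 1).factorization p ≤ ((r ^ k) ^ a - 1).factorization p := by
    have h0 : (r ^ k) ^ a - 1 ≠ 0 := by
      have := Nat.one_lt_pow ha (Nat.one_lt_pow hk (show 1 < r by lia))
      lia
    have hd : r ^ a - 1 ∣ (r ^ k) ^ a - 1 := by
      rw [← pow_mul, mul_comm, pow_mul]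
      simpa using Nat.sub_dvd_pow_sub_pow (r ^ a) 1 k
    by_cases h1 : r ^ a - 1 = 0
    · simp [h1]
    · exact (Nat.factorization_le_iff_dvd h1 h0).2 hd p
  rcases hp.eq_two_or_odd' with rfl | hodd
  · refine ⟨2, le_rfl, two_ne_zero, (hdvd 2 two_ne_zero).trans ?_⟩
    have h := padicValNat.pow_two_sub_one (x := r) (n := 2 * a) (by lia) hpr (by lia) ⟨a, by lia⟩
    have h' : r ^ 2 - 1 = (r + 1) * (r - 1) := by
      simpa using Nat.sq_sub_sq r 1
    rw [padicValNat.mul (by lia) ha, padicValNat.self (by lia),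
      pow_mul] at h
    simp only [Nat.factorization_def _ hp]
    rw [h', padicValNat.mul (by lia) (by lia)] at *
    lia
  · have hp2 := hp.two_le
    refine ⟨p - 1, by lia, by lia, (hdvd (p - 1) (by lia)).trans ?_⟩
    have h1 : 1 < r ^ (p - 1) := Nat.one_lt_pow (by lia) (by lia)
    have hcop : r.Coprime p := ((Nat.Prime.coprime_iff_not_dvd hp).2 hpr).symm
    have hm : p ∣ r ^ (p - 1) - 1 := by
      have := Nat.ModEq.pow_totient hcop
      rw [Nat.totient_prime hp] at this
      exact (Nat.modEq_iff_dvd' h1.le).1 this.symm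
    have h := padicValNat.pow_sub_pow hodd h1 hm (fun h => hpr (hp.dvd_of_dvd_pow h)) ha
    simp only [one_pow] at h
    simp only [Nat.factorization_def _ hp]
    exact h.le

lemma ordProj_pow_sub_one_le {p r a : ℕ} (hp : p.Prime) (hr : 2 ≤ r) (ha : a ≠ 0) :
    ordProj[p] (r ^ a - 1) ≤ r ^ p * ordProj[p] a := by
  by_cases hpr : p ∣ r
  · have hnd : ¬ p ∣ r ^ a - 1 := fun h => by
      have h1 := Nat.one_le_pow a r (by lia)
      have := (Nat.dvd_sub_iff_right h1 (hpr.trans (dvd_pow_self r ha))).1 h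
      exact hp.one_lt.ne' (Nat.dvd_one.1 this)
    rw [Nat.factorization_eq_zero_of_not_dvd hnd, pow_zero]
    exact Nat.mul_pos (by positivity) (pow_pos hp.pos _)
  · obtain ⟨k, hkp, hk, hle⟩ := factorization_pow_sub_one_le hp hr ha hpr
    have h1 : 1 < r ^ k := Nat.one_lt_pow hk (by lia)
    calc ordProj[p] (r ^ a - 1) ≤ ordProj[p] (r ^ k - 1) * ordProj[p] a := by
          rw [← pow_add]; exact Nat.pow_le_pow_right hp.pos hle
      _ ≤ r ^ p * ordProj[p] a := by
          refine Nat.mul_le_mul_right _ ?_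
          calc ordProj[p] (r ^ k - 1) ≤ r ^ k - 1 := Nat.ordProj_le p (by lia)
            _ ≤ r ^ k := Nat.sub_le _ _
            _ ≤ r ^ p := Nat.pow_le_pow_right (by lia) hkp

/-- Let `p` be a prime. For every `C > 0` there is a positive integer `A` such that for all
`a ≥ A` and all `r ≥ 2` one has `(r^a - 1)_{p'} > C * a * a_p`, i.e.
`(r^a - 1)_{p'} / (a * a_p) → ∞` as `a → ∞`, uniformly in `r`. -/
theorem ordCompl_pow_sub_one_tendsto (p : ℕ) (hp : p.Prime) (C : ℝ) (hC : 0 < C) :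
    ∃ A : ℕ, 0 < A ∧ ∀ a : ℕ, A ≤ a → ∀ r : ℕ, 2 ≤ r →
      C * a * (ordProj[p] a : ℝ) < (ordCompl[p] (r ^ a - 1) : ℝ) := by
  have hlim := tendsto_pow_const_div_const_pow_of_one_lt 3 (one_lt_two (α := ℝ))
  have hε : (0 : ℝ) < 1 / (2 * C * 2 ^ p) := by positivity
  obtain ⟨N, hN⟩ := Filter.eventually_atTop.1 (hlim.eventually_lt_const hε)
  refine ⟨N + p + 1, by lia, fun a ha r hr => ?_⟩
  have ha0 : a ≠ 0 := by lia
  have hbig := hN a (by lia)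
  have hP : (0 : ℝ) < (p : ℝ) ^ (r ^ a - 1).factorization p := by
    have := hp.pos
    positivity
  have hQ : (0 : ℝ) < (p : ℝ) ^ a.factorization p := by
    have := hp.pos
    positivity
  have hPle : (p : ℝ) ^ (r ^ a - 1).factorization p ≤ (r : ℝ) ^ p * (p : ℝ) ^ a.factorization p := by
    exact_mod_cast ordProj_pow_sub_one_le hp hr ha0
  have hQle : (p : ℝ) ^ a.factorization p ≤ a := by
    exact_mod_cast Nat.ordProj_le p ha0
  have hr2 : (2 : ℝ) ≤ r := by exact_mod_cast hr
  have hra : (2 : ℝ) ≤ (r : ℝ) ^ a := hr2.trans (le_self_pow₀ (by linarith) ha0)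
  rw [lt_div_iff₀ hP]
  rw [div_lt_div_iff₀ (by positivity) (by positivity)] at hbig
  obtain ⟨m, rfl⟩ : ∃ m, a = p + m := ⟨a - p, by lia⟩
  generalize (p : ℝ) ^ (p + m).factorization p = Q at *
  generalize (p : ℝ) ^ (r ^ (p + m) - 1).factorization p = P at *
  set x : ℝ := ((p + m : ℕ) : ℝ) with hx
  have hx0 : 0 < x := hQ.trans_le hQle
  have hm : 2 * C * x ^ 3 < 2 ^ m := by
    rw [pow_add] at hbig
    have : (0 : ℝ) < 2 ^ p := by positivity
    nlinarith
  have hkey : 2 * (C * x * Q * P) < (r : ℝ) ^ (p + m) := by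
    calc 2 * (C * x * Q * P) ≤ 2 * (C * x * x * (r ^ p * x)) := by
          gcongr
          exact hPle.trans (by gcongr)
      _ = r ^ p * (2 * C * x ^ 3) := by ring
      _ < r ^ p * 2 ^ m := by gcongr
      _ ≤ r ^ p * r ^ m := by gcongr
      _ = (r : ℝ) ^ (p + m) := (pow_add _ _ _).symm
  linarith
end

section
/- Let p be a fixed prime. For every positive real number C there exists a positive integer C₀ such that for all integers c ≥ C₀ and all integers r ≥ 2, the p'-part of r^{p^c} − 1 satisfies (r^{p^c} − 1)_{p'} > C · p^{2c}. In other words, (r^{p^c} − 1)_{p'} / p^{2c} → ∞ as c → ∞, uniformly in r. -/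
/-- For a prime `p`, passing from `x - 1` to `x ^ p - 1` raises the `p`-adic valuation by at most
one, provided `x` is a square when `p = 2`. -/
lemma padicValNat_pow_prime_sub_one_le {p x : ℕ} (hp : p.Prime) (hx : 2 ≤ x)
    (hsq : p = 2 → IsSquare x) :
    padicValNat p (x ^ p - 1) ≤ padicValNat p (x - 1) + 1 := by
  have : Fact p.Prime := ⟨hp⟩
  by_cases hdvd : p ∣ x - 1
  · have hpx : ¬ p ∣ x := fun h => by
      have h1 : p ∣ x - (x - 1) := Nat.dvd_sub h hdvd
      rw [show x - (x - 1) = 1 by omega] at h1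
      exact hp.one_lt.ne' (Nat.dvd_one.mp h1)
    rcases hp.eq_two_or_odd' with rfl | hodd
    · have key := padicValNat.pow_two_sub_pow (x := x) (y := 1) (by omega) hdvd hpx
        (n := 2) two_ne_zero even_two
      have hval : padicValNat 2 (x + 1) ≤ 1 := by
        by_contra! hlt
        have h4 : 2 ^ 2 ∣ x + 1 := (padicValNat_dvd_iff_le (by omega)).mpr hlt
        obtain ⟨z, rfl⟩ := hsq rfl
        have hmod := Nat.mul_mod z z 4
        have : z % 4 < 4 := Nat.mod_lt _ (by norm_num)
        interval_cases z % 4 <;> omega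
      rw [one_pow, padicValNat_self] at key
      omega
    · have key := padicValNat.pow_sub_pow (p := p) (x := x) (y := 1) hodd (by omega) hdvd hpx
        (n := p) hp.ne_zero
      rw [one_pow, padicValNat_self] at key
      exact key.le
  · have hnd : ¬ p ∣ x ^ p - 1 := by
      contrapose! hdvd
      have h1 : 1 ≤ x ^ p := Nat.one_le_pow _ _ (by omega)
      rw [← ZMod.natCast_eq_zero_iff] at hdvd ⊢
      rw [Nat.cast_sub h1, Nat.cast_pow, ZMod.pow_card] at hdvd
      rwa [Nat.cast_sub (by omega)]
    rw [padicValNat.eq_zero_of_not_dvd hnd]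
    exact Nat.zero_le _

/-- For a prime `p`, the `p'`-part of `x ^ p - 1` is at least `x / p`, provided `x` is a square
when `p = 2`. -/
lemma div_prime_le_ordCompl_pow_prime_sub_one {p x : ℕ} (hp : p.Prime) (hx : 2 ≤ x)
    (hsq : p = 2 → IsSquare x) :
    (x : ℝ) / p ≤ ((x : ℝ) ^ p - 1) / (p : ℝ) ^ (x ^ p - 1).factorization p := by
  have hp1 : (1 : ℝ) ≤ p := by exact_mod_cast hp.one_le
  have hx2 : (2 : ℝ) ≤ x := by exact_mod_cast hx
  have hle : (p : ℝ) ^ (x ^ p - 1).factorization p ≤ (x - 1) * p := by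
    calc (p : ℝ) ^ (x ^ p - 1).factorization p
        ≤ (p : ℝ) ^ ((x - 1).factorization p + 1) := by
          apply pow_le_pow_right₀ hp1
          simpa only [Nat.factorization_def _ hp] using padicValNat_pow_prime_sub_one_le hp hx hsq
      _ = (p : ℝ) ^ (x - 1).factorization p * p := pow_succ _ _
      _ ≤ (x - 1) * p := by
          gcongr
          have h := Nat.ordProj_le p (n := x - 1) (by omega)
          have h' : ((p ^ (x - 1).factorization p : ℕ) : ℝ) ≤ ((x - 1 : ℕ) : ℝ) := by
            exact_mod_cast h
          rwa [Nat.cast_sub (by omega), Nat.cast_pow, Nat.cast_one] at h'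
  have hpow : (x : ℝ) ^ 2 ≤ (x : ℝ) ^ p := pow_le_pow_right₀ (by linarith) hp.two_le
  rw [div_le_div_iff₀ (by linarith) (by positivity)]
  calc (x : ℝ) * (p : ℝ) ^ (x ^ p - 1).factorization p
      ≤ x * ((x - 1) * p) := by gcongr
    _ = (x ^ 2 - x) * p := by ring
    _ ≤ (x ^ p - 1) * p := by gcongr; linarith

/-- Let `p` be a prime. For every `C > 0` there is a positive integer `C₀` such that for all
`c ≥ C₀` and all `r ≥ 2` one has `(r^(p^c) - 1)_{p'} > C * p^(2c)`, i.e.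
`(r^(p^c) - 1)_{p'} / p^(2c) → ∞` as `c → ∞`, uniformly in `r`. -/
theorem ordCompl_pow_prime_pow_sub_one_tendsto (p : ℕ) (hp : p.Prime) (C : ℝ) (hC : 0 < C) :
    ∃ C₀ : ℕ, 0 < C₀ ∧ ∀ c : ℕ, C₀ ≤ c → ∀ r : ℕ, 2 ≤ r →
      C * (p : ℝ) ^ (2 * c) < (ordCompl[p] (r ^ p ^ c - 1) : ℝ) := by
  have hp0 : (0 : ℝ) < p := by exact_mod_cast hp.pos
  have hlim := tendsto_pow_const_div_const_pow_of_one_lt 2 (one_lt_two (α := ℝ))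
  have hpos : 0 < 1 / (C * (p : ℝ) ^ 3) := by positivity
  obtain ⟨N, hN⟩ := Filter.eventually_atTop.mp (hlim.eventually_lt_const hpos)
  refine ⟨N + 2, by omega, fun c hc r hr => ?_⟩
  obtain ⟨d, rfl⟩ : ∃ d, c = d + 1 := ⟨c - 1, by omega⟩
  have hd : d < p ^ d := Nat.lt_pow_self hp.one_lt
  have hbound := hN (p ^ d) (by omega)
  rw [div_lt_div_iff₀ (by positivity) (by positivity), one_mul] at hbound
  have hx : 2 ≤ r ^ p ^ d := hr.trans (Nat.le_self_pow (by omega) r)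
  have hsq : p = 2 → IsSquare (r ^ p ^ d) := by
    rintro rfl
    exact Even.isSquare_pow (even_two.pow_of_ne_zero (by omega)) r
  have key := div_prime_le_ordCompl_pow_prime_sub_one hp hx hsq
  have hr2 : (2 : ℝ) ^ p ^ d ≤ (r : ℝ) ^ p ^ d := by
    gcongr
    exact_mod_cast hr
  push_cast at hbound key
  rw [← pow_mul, ← pow_mul, ← pow_succ] at key
  refine lt_of_lt_of_le ?_ key
  rw [lt_div_iff₀ hp0]
  calc C * (p : ℝ) ^ (2 * (d + 1)) * p = ((p : ℝ) ^ d) ^ 2 * (C * (p : ℝ) ^ 3) := by ring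
    _ < 2 ^ p ^ d := hbound
    _ ≤ (r : ℝ) ^ p ^ d := hr2
end

section
/- Let n ≥ 2 be an integer and q a prime power such that the projective special linear group PSL_n(F_q) is simple (that is, (n, q) is neither (2,2) nor (2,3)). Then for any prime p, the number of conjugacy classes of p-regular elements of PSL_n(F_q) satisfies k_{p'}(PSL_n(F_q)) > q^{n−1} / (6 n³). -/
/-- `kReg p G` is the number of conjugacy classes of `p`-regular elements of `G`,
i.e. classes of elements whose order is not divisible by `p`. -/
noncomputable def kReg (p : ℕ) (G : Type*) [Group G] : ℕ :=
  Nat.card {c : ConjClasses G // ∃ g : G, c = ConjClasses.mk g ∧ ¬ p ∣ orderOf g}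

/-- If `g` and `h` have conjugate images in `PSL_n`, then up to a central factor they have the same
characteristic polynomial. -/
theorem Matrix.ProjectiveSpecialLinearGroup.exists_charpoly_eq_of_isConj {ι F : Type*} [Fintype ι]
    [DecidableEq ι] [CommRing F] {g h : Matrix.SpecialLinearGroup ι F}
    (H : IsConj (g : Matrix.ProjectiveSpecialLinearGroup ι F) h) :
    ∃ z : Subgroup.center (Matrix.SpecialLinearGroup ι F),
      (g : Matrix ι ι F).charpoly = ((h * z : Matrix.SpecialLinearGroup ι F) :
        Matrix ι ι F).charpoly := by
  obtain ⟨c, hc⟩ := isConj_iff.mp H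
  obtain ⟨c, rfl⟩ := QuotientGroup.mk_surjective c
  have hz : (c * g * c⁻¹)⁻¹ * h ∈ Subgroup.center (Matrix.SpecialLinearGroup ι F) :=
    QuotientGroup.eq.mp hc
  refine ⟨⟨_, inv_mem hz⟩, ?_⟩
  have h1 : h * ((c * g * c⁻¹)⁻¹ * h)⁻¹ = c * g * c⁻¹ := by group
  have h2 : (c⁻¹ : Matrix.SpecialLinearGroup ι F).1 * c.1 = 1 := by
    rw [← Matrix.SpecialLinearGroup.coe_mul]; simp
  rw [h1, Matrix.SpecialLinearGroup.coe_mul, Matrix.SpecialLinearGroup.coe_mul,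
    Matrix.charpoly_mul_comm, ← mul_assoc, h2, one_mul]

theorem Matrix.SpecialLinearGroup.card_center_le (ι F : Type*) [Fintype ι] [DecidableEq ι]
    [Nonempty ι] [CommRing F] [IsDomain F] :
    Nat.card (Subgroup.center (Matrix.SpecialLinearGroup ι F)) ≤ Fintype.card ι := by
  rw [Nat.card_congr
    (Matrix.SpecialLinearGroup.center_equiv_rootsOfUnity (n := ι) (R := F)).toEquiv,
    max_eq_left Fintype.card_pos]
  have : NeZero (Fintype.card ι) := ⟨Fintype.card_ne_zero⟩
  exact card_rootsOfUnity F (Fintype.card ι)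

open Polynomial in
theorem card_units_pow_isRoot_le {F K : Type*} [Field F] [Field K] [Algebra F K] [Fintype Kˣ]
    [DecidableEq K] {f : F[X]} (hf : f ≠ 0) {c : ℕ} (hc : 0 < c) :
    (Finset.univ.filter fun x : Kˣ => aeval ((x : K) ^ c) f = 0).card ≤ f.natDegree * c := by
  have hg : expand F c f ≠ 0 := (expand_ne_zero hc).mpr hf
  have hg' : (expand F c f).map (algebraMap F K) ≠ 0 := by simpa using hg
  rw [← natDegree_expand, ← natDegree_map (p := expand F c f) (algebraMap F K)]
  refine le_trans ?_ ((Multiset.toFinset_card_le _).trans (card_roots' _))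
  refine Finset.card_le_card_of_injOn Units.val (fun x hx => ?_) Units.val_injective.injOn
  simp only [Finset.coe_filter, Finset.mem_univ, true_and, Set.mem_ofPred_eq] at hx
  simp only [Finset.mem_coe, Multiset.mem_toFinset, mem_roots hg', IsRoot.def, eval_map_algebraMap,
    expand_aeval, hx]

/-- A family of norm one elements `u x` of an `n`-dimensional `F`-algebra `R`, of order prime to
`p` and projecting to `x ^ c` in a field `K`, gives a lower bound for the number of `p`-regular
classes of `PSL_n(F)`, through the regular representation of `R`. -/
theorem card_units_le_mul_kReg {n : ℕ} (hn : 0 < n) {F R K : Type*} [Field F] [Finite F]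
    [CommRing R] [Algebra F R] [Module.Finite F R] (hR : Module.finrank F R = n) [Field K]
    [Finite K] [Algebra F K] (π : R →ₐ[F] K) (u : Kˣ → R) (hu : ∀ x, Algebra.norm F (u x) = 1)
    {c : ℕ} (hc : 0 < c) (hπ : ∀ x, π (u x) = (x : K) ^ c) {p k : ℕ} (hk : ¬ p ∣ k)
    (huk : ∀ x, u x ^ k = 1) :
    Nat.card Kˣ ≤ n * (n * c) * kReg p (Matrix.ProjectiveSpecialLinearGroup (Fin n) F) := by
  classical
  have := Fintype.ofFinite F
  have := Fintype.ofFinite K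
  have : NeZero n := ⟨hn.ne'⟩
  let b : Module.Basis (Fin n) F R := Module.finBasisOfFinrankEq F R hR
  let θ : Kˣ → Matrix.SpecialLinearGroup (Fin n) F := fun x =>
    ⟨Algebra.leftMulMatrix b (u x), by rw [← Algebra.norm_eq_matrix_det, hu]⟩
  have hθk : ∀ x, θ x ^ k = 1 := fun x => by
    apply Subtype.ext
    rw [Matrix.SpecialLinearGroup.coe_pow, ← map_pow, huk, map_one,
      Matrix.SpecialLinearGroup.coe_one]
  have hroot : ∀ x : Kˣ,
      Polynomial.aeval ((x : K) ^ c) (θ x : Matrix (Fin n) (Fin n) F).charpoly = 0 :=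
    fun x => by
      rw [← hπ, Polynomial.aeval_algHom_apply]
      convert! map_zero π
      apply Algebra.leftMulMatrix_injective b
      rw [← Polynomial.aeval_algHom_apply, map_zero]
      exact Matrix.aeval_self_charpoly _
  have : Finite (Matrix.ProjectiveSpecialLinearGroup (Fin n) F) :=
    Finite.of_surjective _ QuotientGroup.mk_surjective
  let C := {c : ConjClasses (Matrix.ProjectiveSpecialLinearGroup (Fin n) F) //
    ∃ g, c = ConjClasses.mk g ∧ ¬ p ∣ orderOf g}
  have : Fintype C := Fintype.ofFinite C
  let Φ : Kˣ → C := fun x => ⟨ConjClasses.mk (θ x), _, rfl, fun h => hk <| h.trans <|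
    orderOf_dvd_of_pow_eq_one <| by rw [← QuotientGroup.mk_pow, hθk, QuotientGroup.mk_one]⟩
  rw [Nat.card_eq_fintype_card, kReg, Nat.card_eq_fintype_card]
  refine Finset.card_le_mul_card_image_of_maps_to (f := Φ) (fun _ _ => Finset.mem_univ _) _ ?_
  intro y _
  by_cases hy : ∃ x, Φ x = y
  swap
  · push Not at hy
    simp [hy]
  obtain ⟨y, rfl⟩ := hy
  let Z := Subgroup.center (Matrix.SpecialLinearGroup (Fin n) F)
  let f : Z → Polynomial F := fun z =>
    ((θ y * z : Matrix.SpecialLinearGroup (Fin n) F) : Matrix (Fin n) (Fin n) F).charpoly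
  calc _ ≤ (Finset.univ.biUnion fun z : Z =>
          Finset.univ.filter fun x : Kˣ => Polynomial.aeval ((x : K) ^ c) (f z) = 0).card := by
        refine Finset.card_le_card fun x hx => ?_
        simp only [Finset.mem_filter, Finset.mem_univ, true_and, Finset.mem_biUnion] at hx ⊢
        obtain ⟨z, hz⟩ := Matrix.ProjectiveSpecialLinearGroup.exists_charpoly_eq_of_isConj
          (ConjClasses.mk_eq_mk_iff_isConj.mp (congrArg Subtype.val hx))
        exact ⟨z, by simpa only [f, ← hz] using hroot x⟩
    _ ≤ (Finset.univ : Finset Z).card * (n * c) := by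
        refine Finset.card_biUnion_le_card_mul _ _ _ fun z _ => ?_
        refine (card_units_pow_isRoot_le (Matrix.charpoly_monic _).ne_zero hc).trans ?_
        simp
    _ ≤ n * (n * c) := by
        refine Nat.mul_le_mul_right _ ?_
        rw [Finset.card_univ, ← Nat.card_eq_fintype_card]
        simpa using Matrix.SpecialLinearGroup.card_center_le (Fin n) F

theorem Algebra.norm_prod_mk (F : Type*) {A B : Type*} [Field F] [CommRing A] [CommRing B]
    [Algebra F A] [Algebra F B] [Module.Finite F A] [Module.Finite F B] (a : A) (b : B) :
    Algebra.norm F (a, b) = Algebra.norm F a * Algebra.norm F b := by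
  simp only [Algebra.norm_apply]
  rw [← LinearMap.det_prodMap]
  congr 1

theorem pow_sub_one_le_of_degree_eq {n : ℕ} (hn : 0 < n) (F : Type*) [Field F] [Fintype F]
    {p c k : ℕ} (hc : Fintype.card F ^ n - 1 = (Fintype.card F - 1) * c * k) (hc0 : 0 < c)
    (hk : ¬ p ∣ k) :
    Fintype.card F ^ n - 1 ≤ n * (n * ((Fintype.card F - 1) * c)) *
      kReg p (Matrix.ProjectiveSpecialLinearGroup (Fin n) F) := by
  obtain ⟨ℓ, hℓ⟩ := CharP.exists F
  have : Fact ℓ.Prime := ⟨CharP.char_is_prime F ℓ⟩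
  have : NeZero n := ⟨hn.ne'⟩
  let K := FiniteField.Extension F ℓ n
  have hK : Nat.card Kˣ = Fintype.card F ^ n - 1 := by
    rw [Nat.card_units, FiniteField.natCard_extension, Nat.card_eq_fintype_card]
  have hq : 0 < Fintype.card F - 1 := Nat.sub_pos_of_lt Fintype.one_lt_card
  rw [← hK]
  refine card_units_le_mul_kReg hn (FiniteField.finrank_extension F ℓ n) (AlgHom.id F K)
    (fun x => (x : K) ^ ((Fintype.card F - 1) * c)) (fun x => ?_) (by positivity)
    (fun x => rfl) hk (fun x => ?_)
  · rw [map_pow, pow_mul, FiniteField.pow_card_sub_one_eq_one, one_pow]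
    exact (x.isUnit.map (Algebra.norm F)).ne_zero
  · rw [← pow_mul, ← hc, ← hK, ← Units.val_pow_eq_pow_val, pow_card_eq_one', Units.val_one]

theorem pow_sub_one_le_of_degree_add_one_eq {m : ℕ} (hm : 0 < m) (F : Type*) [Field F] [Fintype F]
    {p c k : ℕ} (hc : Fintype.card F ^ m - 1 = c * k) (hc0 : 0 < c) (hk : ¬ p ∣ k) :
    Fintype.card F ^ m - 1 ≤ (m + 1) * ((m + 1) * c) *
      kReg p (Matrix.ProjectiveSpecialLinearGroup (Fin (m + 1)) F) := by
  obtain ⟨ℓ, hℓ⟩ := CharP.exists F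
  have : Fact ℓ.Prime := ⟨CharP.char_is_prime F ℓ⟩
  have : NeZero m := ⟨hm.ne'⟩
  let K := FiniteField.Extension F ℓ m
  have hK : Nat.card Kˣ = Fintype.card F ^ m - 1 := by
    rw [Nat.card_units, FiniteField.natCard_extension, Nat.card_eq_fintype_card]
  have hxk : ∀ x : Kˣ, ((x : K) ^ c) ^ k = 1 := fun x => by
    rw [← pow_mul, ← hc, ← hK, ← Units.val_pow_eq_pow_val, pow_card_eq_one', Units.val_one]
  rw [← hK]
  refine card_units_le_mul_kReg m.succ_pos (R := K × F) ?_ (AlgHom.fst F K F)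
    (fun x => ((x : K) ^ c, (Algebra.norm F ((x : K) ^ c))⁻¹)) (fun x => ?_) hc0
    (fun x => rfl) hk (fun x => ?_)
  · rw [Module.finrank_prod, FiniteField.finrank_extension F ℓ m, Module.finrank_self]
  · rw [Algebra.norm_prod_mk, Algebra.norm_self, MonoidHom.id_apply, mul_inv_cancel₀]
    exact ((x.isUnit.pow c).map (Algebra.norm F)).ne_zero
  · rw [Prod.pow_mk, hxk, inv_pow, ← map_pow, hxk, map_one, inv_one, Prod.mk_one_one]

/-- One of `(q ^ n - 1) / (q - 1)` and `q ^ (n - 1) - 1`, the orders of two maximal tori of `SL_n(q)`,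
has a `p`-part which is at most `n`, respectively at most `2`. -/
theorem exists_small_prime_part {n q p : ℕ} (hn : 2 ≤ n) (hq : 2 ≤ q) (hp : p.Prime) :
    (∃ c k, q ^ n - 1 = (q - 1) * c * k ∧ 0 < c ∧ c ≤ n ∧ ¬ p ∣ k) ∨
      ∃ c k, q ^ (n - 1) - 1 = c * k ∧ 0 < c ∧ c ≤ 2 ∧ ¬ p ∣ k := by
  have : Fact p.Prime := ⟨hp⟩
  obtain ⟨S, hS⟩ : q - 1 ∣ q ^ n - 1 := by simpa using Nat.sub_dvd_pow_sub_pow q 1 n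
  have hqn : 1 < q ^ n := Nat.one_lt_pow (by omega) hq
  have hqn' : 1 < q ^ (n - 1) := Nat.one_lt_pow (by omega) hq
  have hS0 : S ≠ 0 := by rintro rfl; omega
  by_cases hpS : p ∣ S
  swap
  · exact .inl ⟨1, S, by simpa using hS, one_pos, by omega, hpS⟩
  have hpn : p ∣ q ^ n - 1 := hS ▸ hpS.mul_left _
  have hpq : ¬ p ∣ q := fun h => hp.one_lt.ne' <| Nat.dvd_one.mp <|
    (Nat.dvd_sub_iff_right hqn.le (h.trans (dvd_pow_self q (by omega)))).mp hpn
  by_cases hpT : p ∣ q ^ (n - 1) - 1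
  swap
  · exact .inr ⟨1, _, (one_mul _).symm, one_pos, by omega, hpT⟩
  have hstep : q ^ n - 1 = q * (q ^ (n - 1) - 1) + (q - 1) := by
    obtain ⟨m, rfl⟩ : ∃ m, n = m + 1 := ⟨n - 1, by omega⟩
    have : q ≤ q * q ^ m := Nat.le_mul_of_pos_right _ (by positivity)
    rw [Nat.add_sub_cancel, pow_succ', Nat.mul_sub, mul_one]
    omega
  have hp1 : p ∣ q - 1 := (Nat.dvd_add_right (hpT.mul_left q)).mp (hstep ▸ hpn)
  have hv : padicValNat p (q ^ n - 1) = padicValNat p (q - 1) + padicValNat p S := by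
    rw [hS, padicValNat.mul (by omega) hS0]
  have key (h : padicValNat p S = padicValNat p n) :
      ∃ c k, q ^ n - 1 = (q - 1) * c * k ∧ 0 < c ∧ c ≤ n ∧ ¬ p ∣ k := by
    obtain ⟨k, hk⟩ : p ^ padicValNat p S ∣ S := pow_padicValNat_dvd
    refine ⟨p ^ padicValNat p S, k, ?_, pow_pos hp.pos _, ?_, fun hpk => ?_⟩
    · rw [hS, mul_assoc, ← hk]
    · rw [h]
      exact Nat.le_of_dvd (by omega) pow_padicValNat_dvd
    · apply pow_succ_padicValNat_not_dvd (p := p) hS0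
      rw [pow_succ]
      exact (mul_dvd_mul_left _ hpk).trans hk.symm.dvd
  rcases hp.eq_two_or_odd' with rfl | hodd
  swap
  · left
    apply key
    have := padicValNat.pow_sub_pow hodd (show 1 < q by omega) hp1 hpq (show n ≠ 0 by omega)
    rw [one_pow] at this
    omega
  have hq_odd : q % 2 = 1 := by omega
  have hn_even : n % 2 = 0 := by
    have hsum : S = ∑ i ∈ Finset.range n, q ^ i := by
      refine Nat.eq_of_mul_eq_mul_left (show 0 < q - 1 by omega) ?_
      rw [← hS, mul_comm, Nat.geomSum_eq hq, Nat.div_mul_cancel ⟨S, hS⟩]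
    have hmod : ∑ i ∈ Finset.range n, q ^ i ≡ ∑ i ∈ Finset.range n, 1 [MOD 2] :=
      Nat.ModEq.sum fun i _ => by simpa using (show q ≡ 1 [MOD 2] from hq_odd).pow i
    rw [← hsum, Finset.sum_const, Finset.card_range, smul_eq_mul, mul_one] at hmod
    have : S % 2 = n % 2 := hmod
    omega
  by_cases h4 : q % 4 = 1
  · left
    apply key
    have h := padicValNat.pow_two_sub_one (show 1 < q by omega) hpq (show n ≠ 0 by omega)
      (Nat.even_iff.mpr hn_even)
    have h1 : padicValNat 2 (q + 1) = 1 := by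
      obtain ⟨t, ht⟩ : ∃ t, q + 1 = 2 * t := ⟨(q + 1) / 2, by omega⟩
      rw [ht, padicValNat.mul (by omega) (by omega), padicValNat_self,
        padicValNat.eq_zero_of_not_dvd (by omega)]
    omega
  · right
    have h3 : q ^ (n - 1) % 4 = 3 := by
      obtain ⟨j, hj⟩ : ∃ j, n - 1 = 2 * j + 1 := ⟨n / 2 - 1, by omega⟩
      rw [Nat.pow_mod, show q % 4 = 3 by omega, hj, pow_succ, pow_mul, Nat.mul_mod, Nat.pow_mod]
      simp
    exact ⟨2, (q ^ (n - 1) - 1) / 2, by omega, by omega, le_rfl, by omega⟩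

/-- If `n ≥ 2` and `F` is a finite field with `q` elements such that `PSL_n(F_q)` is simple
(i.e. `(n, q)` is neither `(2,2)` nor `(2,3)`), then for any prime `p`,
`k_{p'}(PSL_n(F_q)) > q^(n-1) / (6 n³)`. -/
theorem kReg_PSL_gt (n : ℕ) (hn : 2 ≤ n) (F : Type) [Field F] [Fintype F]
    (hsimple : ¬ (n = 2 ∧ (Fintype.card F = 2 ∨ Fintype.card F = 3)))
    (p : ℕ) (hp : p.Prime) :
    ((Fintype.card F : ℝ) ^ (n - 1)) / (6 * (n : ℝ) ^ 3) <
      (kReg p (Matrix.ProjectiveSpecialLinearGroup (Fin n) F) : ℝ) := by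
  set q := Fintype.card F with hq
  have hq2 : 2 ≤ q := Fintype.one_lt_card
  set κ := kReg p (Matrix.ProjectiveSpecialLinearGroup (Fin n) F) with hκ
  suffices h : q ^ (n - 1) < κ * (6 * n ^ 3) by
    rw [div_lt_iff₀ (by positivity)]
    exact_mod_cast h
  obtain ⟨m, rfl⟩ : ∃ m, n = m + 1 := ⟨n - 1, by omega⟩
  rw [Nat.add_sub_cancel]
  have hqm : 2 ≤ q ^ m := hq2.trans (Nat.le_self_pow (by omega) q)
  rcases exists_small_prime_part hn hq2 hp with ⟨c, k, hc, hc0, hcn, hk⟩ | ⟨c, k, hc, hc0, hcn, hk⟩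
  · have h := pow_sub_one_le_of_degree_eq (by omega) F hc hc0 hk
    rw [← hq, ← hκ] at h
    have h1 : (q - 1) * q ^ m ≤ q ^ (m + 1) - 1 := by
      rw [Nat.sub_mul, ← pow_succ']
      omega
    have h2 : q ^ m ≤ (m + 1) * ((m + 1) * c) * κ := by
      refine Nat.le_of_mul_le_mul_left (h1.trans (h.trans (le_of_eq ?_))) (show 0 < q - 1 by omega)
      ring
    have h3 : (m + 1) * ((m + 1) * c) * κ ≤ (m + 1) * ((m + 1) * (m + 1)) * κ := by gcongr
    nlinarith
  · rw [Nat.add_sub_cancel] at hc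
    have h := pow_sub_one_le_of_degree_add_one_eq (show 0 < m by omega) F hc hc0 hk
    rw [← hq, ← hκ] at h
    have h2 : (m + 1) * ((m + 1) * c) * κ ≤ (m + 1) * ((m + 1) * 2) * κ := by gcongr
    have h3 : (m + 1) * ((m + 1) * 2) * κ * 2 ≤ (m + 1) * ((m + 1) * 2) * κ * (m + 1) := by gcongr
    have h4 : (m + 1) * ((m + 1) * 2) * κ * (m + 1) = 2 * (κ * (m + 1) ^ 3) := by ring
    rw [mul_left_comm κ 6]
    omega
end

section
/- Let n ≥ 2 be an integer, ℓ a prime, f a positive integer, and q = ℓ^f a prime power such that PSL_n(F_q) is simple (that is, (n, q) is neither (2,2) nor (2,3)). Then for any prime p, the number of orbits of the automorphism group Aut(PSL_n(F_q)) acting on the set of p-regular elements of PSL_n(F_q) is greater than q^{n−1} / (12 f n⁴). -/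
/-- `kRegAut p S` is the number of orbits of the natural action of `Aut(S)` on the set of
`p`-regular elements of `S` (elements whose order is not divisible by `p`). -/
noncomputable def kRegAut (p : ℕ) (S : Type*) [Group S] : ℕ :=
  Nat.card {c : Quotient (MulAction.orbitRel (MulAut S) S) //
    ∃ g : S, c = Quotient.mk (MulAction.orbitRel (MulAut S) S) g ∧ ¬ p ∣ orderOf g}

namespace PSLAut

open Matrix

section Unipotent

variable {ι F : Type*} [DecidableEq ι] [Fintype ι] [Field F]

/-- The class of an element of `SL` in `PSL`. -/
abbrev proj (A : Matrix.SpecialLinearGroup ι F) : Matrix.ProjectiveSpecialLinearGroup ι F :=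
  QuotientGroup.mk' _ A

lemma val_inj {A B : Matrix.SpecialLinearGroup ι F} (h : A.1 = B.1) : A = B := Subtype.ext h

lemma val_mul (A B : Matrix.SpecialLinearGroup ι F) : (A * B).1 = A.1 * B.1 := rfl

lemma val_one : (1 : Matrix.SpecialLinearGroup ι F).1 = 1 := rfl

lemma val_pow (A : Matrix.SpecialLinearGroup ι F) (k : ℕ) : (A ^ k).1 = A.1 ^ k :=
  Matrix.SpecialLinearGroup.coe_pow A k

lemma val_mul_val_inv (A : Matrix.SpecialLinearGroup ι F) : A.1 * A⁻¹.1 = 1 := by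
  rw [← val_mul, mul_inv_cancel, val_one]

lemma val_inv_mul_val (A : Matrix.SpecialLinearGroup ι F) : A⁻¹.1 * A.1 = 1 := by
  rw [← val_mul, inv_mul_cancel, val_one]

lemma proj_surjective (x : Matrix.ProjectiveSpecialLinearGroup ι F) : ∃ A, proj A = x :=
  QuotientGroup.mk'_surjective _ x

lemma proj_eq_iff {A B : Matrix.SpecialLinearGroup ι F} :
    proj A = proj B ↔ ∃ z : F, z ^ Fintype.card ι = 1 ∧ B.1 = z • A.1 := by
  have h0 : proj A = proj B ↔ A⁻¹ * B ∈ Subgroup.center (Matrix.SpecialLinearGroup ι F) :=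
    QuotientGroup.eq
  rw [h0, Matrix.SpecialLinearGroup.mem_center_iff]
  refine exists_congr fun z ↦ and_congr_right fun _ ↦ ?_
  rw [val_mul, scalar_apply, ← smul_one_eq_diagonal]
  constructor
  · intro h
    have : A.1 * (A⁻¹.1 * B.1) = A.1 * z • 1 := by rw [h]
    rw [← mul_assoc, val_mul_val_inv] at this
    simpa using this
  · intro h
    rw [h, Matrix.mul_smul, val_inv_mul_val]

variable (ℓ : ℕ) [Fact ℓ.Prime] [CharP F ℓ]

lemma eq_of_proj_eq {A B : Matrix.SpecialLinearGroup ι F} {k : ℕ} (hA : A ^ ℓ ^ k = 1)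
    (hB : B ^ ℓ ^ k = 1) (h : proj A = proj B) : A = B := by
  rcases isEmpty_or_nonempty ι with hι | ⟨⟨i⟩⟩
  · exact Subsingleton.elim _ _
  obtain ⟨z, -, hz⟩ := proj_eq_iff.1 h
  have h1 : B.1 ^ ℓ ^ k = 1 := by rw [← val_pow, hB, val_one]
  have h2 : A.1 ^ ℓ ^ k = 1 := by rw [← val_pow, hA, val_one]
  rw [hz, smul_pow, h2] at h1
  have h3 : z ^ ℓ ^ k = 1 := by simpa using congr_fun (congr_fun h1 i) i
  have h4 : z = 1 := iterateFrobenius_inj F ℓ k (by simpa [iterateFrobenius_def] using h3)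
  rw [h4, one_smul] at hz
  exact val_inj hz.symm

lemma commute_of_commute_proj {A B : Matrix.SpecialLinearGroup ι F} {k : ℕ}
    (hA : A ^ ℓ ^ k = 1) (h : Commute (proj A) (proj B)) : Commute A B := by
  have h1 : proj (B * A * B⁻¹) = proj A := by
    change proj B * proj A * (proj B)⁻¹ = proj A
    rw [← h.eq, mul_inv_cancel_right]
  have h2 := eq_of_proj_eq ℓ (k := k) (by rw [conj_pow, hA]; simp) hA h1
  exact (mul_inv_eq_iff_eq_mul.1 h2).symm

lemma pow_eq_one_of_val_eq {A : Matrix.SpecialLinearGroup ι F} {N : Matrix ι ι F} {k : ℕ}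
    (hA : A.1 = 1 + N) (hN : N ^ ℓ ^ k = 0) : A ^ ℓ ^ k = 1 := by
  rcases isEmpty_or_nonempty ι with hι | hι
  · exact Subsingleton.elim _ _
  apply val_inj
  rw [val_pow, hA, add_pow_char_pow_of_commute ℓ k (Commute.one_left N), hN, val_one]
  simp

lemma pow_eq_one_of_sq_eq_zero {A : Matrix.SpecialLinearGroup ι F} {N : Matrix ι ι F}
    (hA : A.1 = 1 + N) (hN : N * N = 0) : A ^ ℓ ^ 1 = 1 := by
  refine pow_eq_one_of_val_eq ℓ hA (pow_eq_zero_of_le ?_ ((sq N).trans hN))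
  simpa using (Fact.out : ℓ.Prime).two_le

open Matrix.SpecialLinearGroup in
lemma transvection_pow_eq_one {i j : ι} (hij : i ≠ j) (a : F) :
    (transvection hij a) ^ ℓ ^ 1 = 1 :=
  pow_eq_one_of_sq_eq_zero ℓ (transvection_coe hij a) (single_mul_single_of_ne _ _ _ _ hij.symm _)

end Unipotent

section Heisenberg

variable {ι F : Type*} [DecidableEq ι] [Fintype ι] [Field F]

/-- The matrices which differ from the identity only in row `i` and column `j`, and
fix the `i`-th basis vector and the `j`-th coordinate. -/
def heisenbergSubmonoid (i j : ι) : Submonoid (Matrix.SpecialLinearGroup ι F) where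
  carrier := {A | ∀ k l, (l = i ∨ k = j ∨ (k ≠ i ∧ l ≠ j)) → (A.1 - 1) k l = 0}
  one_mem' := by intro k l _; simp
  mul_mem' := by
    intro A B hA hB k l h
    have : (A * B).1 - 1 = (A.1 - 1) + (B.1 - 1) + (A.1 - 1) * (B.1 - 1) := by
      rw [val_mul]; noncomm_ring
    rw [this, Matrix.add_apply, Matrix.add_apply, hA k l h, hB k l h, mul_apply,
      Finset.sum_eq_zero, add_zero, add_zero]
    intro m _
    rcases h with h | h | ⟨h, h'⟩
    · rw [hB _ _ (Or.inl h), mul_zero]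
    · rw [hA _ _ (Or.inr (Or.inl h)), zero_mul]
    · by_cases hm : m = j
      · rw [hB _ _ (Or.inr (Or.inl hm)), mul_zero]
      · rw [hA _ _ (Or.inr (Or.inr ⟨h, hm⟩)), zero_mul]

lemma pow_eq_one_of_mem_heisenbergSubmonoid (ℓ : ℕ) [Fact ℓ.Prime] [CharP F ℓ] {i j : ι}
    {A : Matrix.SpecialLinearGroup ι F} (hA : A ∈ heisenbergSubmonoid i j) : A ^ ℓ ^ 2 = 1 := by
  have hl := (Fact.out : ℓ.Prime).two_le
  have h3 : (A.1 - 1) ^ 3 = 0 := by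
    have h2 (k l) (h : k ≠ i) : ((A.1 - 1) * (A.1 - 1)) k l = 0 := by
      rw [mul_apply]
      refine Finset.sum_eq_zero fun m _ ↦ ?_
      by_cases hm : m = j
      · rw [hA _ _ (Or.inr (Or.inl hm)), mul_zero]
      · rw [hA _ _ (Or.inr (Or.inr ⟨h, hm⟩)), zero_mul]
    ext k l
    rw [pow_succ', sq, mul_apply, Matrix.zero_apply]
    refine Finset.sum_eq_zero fun m _ ↦ ?_
    by_cases hm : m = i
    · rw [hA _ _ (Or.inl hm), zero_mul]
    · rw [h2 _ _ hm, mul_zero]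
  exact pow_eq_one_of_val_eq ℓ (N := A.1 - 1) (by simp) (pow_eq_zero_of_le (by nlinarith) h3)

/-- The submonoid `heisenbergSubmonoid i j` as a subgroup. -/
def heisenberg [Finite F] (i j : ι) : Subgroup (Matrix.SpecialLinearGroup ι F) where
  __ := heisenbergSubmonoid i j
  inv_mem' := by
    intro A hA
    have : A⁻¹ ∈ Submonoid.powers A :=
      mem_powers_iff_mem_zpowers.2 (inv_mem (Subgroup.mem_zpowers A))
    exact (Submonoid.powers_le.2 hA) this

open Matrix.SpecialLinearGroup

lemma commute_single_of_commute_transvection {i j : ι} (hij : i ≠ j) {a : F} (ha : a ≠ 0)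
    {A : Matrix.SpecialLinearGroup ι F} (h : Commute (transvection hij a) A) (b : F) :
    Commute (single i j b) A.1 := by
  have h1 : (1 + single i j a) * A.1 = A.1 * (1 + single i j a) := congr_arg Subtype.val h.eq
  have h2 : single i j a * A.1 = A.1 * single i j a := by
    simpa [add_mul, mul_add] using h1
  have h3 : single i j b = (b / a) • single i j a := by simp [ha]
  rw [h3]
  exact Commute.smul_left h2 _

lemma commute_transvection_of_commute_single {i j : ι} (hij : i ≠ j) {a : F}
    {A : Matrix.SpecialLinearGroup ι F} (h : Commute (single i j a) A.1) :
    Commute (transvection hij a) A :=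
  val_inj ((Commute.one_left A.1).add_left h).eq

lemma eq_zero_of_proj_transvection_eq_one (ℓ : ℕ) [Fact ℓ.Prime] [CharP F ℓ] {i j : ι}
    (hij : i ≠ j) {a : F} (h : proj (transvection hij a) = 1) : a = 0 := by
  have h1 : proj (transvection hij a) = proj 1 := h
  have h2 := eq_of_proj_eq ℓ (transvection_pow_eq_one ℓ hij a) (one_pow _) h1
  have h3 : transvection hij a ∈ Subgroup.center _ := h2 ▸ one_mem _
  exact (transvection_mem_center_iff hij a).1 h3

variable [Finite F]

lemma isPGroup_heisenberg (ℓ : ℕ) [Fact ℓ.Prime] [CharP F ℓ] (i j : ι) :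
    IsPGroup ℓ (heisenberg i j : Subgroup (Matrix.SpecialLinearGroup ι F)) := fun A ↦
  ⟨2, Subtype.ext (pow_eq_one_of_mem_heisenbergSubmonoid ℓ A.2)⟩

lemma transvection_mem_heisenberg {i j k l : ι} (hkl : k ≠ l) (h : k = i ∨ l = j)
    (hl : l ≠ i) (hk : k ≠ j) (a : F) :
    transvection hkl a ∈ (heisenberg i j : Subgroup (Matrix.SpecialLinearGroup ι F)) := by
  intro k' l' h'
  rw [transvection_coe, add_sub_cancel_left, single_apply]
  grind

lemma exists_proj_eq_transvection (ℓ : ℕ) [Fact ℓ.Prime] [CharP F ℓ] {i j : ι} (hij : i ≠ j)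
    {A : Matrix.SpecialLinearGroup ι F}
    (h : ∀ u ∈ (heisenberg i j : Subgroup (Matrix.SpecialLinearGroup ι F)),
      Commute (proj u) (proj A)) : ∃ t : F, proj A = proj (transvection hij t) := by
  have hc {k l : ι} (hkl : k ≠ l) (h' : k = i ∨ l = j) (hl : l ≠ i) (hk : k ≠ j) :
      Commute (single k l 1) A.1 :=
    commute_single_of_commute_transvection hkl one_ne_zero
      (commute_of_commute_proj ℓ (transvection_pow_eq_one ℓ hkl 1)
        (h _ (transvection_mem_heisenberg hkl h' hl hk 1))) 1
  have hrow {k l : ι} (hk : k ≠ i) (hkl : l ≠ k) : A.1 k l = 0 :=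
    row_eq_zero_of_commute_single (hc hk.symm (Or.inl rfl) hk hij) hkl
  have hcol {k l : ι} (hk : l ≠ j) (hkl : k ≠ l) : A.1 k l = 0 :=
    col_eq_zero_of_commute_single (hc hk (Or.inr rfl) hij.symm hk) hkl
  have hdiag {k : ι} (hk : k ≠ i) : A.1 i i = A.1 k k :=
    diag_eq_of_commute_single (hc hk.symm (Or.inl rfl) hk hij)
  have hA : A.1 = A.1 i i • 1 + single i j (A.1 i j) := by
    ext k l
    simp only [Matrix.add_apply, Matrix.smul_apply, one_apply, single_apply, smul_eq_mul]
    by_cases hkl : k = l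
    · subst hkl
      have := @hdiag k
      grind
    · have := @hrow k l
      have := @hcol k l
      grind
  have h0 : A.1 i i ≠ 0 := fun h0 ↦ by
    refine zero_ne_one ((det_eq_zero_of_row_eq_zero j fun l ↦ ?_).symm.trans A.2)
    by_cases hl : l = j
    · rw [hl, ← hdiag hij.symm, h0]
    · exact hrow hij.symm hl
  have hA' : A.1 = A.1 i i • (transvection hij (A.1 i j / A.1 i i)).1 := by
    conv_lhs => rw [hA]
    rw [transvection_coe, smul_add, smul_single, smul_eq_mul, mul_div_cancel₀ _ h0]
  refine ⟨A.1 i j / A.1 i i, Eq.symm (proj_eq_iff.2 ⟨A.1 i i, ?_, hA'⟩)⟩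
  have h1 : A.1.det = 1 := A.2
  have h2 : (transvection hij (A.1 i j / A.1 i i)).1.det = 1 :=
    (transvection hij (A.1 i j / A.1 i i)).2
  rw [hA', det_smul, h2, mul_one] at h1
  exact h1

end Heisenberg

section Sylow

variable {ι F : Type*} [DecidableEq ι] [Fintype ι] [Field F] [Finite F]

open Matrix.SpecialLinearGroup

lemma exists_eq_proj_transvection_iff (ℓ : ℕ) [Fact ℓ.Prime] [CharP F ℓ] {i j : ι} (hij : i ≠ j)
    (P : Sylow ℓ (Matrix.ProjectiveSpecialLinearGroup ι F))
    (hP : (heisenberg i j).map (QuotientGroup.mk' _) ≤ P.1)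
    (x : Matrix.ProjectiveSpecialLinearGroup ι F) :
    (∃ t : F, x = proj (transvection hij t)) ↔ x ∈ P.1 ∧ ∀ y ∈ P.1, Commute x y := by
  have hmem (u) (hu : u ∈ heisenberg i j) : proj u ∈ P.1 :=
    hP (Subgroup.mem_map_of_mem (QuotientGroup.mk' _) hu)
  have htr (t : F) : transvection hij t ∈ heisenberg i j :=
    transvection_mem_heisenberg hij (Or.inl rfl) hij.symm hij t
  have hone : proj (1 : Matrix.SpecialLinearGroup ι F) = 1 := map_one _
  have key (x) (hx : ∀ y ∈ P.1, Commute x y) : ∃ t : F, x = proj (transvection hij t) := by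
    obtain ⟨A, rfl⟩ := proj_surjective x
    exact exists_proj_eq_transvection ℓ hij fun u hu ↦ (hx _ (hmem u hu)).symm
  refine ⟨?_, fun h ↦ key x h.2⟩
  rintro ⟨t, rfl⟩
  refine ⟨hmem _ (htr t), ?_⟩
  have hnt : Nontrivial P.1 := by
    refine ⟨⟨⟨proj (transvection hij 1), hmem _ (htr 1)⟩, 1, fun h ↦ ?_⟩⟩
    exact one_ne_zero (eq_zero_of_proj_transvection_eq_one ℓ hij (congr_arg Subtype.val h))
  have : Nontrivial (Subgroup.center P.1) := IsPGroup.center_nontrivial P.isPGroup'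
  obtain ⟨⟨⟨z, hzP⟩, hz⟩, hz1⟩ := exists_ne (1 : Subgroup.center P.1)
  have hzc (y) (hy : y ∈ P.1) : Commute z y :=
    (congr_arg Subtype.val (Subgroup.mem_center_iff.1 hz ⟨y, hy⟩)).symm
  obtain ⟨s, rfl⟩ := key z hzc
  have hs : s ≠ 0 := by
    rintro rfl
    apply hz1
    apply Subtype.ext
    apply Subtype.ext
    have : transvection hij (0 : F) = 1 := val_inj (by simp)
    change proj (transvection hij (0 : F)) = 1
    rw [this, hone]
  intro y hy
  obtain ⟨A, rfl⟩ := proj_surjective y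
  have hA := commute_of_commute_proj ℓ (transvection_pow_eq_one ℓ hij s) (hzc _ hy)
  exact (commute_transvection_of_commute_single hij
    (commute_single_of_commute_transvection hij hs hA t)).map (QuotientGroup.mk' _)

lemma exists_conj_transvection (ℓ : ℕ) [Fact ℓ.Prime] [CharP F ℓ]
    (φ : MulAut (Matrix.ProjectiveSpecialLinearGroup ι F)) {i j : ι} (hij : i ≠ j) :
    ∃ C : Matrix.SpecialLinearGroup ι F, ∀ a : F, ∃ t : F,
      φ (proj (transvection hij a)) = proj (C * transvection hij t * C⁻¹) := by
  obtain ⟨P, hP⟩ := ((isPGroup_heisenberg ℓ i j).map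
    (QuotientGroup.mk' (Subgroup.center (Matrix.SpecialLinearGroup ι F)))).exists_le_sylow
  obtain ⟨g, hg⟩ := MulAction.exists_smul_eq (Matrix.ProjectiveSpecialLinearGroup ι F) P (φ • P)
  obtain ⟨C, rfl⟩ := proj_surjective g
  refine ⟨C, fun a ↦ ?_⟩
  have hψ : ((MulAut.conj (proj C))⁻¹ * φ) • P = P := by
    rw [mul_smul, ← hg, Sylow.smul_def, inv_smul_smul]
  set ψ := (MulAut.conj (proj C))⁻¹ * φ with hψ'
  have hmem (x) (hx : x ∈ P.1) : ψ x ∈ P.1 := by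
    have : ψ • x ∈ (ψ • P).1 := Subgroup.smul_mem_pointwise_smul _ _ _ hx
    rwa [hψ] at this
  have hmem' (y) (hy : y ∈ P.1) : ∃ x ∈ P.1, ψ x = y := by
    have h1 : y ∈ (ψ • P).1 := by rwa [hψ]
    exact Subgroup.mem_smul_pointwise_iff_exists _ _ _ |>.1 h1
  have hx := (exists_eq_proj_transvection_iff ℓ hij P hP (proj (transvection hij a))).1 ⟨a, rfl⟩
  obtain ⟨t, ht⟩ := (exists_eq_proj_transvection_iff ℓ hij P hP (ψ (proj (transvection hij a)))).2
    ⟨hmem _ hx.1, fun y hy ↦ by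
      obtain ⟨x, hxP, rfl⟩ := hmem' y hy
      exact (hx.2 x hxP).map ψ⟩
  refine ⟨t, ?_⟩
  have h1 : φ (proj (transvection hij a)) =
      proj C * ψ (proj (transvection hij a)) * (proj C)⁻¹ := by
    rw [← MulAut.conj_apply, ← MulAut.mul_apply, hψ', mul_inv_cancel_left]
  rw [h1, ht]
  rfl

end Sylow

section Lift

variable {ι F : Type*} [DecidableEq ι] [Fintype ι] [Field F]

open Matrix.SpecialLinearGroup

lemma conj_eq_of_proj_eq (ℓ : ℕ) [Fact ℓ.Prime] [CharP F ℓ]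
    (φ : MulAut (Matrix.ProjectiveSpecialLinearGroup ι F))
    {g x y G X Y : Matrix.SpecialLinearGroup ι F} {k : ℕ} (hg : φ (proj g) = proj G)
    (hx : φ (proj x) = proj X) (hy : φ (proj y) = proj Y) (hX : X ^ ℓ ^ k = 1)
    (hY : Y ^ ℓ ^ k = 1) (h : g * x * g⁻¹ = y) : G * X * G⁻¹ = Y := by
  refine eq_of_proj_eq ℓ (k := k) (by rw [conj_pow, hX]; simp) hY ?_
  rw [← hy, ← h]
  simp only [proj, map_mul, map_inv] at hg hx ⊢
  rw [hg, hx]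

/-- `RootImage φ N τ` says that `φ` sends the root element `1 + a • E i j` to the class of
`1 + τ i j a • N i j`, where `N i j` is a matrix of rank one and square zero. -/
structure RootImage
    (φ : MulAut (Matrix.ProjectiveSpecialLinearGroup ι F))
    (N : ι → ι → Matrix ι ι F) (τ : ι → ι → F → F) : Prop where
  rank_one : ∀ i j, i ≠ j → ∃ u v, N i j = vecMulVec u v
  ne_zero : ∀ i j, i ≠ j → N i j ≠ 0
  sq_zero : ∀ i j, i ≠ j → N i j * N i j = 0
  map_one : ∀ i j, i ≠ j → τ i j 1 = 1
  map_proj : ∀ i j (hij : i ≠ j) a, ∃ B : Matrix.SpecialLinearGroup ι F,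
    B.1 = 1 + τ i j a • N i j ∧ φ (proj (transvection hij a)) = proj B

lemma exists_rootImage [Finite F] (ℓ : ℕ) [Fact ℓ.Prime] [CharP F ℓ]
    (φ : MulAut (Matrix.ProjectiveSpecialLinearGroup ι F)) : ∃ N τ, RootImage φ N τ := by
  have key (i j : ι) : ∃ (N : Matrix ι ι F) (τ : F → F), ∀ hij : i ≠ j,
      (∃ u v, N = vecMulVec u v) ∧ N ≠ 0 ∧ N * N = 0 ∧ τ 1 = 1 ∧
      ∀ a, ∃ B : Matrix.SpecialLinearGroup ι F,
        B.1 = 1 + τ a • N ∧ φ (proj (transvection hij a)) = proj B := by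
    by_cases hij : i = j
    · exact ⟨0, 0, fun h ↦ absurd hij h⟩
    obtain ⟨C, hC⟩ := exists_conj_transvection ℓ φ hij
    choose t ht using hC
    have ht1 : t 1 ≠ 0 := by
      intro h1
      have h2 := ht 1
      have h3 : transvection hij (0 : F) = 1 := val_inj (by simp)
      rw [h1, h3, mul_one, mul_inv_cancel] at h2
      exact one_ne_zero (eq_zero_of_proj_transvection_eq_one ℓ hij (φ.injective (h2.trans
        (map_one φ).symm)))
    set E := C.1 * single i j 1 * C⁻¹.1 with hE
    have hval (s : F) : (C * transvection hij s * C⁻¹).1 = 1 + s • E := by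
      have h1 : single i j s = s • single i j (1 : F) := by simp
      rw [val_mul, val_mul, transvection_coe, mul_add, add_mul, mul_one, val_mul_val_inv, hE, h1,
        Matrix.mul_smul, Matrix.smul_mul]
    have hE0 : E ≠ 0 := by
      intro h0
      have h1 : C⁻¹.1 * E * C.1 = single i j 1 := by
        rw [hE, mul_assoc, mul_assoc, mul_assoc, val_inv_mul_val, mul_one, ← mul_assoc,
          val_inv_mul_val, one_mul]
      rw [h0, mul_zero, zero_mul] at h1
      simpa using congr_fun (congr_fun h1 i) j
    have hEE : E * E = 0 := by
      calc E * E = C.1 * single i j 1 * (C⁻¹.1 * C.1) * single i j 1 * C⁻¹.1 := by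
            rw [hE]; simp only [mul_assoc]
        _ = 0 := by
            rw [val_inv_mul_val, mul_one, mul_assoc C.1,
              single_mul_single_of_ne _ _ _ _ (Ne.symm hij), mul_zero, zero_mul]
    refine ⟨t 1 • E, fun a ↦ t a / t 1, fun _ ↦ ⟨?_, smul_ne_zero ht1 hE0, ?_, div_self ht1, ?_⟩⟩
    · rw [hE, single_eq_single_vecMulVec_single, mul_vecMulVec, vecMulVec_mul, ← smul_vecMulVec]
      exact ⟨_, _, rfl⟩
    · rw [Matrix.smul_mul, Matrix.mul_smul, hEE, smul_zero, smul_zero]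
    · exact fun a ↦ ⟨_, (hval (t a)).trans (by rw [smul_smul, div_mul_cancel₀ _ ht1]), ht a⟩
  choose N τ h using key
  exact ⟨N, τ, ⟨fun i j hij ↦ (h i j hij).1, fun i j hij ↦ (h i j hij).2.1,
    fun i j hij ↦ (h i j hij).2.2.1, fun i j hij ↦ (h i j hij).2.2.2.1,
    fun i j hij ↦ (h i j hij).2.2.2.2⟩⟩

omit [DecidableEq ι] in
lemma mul_eq_zero_or_of_mul_mul_eq_zero {N N' : Matrix ι ι F} (hN : ∃ u v, N = vecMulVec u v)
    (hN' : ∃ u v, N' = vecMulVec u v) (h : N * N' * N = 0) : N * N' = 0 ∨ N' * N = 0 := by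
  obtain ⟨u, v, rfl⟩ := hN
  obtain ⟨u', v', rfl⟩ := hN'
  simp only [vecMulVec_mul_vecMulVec, smul_dotProduct, smul_eq_mul, _root_.mul_eq_zero,
    smul_eq_zero, vecMulVec_eq_zero] at h ⊢
  tauto

lemma mul_eq_zero_of_commute {N N' : Matrix ι ι F} (hN : ∃ u v, N = vecMulVec u v)
    (hN' : ∃ u v, N' = vecMulVec u v) (h0 : N * N = 0) (h : Commute N N') : N * N' = 0 := by
  rcases mul_eq_zero_or_of_mul_mul_eq_zero hN hN'
    (by rw [h.eq, mul_assoc, h0, mul_zero]) with h1 | h1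
  · exact h1
  · rw [h.eq, h1]

/-- The relations satisfied by the images of the root elements under an automorphism. -/
structure RootRel (N : ι → ι → Matrix ι ι F) (τ : ι → ι → F → F) : Prop where
  rank_one : ∀ i j, i ≠ j → ∃ u v, N i j = vecMulVec u v
  ne_zero : ∀ i j, i ≠ j → N i j ≠ 0
  sq_zero : ∀ i j, i ≠ j → N i j * N i j = 0
  map_one : ∀ i j, i ≠ j → τ i j 1 = 1
  map_add : ∀ i j, i ≠ j → ∀ a b, τ i j (a + b) = τ i j a + τ i j b
  mul_zero : ∀ i j k l, i ≠ j → k ≠ l → i ≠ l → j ≠ k → N i j * N k l = 0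
  comm : ∀ i j k, i ≠ j → j ≠ k → i ≠ k → ∀ a b,
    τ i k (a * b) • N i k = (τ i j a * τ j k b) • (N i j * N j k - N j k * N i j)

namespace RootImage

variable {φ : MulAut (Matrix.ProjectiveSpecialLinearGroup ι F)} {N : ι → ι → Matrix ι ι F}
  {τ : ι → ι → F → F}

lemma pow_eq_one (ℓ : ℕ) [Fact ℓ.Prime] [CharP F ℓ] (h : RootImage φ N τ) {i j : ι} (hij : i ≠ j)
    {t : F} {B : Matrix.SpecialLinearGroup ι F} (hB : B.1 = 1 + t • N i j) : B ^ ℓ ^ 1 = 1 :=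
  pow_eq_one_of_sq_eq_zero ℓ hB (by simp [h.sq_zero i j hij])

lemma commute (ℓ : ℕ) [Fact ℓ.Prime] [CharP F ℓ] (h : RootImage φ N τ) {i j k l : ι}
    (hij : i ≠ j) (hkl : k ≠ l) :
    Commute (N i j) (N k l) ↔ Commute (transvection hij (1 : F)) (transvection hkl 1) := by
  obtain ⟨B, hB, hφB⟩ := h.map_proj i j hij 1
  obtain ⟨C, hC, hφC⟩ := h.map_proj k l hkl 1
  have h1 : Commute B C ↔ Commute (N i j) (N k l) := by
    have : Commute B C ↔ B.1 * C.1 = C.1 * B.1 :=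
      ⟨fun h ↦ congr_arg Subtype.val h.eq, fun h ↦ val_inj h⟩
    rw [this, hB, hC, h.map_one i j hij, h.map_one k l hkl, one_smul, one_smul]
    simp only [mul_add, add_mul, mul_one, one_mul, commute_iff_eq]
    constructor
    · intro h; rw [← sub_eq_zero] at h ⊢; rw [← h]; abel
    · intro h; rw [← sub_eq_zero] at h ⊢; rw [← h]; abel
  rw [← h1]
  constructor
  · intro h2
    refine commute_of_commute_proj ℓ (transvection_pow_eq_one ℓ hij 1) ?_
    have h3 : Commute (φ (proj (transvection hij (1 : F)))) (φ (proj (transvection hkl 1))) := by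
      rw [hφB, hφC]; exact h2.map (QuotientGroup.mk' _)
    simpa using h3.map φ.symm
  · intro h2
    refine commute_of_commute_proj ℓ (h.pow_eq_one ℓ hij hB) ?_
    rw [← hφB, ← hφC]
    exact (h2.map (QuotientGroup.mk' _)).map φ

lemma map_add (ℓ : ℕ) [Fact ℓ.Prime] [CharP F ℓ] (h : RootImage φ N τ) {i j : ι}
    (hij : i ≠ j) (a b : F) : τ i j (a + b) = τ i j a + τ i j b := by
  obtain ⟨A, hA, hφA⟩ := h.map_proj i j hij a
  obtain ⟨B, hB, hφB⟩ := h.map_proj i j hij b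
  obtain ⟨C, hC, hφC⟩ := h.map_proj i j hij (a + b)
  have h1 : (A * B).1 = 1 + (τ i j a + τ i j b) • N i j := by
    rw [val_mul, hA, hB]
    simp only [mul_add, add_mul, mul_one, one_mul, Matrix.smul_mul, Matrix.mul_smul,
      h.sq_zero i j hij, smul_zero, add_smul]
    abel
  have h2 : C = A * B := by
    refine eq_of_proj_eq ℓ (h.pow_eq_one ℓ hij hC) (h.pow_eq_one ℓ hij h1) ?_
    rw [← hφC, transvection_add]
    simp only [proj, map_mul] at hφA hφB ⊢
    rw [hφA, hφB]
  rw [h2, h1, add_right_inj] at hC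
  exact (smul_left_injective F (h.ne_zero i j hij) hC).symm

lemma mul_zero (ℓ : ℕ) [Fact ℓ.Prime] [CharP F ℓ] (h : RootImage φ N τ) {i j k l : ι}
    (hij : i ≠ j) (hkl : k ≠ l) (hil : i ≠ l) (hjk : j ≠ k) : N i j * N k l = 0 := by
  refine mul_eq_zero_of_commute (h.rank_one i j hij) (h.rank_one k l hkl) (h.sq_zero i j hij)
    ((h.commute ℓ hij hkl).2 (commute_transvection_of_commute_single hij ?_))
  refine (Commute.one_right _).add_right ?_
  rw [commute_iff_eq, single_mul_single_of_ne _ _ _ _ hjk, single_mul_single_of_ne _ _ _ _ hil.symm]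

lemma comm (ℓ : ℕ) [Fact ℓ.Prime] [CharP F ℓ] (h : RootImage φ N τ) {i j k : ι}
    (hij : i ≠ j) (hjk : j ≠ k) (hik : i ≠ k) (a b : F) :
    τ i k (a * b) • N i k = (τ i j a * τ j k b) • (N i j * N j k - N j k * N i j) := by
  obtain ⟨A, hA, hφA⟩ := h.map_proj i j hij a
  obtain ⟨B, hB, hφB⟩ := h.map_proj j k hjk b
  obtain ⟨C, hC, hφC⟩ := h.map_proj i k hik (a * b)
  have h1 := h.mul_zero ℓ hik hjk hik hjk.symm
  have h2 := h.mul_zero ℓ hjk hik hjk hik.symm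
  have h3 := h.mul_zero ℓ hik hij hij hik.symm
  have hCB : (C * B).1 = 1 + (τ i k (a * b) • N i k + τ j k b • N j k) := by
    rw [val_mul, hC, hB]
    simp only [mul_add, add_mul, mul_one, one_mul, Matrix.smul_mul, Matrix.mul_smul,
      h1, smul_zero]
    abel
  have h4 : A * B * A⁻¹ = C * B := by
    refine conj_eq_of_proj_eq ℓ φ hφA hφB (y := transvection hik (a * b) * transvection hjk b) ?_
      (h.pow_eq_one ℓ hjk hB) (pow_eq_one_of_sq_eq_zero ℓ hCB ?_) ?_
    · simp only [proj, map_mul] at hφC hφB ⊢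
      rw [hφC, hφB]
    · simp [mul_add, add_mul, h1, h2, h.sq_zero i k hik, h.sq_zero j k hjk]
    · rw [mul_inv_eq_iff_eq_mul]
      apply val_inj
      simp only [val_mul, transvection_coe, mul_add, add_mul, mul_one, one_mul,
        single_mul_single_same,
        single_mul_single_of_ne _ _ _ _ hik.symm, single_mul_single_of_ne _ _ _ _ hjk.symm,
        Matrix.zero_mul]
      abel
  have h5 : A.1 * B.1 = (C * B).1 * A.1 := by
    rw [← val_mul, ← val_mul, ← h4, inv_mul_cancel_right]
  rw [hCB, hA, hB] at h5
  simp only [mul_add, add_mul, mul_one, one_mul, Matrix.smul_mul, Matrix.mul_smul, h3, smul_zero,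
    smul_smul] at h5
  rw [smul_sub, mul_comm (τ i j a)]
  rw [mul_comm (τ i j a)] at h5
  rw [← sub_eq_zero] at h5 ⊢
  rw [← neg_eq_zero, ← h5]
  abel

lemma rootRel (ℓ : ℕ) [Fact ℓ.Prime] [CharP F ℓ] (h : RootImage φ N τ) : RootRel N τ where
  rank_one := h.rank_one
  ne_zero := h.ne_zero
  sq_zero := h.sq_zero
  map_one := h.map_one
  map_add _ _ hij := h.map_add ℓ hij
  mul_zero _ _ _ _ := h.mul_zero ℓ
  comm _ _ _ := h.comm ℓ

end RootImage

end Lift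

section MatrixUnits

variable {ι F : Type*} [DecidableEq ι] [Fintype ι] [Field F]

lemma exists_units_conj_single [Nontrivial ι] {N : ι → ι → Matrix ι ι F} {b : ι → ι → F}
    (hb0 : ∀ i, b i ≠ 0) (hself : ∀ i j, i ≠ j → N i j *ᵥ b j = b i)
    (hne : ∀ i j k, i ≠ j → k ≠ j → N i j *ᵥ b k = 0) :
    ∃ g : (Matrix ι ι F)ˣ, ∀ i j, i ≠ j → N i j = g.1 * single i j 1 * g⁻¹.1 := by
  have hli : LinearIndependent F b := by
    rw [Fintype.linearIndependent_iff]
    intro c hc j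
    obtain ⟨i, hij⟩ := exists_ne j
    have h1 : N i j *ᵥ ∑ k, c k • b k = c j • b i := by
      rw [mulVec_sum, Finset.sum_eq_single j]
      · rw [mulVec_smul, hself i j hij]
      · intro k _ hk
        rw [mulVec_smul, hne i j k hij hk, smul_zero]
      · simp
    rw [hc, mulVec_zero] at h1
    exact (smul_eq_zero.1 h1.symm).resolve_right (hb0 i)
  obtain ⟨g, hg⟩ : IsUnit ((of b)ᵀ) := linearIndependent_cols_iff_isUnit.1 hli
  refine ⟨g, fun i j hij ↦ ?_⟩
  rw [Units.eq_mul_inv_iff_mul_eq, hg]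
  ext k l
  have h1 : (N i j * (of b)ᵀ) k l = (N i j *ᵥ b l) k := rfl
  rw [h1]
  by_cases hl : l = j
  · subst hl
    rw [hself i l hij, mul_single_apply_same, mul_one]
    rfl
  · rw [hne i j l hij hl, mul_single_apply_of_ne _ _ _ _ _ hl]
    rfl

omit [DecidableEq ι] [Fintype ι] in
lemma exists_ringEquiv [Finite F] (α : F → F) (h1 : α 1 = 1)
    (hadd : ∀ a b, α (a + b) = α a + α b) (hmul : ∀ a b, α (a * b) = α a * α b) :
    ∃ β : F ≃+* F, ∀ a, β a = α a := by
  let β : F →+* F := RingHom.mk' ⟨⟨α, h1⟩, hmul⟩ hadd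
  exact ⟨RingEquiv.ofBijective β (Finite.injective_iff_bijective.1 β.injective), fun _ ↦ rfl⟩

omit [DecidableEq ι] in
lemma mul_mul_ne_zero {X Y Z : Matrix ι ι F} (hY : ∃ u v, Y = vecMulVec u v)
    (hXY : X * Y ≠ 0) (hYZ : Y * Z ≠ 0) : X * Y * Z ≠ 0 := by
  obtain ⟨u, v, rfl⟩ := hY
  simp only [mul_vecMulVec, vecMulVec_mul, ne_eq, vecMulVec_eq_zero] at *
  tauto

end MatrixUnits

namespace RootRel

variable {ι F : Type*} [Fintype ι] [Field F] {N : ι → ι → Matrix ι ι F}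
  {τ : ι → ι → F → F}

lemma neg_transpose (h : RootRel N τ) : RootRel (fun i j ↦ -(N i j)ᵀ) τ where
  rank_one i j hij := by
    obtain ⟨u, v, huv⟩ := h.rank_one i j hij
    exact ⟨-v, u, by rw [huv, transpose_vecMulVec, neg_vecMulVec]⟩
  ne_zero i j hij := by simpa using h.ne_zero i j hij
  sq_zero i j hij := by
    rw [neg_mul_neg, ← transpose_mul, h.sq_zero i j hij, transpose_zero]
  map_one := h.map_one
  map_add := h.map_add
  mul_zero i j k l hij hkl hil hjk := by
    rw [neg_mul_neg, ← transpose_mul, h.mul_zero k l i j hkl hij hjk.symm hil.symm, transpose_zero]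
  comm i j k hij hjk hik a b := by
    rw [neg_mul_neg, neg_mul_neg, ← transpose_mul, ← transpose_mul, ← transpose_sub, smul_neg,
      ← transpose_smul, h.comm i j k hij hjk hik, transpose_smul, ← smul_neg, ← transpose_neg,
      neg_sub]

lemma bracket (h : RootRel N τ) {i j k : ι} (hij : i ≠ j) (hjk : j ≠ k) (hik : i ≠ k) :
    N i k = N i j * N j k - N j k * N i j := by
  simpa [h.map_one i k hik, h.map_one i j hij, h.map_one j k hjk] using h.comm i j k hij hjk hik 1 1

lemma mul_eq_zero_or (h : RootRel N τ) {i j k : ι} (hij : i ≠ j) (hjk : j ≠ k) (hik : i ≠ k) :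
    N j k * N i j = 0 ∨ N i j * N j k = 0 := by
  refine mul_eq_zero_or_of_mul_mul_eq_zero (h.rank_one j k hjk) (h.rank_one i j hij) ?_
  have h1 := h.mul_zero j k i k hjk hik hjk hik.symm
  rw [h.bracket hij hjk hik, mul_sub, ← mul_assoc, ← mul_assoc, h.sq_zero j k hjk, Matrix.zero_mul,
    sub_zero] at h1
  exact h1

/-- The positive sign for the triple `i, j, k` -/
def Pos (N : ι → ι → Matrix ι ι F) (i j k : ι) : Prop := N j k * N i j = 0

lemma eq_mul (h : RootRel N τ) {i j k : ι} (hij : i ≠ j) (hjk : j ≠ k) (hik : i ≠ k)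
    (hp : Pos N i j k) : N i j * N j k = N i k := by
  rw [h.bracket hij hjk hik, show _ = _ from hp, sub_zero]

lemma of_not_pos (h : RootRel N τ) {i j k : ι} (hij : i ≠ j) (hjk : j ≠ k) (hik : i ≠ k)
    (hp : ¬ Pos N i j k) : N i j * N j k = 0 ∧ N i k = -(N j k * N i j) := by
  have h1 := (h.mul_eq_zero_or hij hjk hik).resolve_left hp
  exact ⟨h1, by rw [h.bracket hij hjk hik, h1, zero_sub]⟩

lemma Pos.rotate (h : RootRel N τ) {i j k : ι} (hij : i ≠ j) (hjk : j ≠ k) (hik : i ≠ k)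
    (hp : Pos N i j k) : Pos N j k i := by
  by_contra hn
  obtain ⟨h1, h2⟩ := h.of_not_pos hjk hik.symm hij.symm hn
  have h3 : N i k * N j i = 0 := by
    rw [← h.eq_mul hij hjk hik hp, mul_assoc, h.mul_zero j k j i hjk hij.symm hij.symm hjk.symm,
      Matrix.mul_zero]
  have h4 : N j i * N i k = 0 := by
    rw [h2, Matrix.neg_mul, mul_assoc, h.mul_zero j k i k hjk hik hjk hik.symm, Matrix.mul_zero,
      neg_zero]
  exact h.ne_zero j k hjk (by rw [h.bracket hij.symm hik hjk, h3, h4, sub_zero])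

lemma Pos.reverse (h : RootRel N τ) {i j k : ι} (hij : i ≠ j) (hjk : j ≠ k) (hik : i ≠ k)
    (hp : Pos N i j k) : Pos N k j i := by
  by_contra hn
  obtain ⟨-, h2⟩ := h.of_not_pos hjk.symm hij.symm hik.symm hn
  have hp' := (hp.rotate h hij hjk hik).rotate h hjk hik.symm hij.symm
  refine h.ne_zero k j hjk.symm ?_
  rw [← h.eq_mul hik.symm hij hjk.symm hp', h2, Matrix.neg_mul, mul_assoc,
    h.mul_zero k j i j hjk.symm hij hjk.symm hij.symm, Matrix.mul_zero, neg_zero]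

lemma Pos.congr_right (h : RootRel N τ) {i j k l : ι} (hij : i ≠ j) (hjk : j ≠ k) (hik : i ≠ k)
    (hil : i ≠ l) (hjl : j ≠ l) (hp : Pos N i j k) : Pos N i j l := by
  by_contra hn
  refine mul_mul_ne_zero (h.rank_one i j hij) hn (Z := N j k) ?_ ?_
  · rw [h.eq_mul hij hjk hik hp]
    exact h.ne_zero i k hik
  · rw [mul_assoc, h.eq_mul hij hjk hik hp, h.mul_zero j l i k hjl hik hjk hil.symm]

lemma pos_of_pos (h : RootRel N τ) {i j k : ι} (hij : i ≠ j) (hjk : j ≠ k) (hik : i ≠ k)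
    (hp : Pos N i j k) {a b c : ι} (hab : a ≠ b) (hbc : b ≠ c) (hac : a ≠ c) : Pos N a b c := by
  have hT {i j k : ι} (hij : i ≠ j) (hjk : j ≠ k) (hik : i ≠ k) (hp : Pos N i j k) {l : ι}
      (hjl : j ≠ l) (m : ι) (hjm : j ≠ m) (hlm : l ≠ m) : Pos N j l m := by
    by_cases hli : i = l
    · subst hli
      exact ((hp.reverse h hij hjk hik).rotate h hjk.symm hij.symm hik.symm).congr_right h hij.symm
        hik hjk hjm hlm
    · exact ((hp.congr_right h hij hjk hik hli hjl).rotate h hij hjl hli).congr_right h hjl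
        (Ne.symm hli) hij.symm hjm hlm
  by_cases haj : j = a
  · subst haj
    exact hT hij hjk hik hp hab c hac hbc
  · obtain ⟨m, hm1, hm2⟩ : ∃ m, j ≠ m ∧ a ≠ m := by
      by_cases hai : a = i
      · exact ⟨k, hjk, hai ▸ hik⟩
      · exact ⟨i, hij.symm, hai⟩
    exact hT haj hm2 hm1 (hT hij hjk hik hp haj m hm1 hm2) hab c hac hbc

variable [DecidableEq ι] [Finite F]

lemma exists_of_pos (h : RootRel N τ) {o p q : ι} (hop : o ≠ p) (hpq : p ≠ q) (hoq : o ≠ q)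
    (hp : ∀ i j k, i ≠ j → j ≠ k → i ≠ k → Pos N i j k) :
    ∃ (g : (Matrix ι ι F)ˣ) (α : F ≃+* F), ∀ i j, i ≠ j → ∀ a,
      τ i j a • N i j = g.1 * single i j (α a) * g⁻¹.1 := by
  have : Nontrivial ι := ⟨o, p, hop⟩
  have mul_same {i j k} (hij : i ≠ j) (hjk : j ≠ k) (hik : i ≠ k) : N i j * N j k = N i k :=
    h.eq_mul hij hjk hik (hp i j k hij hjk hik)
  have mul_of_ne {i j k l} (hij : i ≠ j) (hkl : k ≠ l) (hjk : j ≠ k) : N i j * N k l = 0 := by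
    by_cases hil : i = l
    · subst hil
      exact hp k i j hkl hij hjk.symm
    · exact h.mul_zero i j k l hij hkl hil hjk
  have mul_diag {i j k} (hij : i ≠ j) (hik : i ≠ k) : N i j * N j i = N i k * N k i := by
    by_cases hjk : j = k
    · rw [hjk]
    · rw [← mul_same hik (Ne.symm hjk) hij, mul_assoc, mul_same (Ne.symm hjk) hij.symm hik.symm]
  have mul_diag_self {i} (hi : i ≠ o) : N i o * (N o p * N p o) = N i o := by
    by_cases hip : i = p
    · subst hip
      rw [mul_diag hop hoq, ← mul_assoc, mul_same hop.symm hoq hpq, mul_same hpq hoq.symm hi]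
    · rw [← mul_assoc, mul_same hi hop hip, mul_same hip hop.symm hi]
  obtain ⟨w, hw⟩ : ∃ w, N p o *ᵥ w ≠ 0 := by
    by_contra! hc
    exact h.ne_zero p o hop.symm (Matrix.ext_of_mulVec_single fun i ↦ by rw [hc, zero_mulVec])
  obtain ⟨b, hbo, hb⟩ : ∃ b : ι → ι → F, b o = (N o p * N p o) *ᵥ w ∧
      ∀ k, k ≠ o → b k = N k o *ᵥ w :=
    ⟨fun k ↦ if k = o then (N o p * N p o) *ᵥ w else N k o *ᵥ w, by simp, fun k hk ↦ by simp [hk]⟩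
  have hself (i j) (hij : i ≠ j) : N i j *ᵥ b j = b i := by
    by_cases hj : j = o
    · subst hj
      rw [hbo, hb i hij, mulVec_mulVec, mul_diag_self hij]
    · rw [hb j hj, mulVec_mulVec]
      by_cases hi : i = o
      · subst hi
        rw [hbo, mul_diag hij hop]
      · rw [hb i hi, mul_same hij hj hi]
  have hne (i j k) (hij : i ≠ j) (hkj : k ≠ j) : N i j *ᵥ b k = 0 := by
    by_cases hk : k = o
    · subst hk
      rw [hbo, mulVec_mulVec, ← mul_assoc, mul_of_ne hij hop hkj.symm, Matrix.zero_mul, zero_mulVec]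
    · rw [hb k hk, mulVec_mulVec, mul_of_ne hij hk hkj.symm, zero_mulVec]
  have hb0 (k) : b k ≠ 0 := by
    intro h0
    by_cases hk : p = k
    · exact hw (by rw [← hb p hop.symm, hk, h0])
    · exact hw (by rw [← hb p hop.symm, ← hself p k hk, h0, mulVec_zero])
  obtain ⟨g, hg⟩ := exists_units_conj_single hb0 hself hne
  have hτ {i j k} (hij : i ≠ j) (hjk : j ≠ k) (hik : i ≠ k) (a c : F) :
      τ i k (a * c) = τ i j a * τ j k c := by
    have h1 := h.comm i j k hij hjk hik a c
    rw [← h.bracket hij hjk hik] at h1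
    exact smul_left_injective F (h.ne_zero i k hik) h1
  have hτr {i j k} (hij : i ≠ j) (hjk : j ≠ k) (hik : i ≠ k) : τ i k = τ i j := by
    ext a
    have := hτ hij hjk hik a 1
    rwa [mul_one, h.map_one j k hjk, mul_one] at this
  have hτl {i j k} (hij : i ≠ j) (hjk : j ≠ k) (hik : i ≠ k) : τ i k = τ j k := by
    ext a
    have := hτ hij hjk hik 1 a
    rwa [one_mul, h.map_one i j hij, one_mul] at this
  obtain ⟨α, hα⟩ := exists_ringEquiv (τ o p) (h.map_one o p hop) (h.map_add o p hop)
    (fun a c ↦ by rw [hτ hoq hpq.symm hop, ← hτl hoq hpq.symm hop, hτr hop hpq hoq])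
  have hrow {i j k} (hij : i ≠ j) (hik : i ≠ k) : τ i j = τ i k := by
    by_cases hjk : j = k
    · rw [hjk]
    · exact (hτr hij hjk hik).symm
  have hτ_eq {i j} (hij : i ≠ j) (hjo : j ≠ o) : τ i j = τ o p := by
    by_cases hio : i = o
    · subst hio
      exact hrow hij hop
    · rw [hτl hio hjo.symm hij, hrow hjo.symm hop]
  have hτα (i j) (hij : i ≠ j) : τ i j = τ o p := by
    by_cases hjo : j = o
    · by_cases hip : i = p
      · rw [hrow hij (hip ▸ hpq : i ≠ q), hτ_eq (hip ▸ hpq) hoq.symm]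
      · rw [hrow hij hip, hτ_eq hip hop.symm]
    · exact hτ_eq hij hjo
  refine ⟨g, α, fun i j hij a ↦ ?_⟩
  have h1 : single i j (τ o p a) = τ o p a • single i j (1 : F) := by simp
  rw [hα, hg i j hij, hτα i j hij, h1, Matrix.mul_smul, Matrix.smul_mul]

theorem exists_conj (h : RootRel N τ) {o p q : ι} (hop : o ≠ p) (hpq : p ≠ q) (hoq : o ≠ q) :
    ∃ (g : (Matrix ι ι F)ˣ) (α : F ≃+* F),
      (∀ i j, i ≠ j → ∀ a, τ i j a • N i j = g.1 * single i j (α a) * g⁻¹.1) ∨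
      (∀ i j, i ≠ j → ∀ a, τ i j a • N i j = -(g.1 * single j i (α a) * g⁻¹.1)) := by
  by_cases hN : Pos N o p q
  · obtain ⟨g, α, hg⟩ := h.exists_of_pos hop hpq hoq fun i j k hij hjk hik ↦
      h.pos_of_pos hop hpq hoq hN hij hjk hik
    exact ⟨g, α, Or.inl hg⟩
  · have h' := h.neg_transpose
    have hN' : Pos (fun i j ↦ -(N i j)ᵀ) o p q := by
      rw [Pos, neg_mul_neg, ← transpose_mul, (h.of_not_pos hop hpq hoq hN).1, transpose_zero]
    obtain ⟨g, α, hg⟩ := h'.exists_of_pos hop hpq hoq fun i j k hij hjk hik ↦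
      h'.pos_of_pos hop hpq hoq hN' hij hjk hik
    refine ⟨⟨(g⁻¹.1)ᵀ, g.1ᵀ, by rw [← transpose_mul]; simp, by rw [← transpose_mul]; simp⟩, α,
      Or.inr fun i j hij a ↦ ?_⟩
    have := congr_arg transpose (hg i j hij a)
    rw [transpose_smul, transpose_neg, transpose_transpose, transpose_mul, transpose_mul,
      transpose_single, smul_neg, neg_eq_iff_eq_neg, ← mul_assoc] at this
    exact this

end RootRel

section RankTwo

variable {ι F : Type*} [DecidableEq ι] [Fintype ι] [Field F]

open Matrix.SpecialLinearGroup

lemma weyl_eq {R : Type*} [Ring R] [Algebra F R] {x y : R} (hx : x * x = 0)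
    (hxy : x * y * x = x) {a : F} (ha : a ≠ 0) :
    (1 + a • x) * (1 + -a⁻¹ • y) * (1 + a • x) = 1 + a • x - a⁻¹ • y - x * y - y * x := by
  simp only [add_mul, mul_add, one_mul, mul_one, smul_mul_assoc, mul_smul_comm, hx, hxy, smul_zero]
  match_scalars <;> field_simp
  ring

lemma weyl_relation {R : Type*} [Ring R] [Algebra F R] {x y : R} (hx : x * x = 0) (hy : y * y = 0)
    (hxy : x * y * x = x) (hyx : y * x * y = y) {a : F} (ha : a ≠ 0) (c : F) :
    (1 + a • x) * (1 + -a⁻¹ • y) * (1 + a • x) * (1 + c • x) =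
      (1 + -(c / a ^ 2) • y) * ((1 + a • x) * (1 + -a⁻¹ • y) * (1 + a • x)) := by
  have h2 : y * x * x = 0 := by rw [mul_assoc, hx, mul_zero]
  rw [weyl_eq hx hxy ha]
  simp only [add_mul, mul_add, sub_mul, mul_sub, one_mul, mul_one, smul_mul_assoc, mul_smul_comm,
    hx, hy, hxy, hyx, ← mul_assoc, h2, smul_zero, zero_mul]
  match_scalars <;> field_simp <;> ring

lemma weyl_mul_weyl {R : Type*} [Ring R] [Algebra F R] {x y : R} (hx : x * x = 0) (hy : y * y = 0)
    (hxy : x * y * x = x) (hyx : y * x * y = y) {a : F} (ha : a ≠ 0) :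
    (1 + a • x) * (1 + -a⁻¹ • y) * (1 + a • x) *
      ((1 + (-1 : F) • x) * (1 + -(-1 : F)⁻¹ • y) * (1 + (-1 : F) • x)) =
      1 + (a - 1) • (x * y) + (a⁻¹ - 1) • (y * x) := by
  have h1 : x * y * y = 0 := by rw [mul_assoc, hy, mul_zero]
  have h2 : y * x * x = 0 := by rw [mul_assoc, hx, mul_zero]
  rw [weyl_eq hx hxy ha, weyl_eq hx hxy (neg_ne_zero.2 one_ne_zero)]
  simp only [add_mul, mul_add, sub_mul, mul_sub, one_mul, mul_one, smul_mul_assoc, mul_smul_comm,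
    hx, hy, hxy, hyx, ← mul_assoc, h1, h2, smul_zero, zero_mul]
  match_scalars <;> field_simp <;> ring

lemma commute_of_weyl_relation {R : Type*} [Ring R] [Algebra F R] {x y : R} (hx : x * x = 0)
    (hy : y * y = 0) {s : F}
    (h : (1 + x) * (1 + s • y) * (1 + x) * (1 + x) =
      (1 + s • y) * ((1 + x) * (1 + s • y) * (1 + x)))
    (h0 : x * y = 0 ∨ y * x = 0) : Commute x y := by
  have h1 : (1 + x) * (1 + s • y) * (1 + x) * x = s • y * ((1 + x) * (1 + s • y) * (1 + x)) := by
    generalize (1 + x) * (1 + s • y) * (1 + x) = M at h ⊢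
    rw [mul_add, mul_one, add_mul 1 (s • y), one_mul] at h
    exact add_left_cancel h
  have h2 : y * x = 0 := by
    refine h0.elim (fun h0 ↦ ?_) id
    have h3 := congr_arg (y * ·) h1
    simp only [add_mul, mul_add, one_mul, mul_one, smul_mul_assoc, mul_smul_comm, hx, hy, h0,
      mul_assoc, mul_zero, smul_zero, add_zero, zero_add] at h3
    simpa only [← mul_assoc, hy, zero_mul, mul_zero, smul_zero, add_zero] using h3
  have h3 : x = s • y := by
    simp only [add_mul, mul_add, one_mul, mul_one, smul_mul_assoc, mul_smul_comm, hx, hy, h2,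
      mul_assoc, mul_zero, smul_zero, add_zero, zero_add] at h1
    simpa only [← mul_assoc, h2, zero_mul, smul_zero, add_zero] using h1
  rw [h3]
  exact (Commute.refl y).smul_left s

namespace RootImage

variable {φ : MulAut (Matrix.ProjectiveSpecialLinearGroup ι F)} {N : ι → ι → Matrix ι ι F}
  {τ : ι → ι → F → F}

lemma weyl (ℓ : ℕ) [Fact ℓ.Prime] [CharP F ℓ] (h : RootImage φ N τ) {i j : ι}
    (hij : i ≠ j) {a : F} (ha : a ≠ 0) (c : F) :
    (1 + τ i j a • N i j) * (1 + τ j i (-a⁻¹) • N j i) * (1 + τ i j a • N i j) *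
      (1 + τ i j c • N i j) = (1 + τ j i (-(c / a ^ 2)) • N j i) *
      ((1 + τ i j a • N i j) * (1 + τ j i (-a⁻¹) • N j i) * (1 + τ i j a • N i j)) := by
  obtain ⟨A, hA, hφA⟩ := h.map_proj i j hij a
  obtain ⟨B, hB, hφB⟩ := h.map_proj j i hij.symm (-a⁻¹)
  obtain ⟨C, hC, hφC⟩ := h.map_proj i j hij c
  obtain ⟨D, hD, hφD⟩ := h.map_proj j i hij.symm (-(c / a ^ 2))
  rw [← hA, ← hB, ← hC, ← hD]
  have h1 : (A * B * A) * C * (A * B * A)⁻¹ = D := by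
    refine conj_eq_of_proj_eq ℓ φ (g := transvection hij a * transvection hij.symm (-a⁻¹) *
      transvection hij a) ?_ hφC hφD (h.pow_eq_one ℓ hij hC) (h.pow_eq_one ℓ hij.symm hD) ?_
    · simp only [proj, map_mul] at hφA hφB ⊢
      rw [hφA, hφB]
    · rw [mul_inv_eq_iff_eq_mul]
      apply val_inj
      have hs (i j : ι) (t : F) : single i j t = t • single i j (1 : F) := by simp
      simp only [val_mul, transvection_coe]
      rw [hs i j a, hs i j c, hs j i, hs j i (-(c / a ^ 2))]
      exact weyl_relation (single_mul_single_of_ne _ _ _ _ hij.symm _)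
        (single_mul_single_of_ne _ _ _ _ hij _) (by simp) (by simp) ha c
  rw [← h1]
  simp only [← val_mul, inv_mul_cancel_right]

lemma mul_ne_zero_of_weyl (ℓ : ℕ) [Fact ℓ.Prime] [CharP F ℓ] (h : RootImage φ N τ) {i j : ι}
    (hij : i ≠ j) : N i j * N j i ≠ 0 ∧ N j i * N i j ≠ 0 := by
  have hnc : ¬ Commute (N i j) (N j i) := by
    rw [h.commute ℓ hij hij.symm]
    intro hc
    have h1 := commute_single_of_commute_transvection hij one_ne_zero hc 1
    have h2 := (commute_iff_eq _ _).1 h1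
    have h3 := congr_fun (congr_fun h2 i) i
    simp [transvection_coe, hij, one_apply_ne hij.symm] at h3
  have hw := h.weyl ℓ hij one_ne_zero 1
  rw [one_pow, div_one, inv_one, h.map_one i j hij, one_smul] at hw
  have h1 := mt (commute_of_weyl_relation (h.sq_zero i j hij) (h.sq_zero j i hij.symm) hw) hnc
  exact not_or.1 h1

end RootImage

lemma map_mul_of_map_sq_mul [Finite F] {α : F → F} (h1 : α 1 = 1)
    (hadd : ∀ a b, α (a + b) = α a + α b) (hsq : ∀ a b, α (a ^ 2 * b) = α a ^ 2 * α b) (a b : F) :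
    α (a * b) = α a * α b := by
  by_cases h2 : (2 : F) = 0
  · have : CharP F 2 := CharTwo.of_one_ne_zero_of_two_eq_zero one_ne_zero h2
    obtain ⟨c, rfl⟩ := isSquare_of_charTwo' a
    have h3 := hsq c 1
    rw [h1, mul_one, mul_one, sq] at h3
    rw [h3, ← hsq, sq]
  · have h3 := hsq (a + 1) b
    have h4 : (a + 1) ^ 2 * b = a ^ 2 * b + (a * b + a * b) + b := by ring
    rw [h4, hadd, hadd, hadd, hadd, h1, hsq] at h3
    apply mul_left_cancel₀ h2
    linear_combination h3

lemma weyl_entries {i j : ι} (hij : i ≠ j) {p q r s : F}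
    (h : (1 + p • single i j (1 : F)) * (1 + q • single j i 1) * (1 + p • single i j 1) *
      (1 + s • single i j 1) = (1 + r • single j i 1) * ((1 + p • single i j 1) *
      (1 + q • single j i 1) * (1 + p • single i j 1))) :
    (1 + p * q) * s = 0 ∧ q * s = r * (2 * p + p ^ 2 * q) := by
  have h1 := congr_fun (congr_fun h i) j
  have h2 := congr_fun (congr_fun h j) j
  simp [add_mul, mul_add, hij, hij.symm] at h1 h2
  constructor
  · linear_combination h1
  · linear_combination h2

namespace RootImage

variable {φ : MulAut (Matrix.ProjectiveSpecialLinearGroup ι F)} {N : ι → ι → Matrix ι ι F}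
  {τ : ι → ι → F → F}

theorem exists_conj_of_two [Finite F] (ℓ : ℕ) [Fact ℓ.Prime] [CharP F ℓ] (h : RootImage φ N τ)
    {o p : ι} (hop : o ≠ p) (hall : ∀ k, k = o ∨ k = p) :
    ∃ (g : (Matrix ι ι F)ˣ) (α : F ≃+* F), ∀ i j, i ≠ j → ∀ a,
      τ i j a • N i j = g.1 * single i j (α a) * g⁻¹.1 := by
  have : Nontrivial ι := ⟨o, p, hop⟩
  obtain ⟨hm, hm'⟩ := h.mul_ne_zero_of_weyl ℓ hop
  obtain ⟨κ, hκ⟩ : ∃ κ : F, N p o * N o p * N p o = κ • N p o := by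
    obtain ⟨u, v, huv⟩ := h.rank_one p o hop.symm
    exact ⟨(v ᵥ* N o p) ⬝ᵥ u, by
      rw [huv, vecMulVec_mul, vecMulVec_mul_vecMulVec, ← vecMulVec_smul]⟩
  have hκ0 : κ ≠ 0 := by
    rintro rfl
    exact mul_mul_ne_zero (h.rank_one o p hop) hm' hm (by rw [hκ, zero_smul])
  obtain ⟨w, hw⟩ : ∃ w, (N o p * N p o) *ᵥ w ≠ 0 := by
    by_contra! hc
    exact hm (Matrix.ext_of_mulVec_single fun i ↦ by rw [hc, zero_mulVec])
  obtain ⟨g, hg⟩ : ∃ g : (Matrix ι ι F)ˣ, ∀ i j, i ≠ j →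
      (if i = o then N o p else κ⁻¹ • N p o) = g.1 * single i j 1 * g⁻¹.1 := by
    refine exists_units_conj_single
      (b := fun k ↦ if k = o then (N o p * N p o) *ᵥ w else N p o *ᵥ w) ?_ ?_ ?_
    · intro i
      split_ifs
      · exact hw
      · intro h0
        exact hw (by rw [← mulVec_mulVec, h0, mulVec_zero])
    · intro i j hij
      rcases hall i with rfl | rfl
      · simp [hij.symm]
      · obtain rfl := (hall j).resolve_right hij.symm
        simp only [hij, if_true, if_false]
        rw [smul_mulVec, mulVec_mulVec, ← mul_assoc, hκ, smul_mulVec, inv_smul_smul₀ hκ0]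
    · intro i j k hij hkj
      rcases hall i with rfl | rfl
      · obtain rfl := (hall j).resolve_left hij.symm
        obtain rfl := (hall k).resolve_right hkj
        simp only [if_true]
        rw [mulVec_mulVec, ← mul_assoc, h.sq_zero _ _ hij, Matrix.zero_mul, zero_mulVec]
      · obtain rfl := (hall j).resolve_right hij.symm
        simp only [hij, hkj, if_false]
        obtain rfl := (hall k).resolve_left hkj
        rw [smul_mulVec, mulVec_mulVec, h.sq_zero _ _ hij, zero_mulVec, smul_zero]
  have hg1 := hg o p hop
  have hg2 := hg p o hop.symm
  rw [if_pos rfl] at hg1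
  rw [if_neg hop.symm, inv_smul_eq_iff₀ hκ0] at hg2
  have hτ {a : F} (ha : a ≠ 0) (c : F) :
      (1 + τ o p a * (κ * τ p o (-a⁻¹))) * τ o p c = 0 ∧ (κ * τ p o (-a⁻¹)) * τ o p c =
        (κ * τ p o (-(c / a ^ 2))) * (2 * τ o p a + τ o p a ^ 2 * (κ * τ p o (-a⁻¹))) := by
    refine weyl_entries hop ?_
    have hc1 (t : F) : g⁻¹.1 * (1 + t • N o p) * g.1 = 1 + t • single o p 1 := by
      rw [hg1]
      simp [mul_add, add_mul, mul_assoc]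
    have hc2 (t : F) : g⁻¹.1 * (1 + t • N p o) * g.1 = 1 + (κ * t) • single p o 1 := by
      rw [hg2]
      simp [mul_add, add_mul, mul_assoc, mul_comm]
    have h3 := congr_arg (fun M ↦ g⁻¹.1 * M * g.1) (h.weyl ℓ hop ha c)
    rw [← hc1, ← hc1, ← hc2, ← hc2]
    simp only [mul_assoc, Units.mul_inv_cancel_left] at h3 ⊢
    exact h3
  have h1 {a : F} (ha : a ≠ 0) : τ o p a * (κ * τ p o (-a⁻¹)) = -1 := by
    have := (hτ ha 1).1
    rw [h.map_one o p hop, mul_one] at this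
    linear_combination this
  have h2 {a : F} (ha : a ≠ 0) (c : F) :
      κ * τ p o (-(c / a ^ 2)) * τ o p a ^ 2 = - τ o p c := by
    linear_combination (- τ o p a) * (hτ ha c).2 +
      (τ o p c - κ * τ p o (-(c / a ^ 2)) * τ o p a ^ 2) * h1 ha
  have h3 (c : F) : κ * τ p o (-c) = - τ o p c := by
    simpa [h.map_one o p hop] using h2 one_ne_zero c
  have hadd := h.map_add ℓ hop
  have hzero : τ o p 0 = 0 := by simpa using hadd 0 0
  have hneg (c : F) : τ o p (-c) = - τ o p c := by
    rw [eq_neg_iff_add_eq_zero, ← hadd, neg_add_cancel, hzero]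
  have hsq (a b : F) : τ o p (a ^ 2 * b) = τ o p a ^ 2 * τ o p b := by
    by_cases ha : a = 0
    · simp [ha, hzero]
    · have h4 := h2 ha (a ^ 2 * b)
      rw [mul_div_cancel_left₀ _ (pow_ne_zero 2 ha), h3] at h4
      linear_combination h4
  obtain ⟨α, hα⟩ := exists_ringEquiv (τ o p) (h.map_one o p hop) hadd
    (map_mul_of_map_sq_mul (h.map_one o p hop) hadd hsq)
  have hs (i j : ι) (t : F) : single i j t = t • single i j (1 : F) := by simp
  refine ⟨g, α, fun i j hij a ↦ ?_⟩
  rw [hα, hs, Matrix.mul_smul, Matrix.smul_mul]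
  rcases hall i with rfl | rfl
  · obtain rfl := (hall j).resolve_left hij.symm
    rw [hg1]
  · obtain rfl := (hall j).resolve_right hij.symm
    have h4 := h3 (-a)
    rw [neg_neg, hneg, neg_neg] at h4
    rw [hg2, smul_smul, mul_comm, h4]

end RootImage

end RankTwo

section Aut

variable {ι F : Type*} [DecidableEq ι] [Fintype ι] [Field F]

open Matrix.SpecialLinearGroup

lemma diag2n_eq {i j : ι} (hij : i ≠ j) {c : F} (hc : c ≠ 0) :
    diag2n hij c hc = transvection hij c * transvection hij.symm (-c⁻¹) * transvection hij c *
      (transvection hij (-1) * transvection hij.symm (-(-1)⁻¹) * transvection hij (-1)) := by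
  apply val_inj
  have hs (i j : ι) (t : F) : single i j t = t • single i j (1 : F) := by simp
  simp only [val_mul, transvection_coe]
  rw [hs i j c, hs j i (-c⁻¹), hs i j (-1), hs j i (-(-1)⁻¹),
    weyl_mul_weyl (single_mul_single_of_ne _ _ _ _ hij.symm _)
      (single_mul_single_of_ne _ _ _ _ hij _) (by simp) (by simp) hc, diag2n_coe]
  ext k l
  simp [single_apply, one_apply, diagonal_apply]
  grind

lemma induction_transvection [Nontrivial ι] {P : Matrix.SpecialLinearGroup ι F → Prop}
    (A : Matrix.SpecialLinearGroup ι F)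
    (htransvec : ∀ (i j : ι) (hij : i ≠ j) (a : F), P (transvection hij a))
    (hmul : ∀ A B, P A → P B → P (A * B)) : P A := by
  refine diagonal_transvection_induction' P A (fun i j hij c hc ↦ ?_) htransvec hmul
  rw [diag2n_eq]
  exact hmul _ _ (hmul _ _ (hmul _ _ (htransvec _ _ _ _) (htransvec _ _ _ _))
    (htransvec _ _ _ _)) (hmul _ _ (hmul _ _ (htransvec _ _ _ _) (htransvec _ _ _ _))
    (htransvec _ _ _ _))

/-- Every automorphism of `PSL` is induced by a semilinear change of coordinates, possibly
composed with the inverse transpose. -/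
theorem exists_aut_form [Finite F] [Nontrivial ι]
    (φ : MulAut (Matrix.ProjectiveSpecialLinearGroup ι F)) :
    ∃ (g : (Matrix ι ι F)ˣ) (α : F ≃+* F),
      (∀ A : Matrix.SpecialLinearGroup ι F, ∃ B : Matrix.SpecialLinearGroup ι F,
        φ (proj A) = proj B ∧ B.1 = g.1 * A.1.map α * g⁻¹.1) ∨
      (∀ A : Matrix.SpecialLinearGroup ι F, ∃ B : Matrix.SpecialLinearGroup ι F,
        φ (proj A) = proj B ∧ B.1 = g.1 * (A⁻¹.1.map α)ᵀ * g⁻¹.1) := by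
  obtain ⟨ℓ, hℓ⟩ := CharP.exists F
  have : Fact ℓ.Prime := ⟨CharP.char_is_prime F ℓ⟩
  obtain ⟨N, τ, h⟩ := exists_rootImage ℓ φ
  have key : ∃ (g : (Matrix ι ι F)ˣ) (α : F ≃+* F),
      (∀ i j, i ≠ j → ∀ a, τ i j a • N i j = g.1 * single i j (α a) * g⁻¹.1) ∨
      (∀ i j, i ≠ j → ∀ a, τ i j a • N i j = -(g.1 * single j i (α a) * g⁻¹.1)) := by
    obtain ⟨o, p, hop⟩ := exists_pair_ne ι
    by_cases hq : ∃ q, q ≠ o ∧ q ≠ p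
    · obtain ⟨q, hqo, hqp⟩ := hq
      exact (h.rootRel ℓ).exists_conj hop hqp.symm hqo.symm
    · push Not at hq
      obtain ⟨g, α, hg⟩ := h.exists_conj_of_two ℓ hop fun k ↦ or_iff_not_imp_left.2 (hq k)
      exact ⟨g, α, Or.inl hg⟩
  obtain ⟨g, α, hg⟩ := key
  have hconj (M : Matrix ι ι F) : 1 + g.1 * M * g⁻¹.1 = g.1 * (1 + M) * g⁻¹.1 := by
    rw [mul_add, add_mul, mul_one, Units.mul_inv]
  refine ⟨g, α, hg.imp (fun hg A ↦ ?_) fun hg A ↦ ?_⟩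
  · refine induction_transvection (P := fun A ↦ ∃ B : Matrix.SpecialLinearGroup ι F,
      φ (proj A) = proj B ∧ B.1 = g.1 * A.1.map α * g⁻¹.1) A
      (fun i j hij a ↦ ?_) fun A A' hA hA' ↦ ?_
    · obtain ⟨B, hB, hφ⟩ := h.map_proj i j hij a
      refine ⟨B, hφ, ?_⟩
      rw [hB, hg i j hij, hconj, transvection_coe, Matrix.map_add _ (map_add α)]
      simp [Matrix.map_single, Matrix.map_one]
    · obtain ⟨B, hφ, hB⟩ := hA
      obtain ⟨B', hφ', hB'⟩ := hA'
      refine ⟨B * B', ?_, ?_⟩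
      · simp only [proj, map_mul] at hφ hφ' ⊢
        rw [hφ, hφ']
      · rw [val_mul, val_mul, hB, hB', Matrix.map_mul]
        simp [mul_assoc]
  · refine induction_transvection (P := fun A ↦ ∃ B : Matrix.SpecialLinearGroup ι F,
      φ (proj A) = proj B ∧ B.1 = g.1 * (A⁻¹.1.map α)ᵀ * g⁻¹.1) A
      (fun i j hij a ↦ ?_) fun A A' hA hA' ↦ ?_
    · obtain ⟨B, hB, hφ⟩ := h.map_proj i j hij a
      refine ⟨B, hφ, ?_⟩
      rw [hB, hg i j hij, ← neg_mul, ← mul_neg, hconj, transvection_inv, transvection_coe,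
        Matrix.map_add _ (map_add α), transpose_add]
      simp [Matrix.map_single, Matrix.map_one, single_neg]
    · obtain ⟨B, hφ, hB⟩ := hA
      obtain ⟨B', hφ', hB'⟩ := hA'
      refine ⟨B * B', ?_, ?_⟩
      · simp only [proj, map_mul] at hφ hφ' ⊢
        rw [hφ, hφ']
      · rw [_root_.mul_inv_rev, val_mul, val_mul, hB, hB', Matrix.map_mul, transpose_mul]
        simp [mul_assoc]

end Aut

section Counting

variable {ι F : Type*} [DecidableEq ι] [Fintype ι] [Field F]

lemma isRoot_charpoly_of_smul {E : Type*} [Field E] {M : Matrix ι ι E} {y z : E} (hz : z ≠ 0)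
    (h : (z • M).charpoly.IsRoot y) : M.charpoly.IsRoot (z⁻¹ * y) := by
  rw [Polynomial.IsRoot, eval_charpoly] at h ⊢
  have : scalar ι y - z • M = z • (scalar ι (z⁻¹ * y) - M) := by
    rw [smul_sub, scalar_apply, scalar_apply, ← diagonal_smul]
    simp [Pi.smul_def, mul_inv_cancel_left₀ hz]
  rw [this, det_smul] at h
  exact (mul_eq_zero.1 h).resolve_left (pow_ne_zero _ hz)

lemma charP_of_card {F : Type*} [Field F] [Fintype F] {ℓ f : ℕ} (hℓ : ℓ.Prime)
    (hq : Fintype.card F = ℓ ^ f) : CharP F ℓ := by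
  have := Nat.cast_card_eq_zero F
  rw [hq, Nat.cast_pow] at this
  exact (CharP.charP_iff_prime_eq_zero hℓ).2
    (pow_eq_zero_iff (by rintro rfl; simp at this) |>.1 this)

lemma card_ringEquiv_le {F : Type*} [Field F] [Fintype F] {ℓ f : ℕ} (hℓ : ℓ.Prime)
    (hq : Fintype.card F = ℓ ^ f) : Nat.card (F ≃+* F) ≤ f := by
  have := charP_of_card hℓ hq
  have : Fact ℓ.Prime := ⟨hℓ⟩
  let _ := ZMod.algebra F ℓ
  have hfin : Module.finrank (ZMod ℓ) F = f := by
    have := Module.card_eq_pow_finrank (K := ZMod ℓ) (V := F)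
    rw [ZMod.card, hq] at this
    exact (Nat.pow_right_injective hℓ.two_le this).symm
  have h : Function.Injective fun α : F ≃+* F ↦ (AlgEquiv.ofRingEquiv (f := α) (R := ZMod ℓ)
      fun r ↦ by
        have : (α : F →+* F).comp (algebraMap (ZMod ℓ) F) = algebraMap (ZMod ℓ) F :=
          Subsingleton.elim _ _
        exact DFunLike.congr_fun this r) := fun α β hαβ ↦ by
    ext x
    exact DFunLike.congr_fun hαβ x
  calc Nat.card (F ≃+* F) ≤ Nat.card (F ≃ₐ[ZMod ℓ] F) := Nat.card_le_card_of_injective _ h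
    _ = Fintype.card (F ≃ₐ[ZMod ℓ] F) := Nat.card_eq_fintype_card
    _ ≤ f := hfin ▸ AlgEquiv.card_le

/-- Eigenvalues of matrices representing one automorphism class of elements of `PSL` are
related by field automorphisms, inversion, and multiplication by roots of unity. -/
lemma exists_isRoot_of_aut [Finite F] [Nontrivial ι] {E : Type*} [Field E] [Algebra F E]
    {A A' : Matrix.SpecialLinearGroup ι F}
    {φ : MulAut (Matrix.ProjectiveSpecialLinearGroup ι F)}
    (h : φ (proj A) = proj A') {y : E} (hy : (A'.1.charpoly.map (algebraMap F E)).IsRoot y) :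
    ∃ (α : F ≃+* F) (b : Bool) (z w : E), z ^ Fintype.card ι = 1 ∧
      (((bif b then A else A⁻¹).1.charpoly.map (α : F →+* F)).map (algebraMap F E)).IsRoot w ∧
      z * w = y := by
  obtain ⟨g, α, hg⟩ := exists_aut_form φ
  have key {B : Matrix.SpecialLinearGroup ι F} (hB : φ (proj A) = proj B) :
      ∃ z w : E, z ^ Fintype.card ι = 1 ∧
        (B.1.charpoly.map (algebraMap F E)).IsRoot w ∧ z * w = y := by
    obtain ⟨z, hz, hz'⟩ := proj_eq_iff.1 (hB.symm.trans h)
    have hz0 : z ≠ 0 := by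
      rintro rfl
      simp [Fintype.card_ne_zero] at hz
    have hz0' : algebraMap F E z ≠ 0 := by simpa using hz0
    refine ⟨algebraMap F E z, (algebraMap F E z)⁻¹ * y, by rw [← map_pow, hz, map_one], ?_,
      mul_inv_cancel_left₀ hz0' y⟩
    rw [← charpoly_map] at hy ⊢
    apply isRoot_charpoly_of_smul hz0'
    rwa [hz', show (z • B.1).map (algebraMap F E) = algebraMap F E z • B.1.map (algebraMap F E) by
      ext; simp] at hy
  have hc (M : Matrix ι ι F) : (g.1 * M * g⁻¹.1).charpoly = M.charpoly := by
    rw [coe_units_inv, charpoly_units_conj]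
  rcases hg with hg | hg
  · obtain ⟨B, hB, hB'⟩ := hg A
    obtain ⟨z, w, hz, hw, hzw⟩ := key hB
    refine ⟨α, true, z, w, hz, ?_, hzw⟩
    rw [hB', hc] at hw
    rwa [cond_true, ← charpoly_map]
  · obtain ⟨B, hB, hB'⟩ := hg A
    obtain ⟨z, w, hz, hw, hzw⟩ := key hB
    refine ⟨α, false, z, w, hz, ?_, hzw⟩
    rw [hB', hc, charpoly_transpose] at hw
    rwa [cond_false, ← charpoly_map]

/-- A family of elements of `SL` of order prime to `p`, with pairwise distinct chosen
eigenvalues, bounds the number of classes of `p`-regular elements from below. -/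
theorem card_le_mul_kRegAut {F : Type*} [Field F] [Fintype F] [Nontrivial ι]
    {ℓ f : ℕ} (hℓ : ℓ.Prime) (hq : Fintype.card F = ℓ ^ f) {E : Type*} [Field E] [Algebra F E]
    {p m : ℕ} (hp : ¬ p ∣ m) (Y : Finset E)
    (hY : ∀ y ∈ Y, ∃ A : Matrix.SpecialLinearGroup ι F, A ^ m = 1 ∧
      (A.1.charpoly.map (algebraMap F E)).IsRoot y) :
    Y.card ≤ f * 2 * (Fintype.card ι * Fintype.card ι) *
      kRegAut p (Matrix.ProjectiveSpecialLinearGroup ι F) := by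
  classical
  have hfin : Finite (Matrix.ProjectiveSpecialLinearGroup ι F) :=
    Finite.of_surjective _ (proj_surjective (ι := ι) (F := F))
  have : Finite (F ≃+* F) := Finite.of_injective _ (DFunLike.coe_injective (F := F ≃+* F))
  have : Fintype (F ≃+* F) := Fintype.ofFinite _
  choose! A hA hroot using hY
  let cl (y : E) : Quotient (MulAction.orbitRel
      (MulAut (Matrix.ProjectiveSpecialLinearGroup ι F))
      (Matrix.ProjectiveSpecialLinearGroup ι F)) := Quotient.mk _ (proj (A y))
  have himage : (Y.image cl).card ≤
      kRegAut p (Matrix.ProjectiveSpecialLinearGroup ι F) := by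
    rw [← Set.ncard_coe_finset, Finset.coe_image]
    refine Set.ncard_le_ncard ?_ (Set.toFinite _)
    rintro _ ⟨y, hy, rfl⟩
    refine ⟨_, rfl, fun h ↦ hp <| h.trans ?_⟩
    rw [orderOf_dvd_iff_pow_eq_one, proj, ← map_pow, hA y hy, map_one]
  refine (Finset.card_le_mul_card_image (f := cl) Y _ fun c hc ↦ ?_).trans
    (Nat.mul_le_mul_left _ himage)
  obtain ⟨y₀, -, rfl⟩ := Finset.mem_image.1 hc
  let P (x : (F ≃+* F) × Bool) : Polynomial E :=
    ((bif x.2 then A y₀ else (A y₀)⁻¹).1.charpoly.map (x.1 : F →+* F)).map (algebraMap F E)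
  let T (x : (F ≃+* F) × Bool) : Finset E :=
    ((Polynomial.nthRoots (Fintype.card ι) (1 : E)).toFinset ×ˢ (P x).roots.toFinset).image
      fun v ↦ v.1 * v.2
  have hmonic (x) : (P x).Monic := ((charpoly_monic _).map _).map _
  have hT (x) : (T x).card ≤ Fintype.card ι * Fintype.card ι := by
    refine Finset.card_image_le.trans ?_
    rw [Finset.card_product]
    refine Nat.mul_le_mul ((Multiset.toFinset_card_le _).trans (Polynomial.card_nthRoots _ _))
      ((Multiset.toFinset_card_le _).trans ((Polynomial.card_roots' _).trans ?_))
    refine Polynomial.natDegree_map_le.trans (Polynomial.natDegree_map_le.trans ?_)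
    rw [charpoly_natDegree_eq_dim]
  have hsub : {y ∈ Y | cl y = cl y₀} ⊆ Finset.univ.biUnion T := by
    intro y hy
    obtain ⟨hyY, hy⟩ := Finset.mem_filter.1 hy
    obtain ⟨φ, hφ⟩ := Quotient.exact hy
    obtain ⟨α, b, z, w, hz, hw, rfl⟩ := exists_isRoot_of_aut (φ := φ) hφ (hroot y hyY)
    simp only [Finset.mem_biUnion, Finset.mem_univ, true_and]
    refine ⟨(α, b), Finset.mem_image.2 ⟨(z, w), ?_, rfl⟩⟩
    rw [Finset.mem_product, Multiset.mem_toFinset, Multiset.mem_toFinset,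
      Polynomial.mem_nthRoots Fintype.card_pos, Polynomial.mem_roots (hmonic _).ne_zero]
    exact ⟨hz, hw⟩
  calc _ ≤ _ := Finset.card_le_card hsub
    _ ≤ _ := Finset.card_biUnion_le_card_mul _ _ _ fun x _ ↦ hT x
    _ ≤ _ := by
      gcongr
      rw [Finset.card_univ, Fintype.card_prod, Fintype.card_bool, ← Nat.card_eq_fintype_card]
      exact Nat.mul_le_mul_right _ (card_ringEquiv_le hℓ hq)

end Counting

section Tori

variable {ι F E : Type*} [DecidableEq ι] [Fintype ι] [Field F] [Field E] [Algebra F E]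

lemma exists_specialLinearGroup_of_norm {R : Type*} [CommRing R] [Algebra F R]
    (b : Module.Basis ι F R) {r : R} (hr : Algebra.norm F r = 1) (π : R →ₐ[F] E) {m : ℕ}
    (hm : r ^ m = 1) :
    ∃ A : Matrix.SpecialLinearGroup ι F, A ^ m = 1 ∧
      (A.1.charpoly.map (algebraMap F E)).IsRoot (π r) := by
  obtain ⟨A, hA⟩ : ∃ A : Matrix.SpecialLinearGroup ι F, A.1 = Algebra.leftMulMatrix b r :=
    ⟨⟨Algebra.leftMulMatrix b r, by rw [← Algebra.norm_eq_matrix_det b, hr]⟩, rfl⟩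
  refine ⟨A, val_inj ?_, ?_⟩
  · rw [val_pow, hA, val_one, ← map_pow, hm, map_one]
  · have h : Polynomial.aeval r (Algebra.leftMulMatrix b r).charpoly = 0 := by
      apply Algebra.leftMulMatrix_injective b
      rw [← Polynomial.aeval_algHom_apply, aeval_self_charpoly, map_zero]
    rw [hA, Polynomial.IsRoot, Polynomial.eval_map_algebraMap, Polynomial.aeval_algHom_apply, h,
      map_zero]

lemma exists_specialLinearGroup_of_finrank_eq [Finite F] [Finite E]
    (h : Module.finrank F E = Fintype.card ι) {m : ℕ}
    (hm : m ∣ ∑ i ∈ Finset.range (Fintype.card ι), Nat.card F ^ i) {y : E} (hy : y ^ m = 1) :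
    ∃ A : Matrix.SpecialLinearGroup ι F, A ^ m = 1 ∧
      (A.1.charpoly.map (algebraMap F E)).IsRoot y := by
  refine exists_specialLinearGroup_of_norm
    ((Module.finBasisOfFinrankEq F E h).reindex (Fintype.equivFin ι).symm) (r := y) ?_
    (AlgHom.id F E) hy
  apply (algebraMap F E).injective
  obtain ⟨k, hk⟩ := hm
  rw [FiniteField.algebraMap_norm_eq_pow_sum, h, hk, pow_mul, hy, one_pow, map_one]

lemma norm_prod [FiniteDimensional F E] (y : E) (x : F) :
    Algebra.norm F (y, x) = Algebra.norm F y * x := by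
  have : Algebra.lmul F (E × F) (y, x) = (Algebra.lmul F E y).prodMap (Algebra.lmul F F x) := by
    ext <;> simp
  rw [Algebra.norm_apply, this, LinearMap.det_prodMap, ← Algebra.norm_apply,
    ← Algebra.norm_apply, Algebra.norm_self, MonoidHom.id_apply]

lemma exists_specialLinearGroup_of_finrank_add_one_eq [FiniteDimensional F E]
    (h : Module.finrank F E + 1 = Fintype.card ι) {m : ℕ} (hm : m ≠ 0) {y : E}
    (hy : y ^ m = 1) :
    ∃ A : Matrix.SpecialLinearGroup ι F, A ^ m = 1 ∧
      (A.1.charpoly.map (algebraMap F E)).IsRoot y := by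
  have hr : Module.finrank F (E × F) = Fintype.card ι := by
    rw [Module.finrank_prod, Module.finrank_self, h]
  have hy0 : y ≠ 0 := by
    rintro rfl
    simp [hm] at hy
  refine exists_specialLinearGroup_of_norm
    ((Module.finBasisOfFinrankEq F (E × F) hr).reindex (Fintype.equivFin ι).symm)
    (r := (y, (Algebra.norm F y)⁻¹)) ?_ (AlgHom.fst F E F) ?_
  · rw [norm_prod, mul_inv_cancel₀ (Algebra.norm_ne_zero_iff.2 hy0)]
  · rw [Prod.pow_mk, hy, inv_pow, ← map_pow, hy, map_one, inv_one, Prod.mk_one_one]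

lemma exists_finset_card_eq_of_dvd [Finite E] {m : ℕ} (hm : m ∣ Nat.card E - 1) :
    ∃ Y : Finset E, Y.card = m ∧ ∀ y ∈ Y, y ^ m = 1 := by
  have hpos : 0 < Nat.card E - 1 := Nat.sub_pos_of_lt Finite.one_lt_card
  obtain ⟨g, hg⟩ := IsCyclic.exists_ofOrder_eq_natCard (α := Eˣ)
  rw [Nat.card_units] at hg
  have hg' : IsPrimitiveRoot (g : E) (Nat.card E - 1) := by
    rw [← hg, ← orderOf_units]
    exact IsPrimitiveRoot.orderOf _
  obtain ⟨k, hk⟩ := hm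
  have := hg'.pow hpos (hk.trans (mul_comm m k))
  refine ⟨Polynomial.nthRootsFinset m (1 : E), this.card_nthRootsFinset, fun y hy ↦ ?_⟩
  exact (Polynomial.mem_nthRootsFinset (Nat.pos_of_mul_pos_right (hk ▸ hpos)) _).1 hy

end Tori

section Numerics

lemma le_of_dvd_of_dvd {n q P : ℕ} (hn : 0 < n) (hq : 0 < q)
    (ha : P ∣ ∑ i ∈ Finset.range n, q ^ i) (hb : P ∣ q ^ (n - 1) - 1) : P ≤ n := by
  apply Nat.le_of_dvd hn
  rw [← ZMod.natCast_eq_zero_iff] at ha hb ⊢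
  rw [Nat.cast_sub (Nat.one_le_pow _ _ hq), sub_eq_zero] at hb
  push_cast at ha hb
  have hq1 : (q : ZMod P) = 1 := by
    have := geom_sum_mul (q : ZMod P) n
    rw [ha, zero_mul, ← Nat.sub_add_cancel hn, pow_succ, hb, one_mul, eq_comm, sub_eq_zero] at this
    exact this
  simpa [hq1] using ha

lemma exists_large_part {n q p : ℕ} (hn : 2 ≤ n) (hq : 2 ≤ q) (hp : p.Prime) :
    ∃ m, ¬ p ∣ m ∧ q ^ (n - 1) - 1 ≤ n * m ∧
      (m ∣ ∑ i ∈ Finset.range n, q ^ i ∨ m ∣ q ^ (n - 1) - 1) := by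
  have hab : q ^ (n - 1) - 1 ≤ ∑ i ∈ Finset.range n, q ^ i :=
    (Nat.sub_le _ _).trans <| Finset.single_le_sum (f := fun i ↦ q ^ i) (fun _ _ ↦ Nat.zero_le _)
      (Finset.mem_range.2 (by omega))
  have hb0 : q ^ (n - 1) - 1 ≠ 0 := (Nat.sub_pos_of_lt (Nat.one_lt_pow (by omega) hq)).ne'
  generalize hb : q ^ (n - 1) - 1 = b at *
  generalize ha : ∑ i ∈ Finset.range n, q ^ i = a at *
  have hP {P : ℕ} (h1 : P ∣ a) (h2 : P ∣ b) : P ≤ n :=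
    le_of_dvd_of_dvd (by omega) (by omega) (ha ▸ h1) (hb ▸ h2)
  rcases le_total (a.factorization p) (b.factorization p) with h | h
  · refine ⟨_, Nat.not_dvd_ordCompl hp (by omega : a ≠ 0), ?_, .inl (Nat.ordCompl_dvd a p)⟩
    refine hab.trans ((Nat.ordProj_mul_ordCompl_eq_self a p).ge.trans ?_)
    exact Nat.mul_le_mul_right _ (hP (Nat.ordProj_dvd a p)
      ((pow_dvd_pow p h).trans (Nat.ordProj_dvd b p)))
  · refine ⟨_, Nat.not_dvd_ordCompl hp hb0, ?_, .inr (Nat.ordCompl_dvd b p)⟩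
    refine (Nat.ordProj_mul_ordCompl_eq_self b p).ge.trans ?_
    exact Nat.mul_le_mul_right _ (hP ((pow_dvd_pow p h).trans (Nat.ordProj_dvd a p))
      (Nat.ordProj_dvd b p))

end Numerics

section Main

variable {ι F : Type*} [DecidableEq ι] [Fintype ι] [Nontrivial ι] [Field F] [Fintype F]

lemma card_pow_sub_one_le_mul_kRegAut {ℓ f p : ℕ} (hℓ : ℓ.Prime)
    (hq : Fintype.card F = ℓ ^ f) (hp : p.Prime) :
    Fintype.card F ^ (Fintype.card ι - 1) - 1 ≤
      Fintype.card ι * (f * 2 * (Fintype.card ι * Fintype.card ι) *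
        kRegAut p (Matrix.ProjectiveSpecialLinearGroup ι F)) := by
  have : Fact ℓ.Prime := ⟨hℓ⟩
  have := charP_of_card hℓ hq
  have hn : 2 ≤ Fintype.card ι := Fintype.one_lt_card
  have hF : 2 ≤ Fintype.card F := Fintype.one_lt_card
  obtain ⟨m, hpm, hle, hm⟩ := exists_large_part hn hF hp
  refine hle.trans (Nat.mul_le_mul_left _ ?_)
  have hm0 : m ≠ 0 := by
    rintro rfl
    exact hpm (dvd_zero p)
  rw [← Nat.card_eq_fintype_card (α := F)] at hm
  rcases hm with hm | hm
  · have : NeZero (Fintype.card ι) := ⟨by omega⟩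
    have hE : m ∣ Nat.card (FiniteField.Extension F ℓ (Fintype.card ι)) - 1 := by
      rw [FiniteField.natCard_extension]
      refine hm.trans ⟨Nat.card F - 1, ?_⟩
      zify [Nat.one_le_pow _ _ (Nat.card_pos (α := F)), Nat.card_pos (α := F)]
      exact (geom_sum_mul _ _).symm
    obtain ⟨Y, rfl, hY⟩ := exists_finset_card_eq_of_dvd hE
    exact card_le_mul_kRegAut hℓ hq hpm Y fun y hy ↦
      exists_specialLinearGroup_of_finrank_eq (FiniteField.finrank_extension F ℓ _) hm (hY y hy)
  · have : NeZero (Fintype.card ι - 1) := ⟨by omega⟩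
    have hE : m ∣ Nat.card (FiniteField.Extension F ℓ (Fintype.card ι - 1)) - 1 := by
      rwa [FiniteField.natCard_extension]
    obtain ⟨Y, rfl, hY⟩ := exists_finset_card_eq_of_dvd hE
    refine card_le_mul_kRegAut hℓ hq hpm Y fun y hy ↦
      exists_specialLinearGroup_of_finrank_add_one_eq ?_ hm0 (hY y hy)
    rw [FiniteField.finrank_extension]
    omega

end Main

end PSLAut

/-- If `n ≥ 2`, `ℓ` is a prime, `f ≥ 1`, and `F` is a finite field with `q = ℓ^f` elements
such that `PSL_n(F_q)` is simple (i.e. `(n,q)` is neither `(2,2)` nor `(2,3)`), then for any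
prime `p`, the number of `Aut(PSL_n(F_q))`-orbits on the set of `p`-regular elements of
`PSL_n(F_q)` is greater than `q^(n-1) / (12 f n⁴)`. -/
theorem kRegAut_PSL_gt (n : ℕ) (hn : 2 ≤ n) (ℓ f : ℕ) (hℓ : ℓ.Prime) (hf : 1 ≤ f)
    (F : Type) [Field F] [Fintype F] (hq : Fintype.card F = ℓ ^ f)
    (hsimple : ¬ (n = 2 ∧ (Fintype.card F = 2 ∨ Fintype.card F = 3)))
    (p : ℕ) (hp : p.Prime) :
    ((Fintype.card F : ℝ) ^ (n - 1)) / (12 * (f : ℝ) * (n : ℝ) ^ 4) <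
      (kRegAut p (Matrix.ProjectiveSpecialLinearGroup (Fin n) F) : ℝ) := by
  have : Nontrivial (Fin n) := Fin.nontrivial_iff_two_le.2 hn
  have h := PSLAut.card_pow_sub_one_le_mul_kRegAut (ι := Fin n) hℓ hq hp
  have hQ : 2 ≤ Fintype.card F ^ (n - 1) := Nat.one_lt_pow (by omega) Fintype.one_lt_card
  rw [Fintype.card_fin] at h
  generalize kRegAut p (Matrix.ProjectiveSpecialLinearGroup (Fin n) F) = K at *
  rw [← Nat.cast_pow]
  generalize Fintype.card F ^ (n - 1) = Q at *
  rw [div_lt_iff₀ (by positivity)]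
  norm_cast
  calc Q < 6 * 2 * (Q - 1) := by omega
    _ ≤ 6 * n * (n * (f * 2 * (n * n) * K)) := by gcongr
    _ = K * (12 * f * n ^ 4) := by ring
end

section
/- Let q ≥ 4 be a prime power. Then for any prime p, the number of conjugacy classes of p-regular elements of PSL_2(F_q) satisfies k_{p'}(PSL_2(F_q)) ≥ q / (4e · (1 + log_q 3) · gcd(2, q−1)), where e is Euler's number and log_q 3 = (log 3)/(log q). -/
open Polynomial in
/-- An element of an extension of the finite field `F` fixed by the Frobenius of `F` lies in `F`. -/
theorem FiniteField.exists_algebraMap_eq_of_pow_card_eq {F A : Type*} [Field F] [Fintype F]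
    [Field A] [Algebra F A] {x : A} (hx : x ^ Fintype.card F = x) :
    ∃ t : F, algebraMap F A t = x := by
  have hroots := FiniteField.roots_X_pow_card_sub_X F
  have hne : (X ^ Fintype.card F - X : F[X]) ≠ 0 :=
    FiniteField.X_pow_card_sub_X_ne_zero F Fintype.one_lt_card
  have hsplits : (X ^ Fintype.card F - X : F[X]).Splits := by
    rw [splits_iff_card_roots, hroots,
      FiniteField.X_pow_card_sub_X_natDegree_eq F Fintype.one_lt_card]
    rfl
  have hmem : x ∈ ((X ^ Fintype.card F - X : F[X]).map (algebraMap F A)).roots := by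
    rw [mem_roots (Polynomial.map_ne_zero hne)]
    simp [hx]
  rw [hsplits.roots_map, hroots] at hmem
  simpa using hmem

namespace Matrix.SpecialLinearGroup

open Polynomial

/-- If `a ≠ a⁻¹` is an `m`-th root of unity in an extension of `F` with `a + a⁻¹ ∈ F`, then there is
an element of `SL₂(F)` with trace `a + a⁻¹` and `m`-th power `1`. -/
theorem exists_trace_eq_and_pow_eq_one {F A : Type*} [Field F] [Field A] [Algebra F A]
    {m : ℕ} {a : A} {t : F} (ha : a ≠ 0) (ham : a ^ m = 1) (hne : a ≠ a⁻¹)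
    (ht : algebraMap F A t = a + a⁻¹) :
    ∃ g : SpecialLinearGroup (Fin 2) F, g.1.trace = t ∧ g ^ m = 1 := by
  let M : Matrix (Fin 2) (Fin 2) F := !![0, -1; 1, t]
  have hdet : M.det = 1 := by simp [M, det_fin_two]
  have htr : M.trace = t := by simp [M, trace_fin_two]
  refine ⟨⟨M, hdet⟩, htr, Subtype.ext ?_⟩
  have hdvd : (X ^ 2 - C t * X + 1 : F[X]) ∣ X ^ m - 1 := by
    rw [← map_dvd_map' (algebraMap F A)]
    have hfac : (X ^ 2 - C t * X + 1 : F[X]).map (algebraMap F A) = (X - C a) * (X - C a⁻¹) := by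
      have h1 : (C a * C a⁻¹ : A[X]) = 1 := by rw [← C_mul, mul_inv_cancel₀ ha, C_1]
      simp only [Polynomial.map_add, Polynomial.map_sub, Polynomial.map_mul, Polynomial.map_pow,
        map_X, map_C, ht, C_add, Polynomial.map_one]
      linear_combination -h1
    rw [hfac]
    refine (isCoprime_X_sub_C_of_isUnit_sub (sub_ne_zero.2 hne).isUnit).mul_dvd ?_ ?_ <;>
      rw [dvd_iff_isRoot] <;> simp [ham]
  have hM : aeval M (X ^ 2 - C t * X + 1 : F[X]) = 0 := by
    simp only [map_add, map_sub, map_mul, map_pow, aeval_X, aeval_C, map_one]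
    ext i j
    fin_cases i <;> fin_cases j <;>
      simp [M, pow_two, Matrix.mul_apply, Matrix.algebraMap_matrix_apply]
  have h := aeval_eq_zero_of_dvd_aeval_eq_zero hdvd hM
  have hpow : M ^ m = 1 := by simpa [sub_eq_zero] using h
  exact (coe_pow _ _).trans hpow

/-- The square of the trace is a conjugacy invariant of the image in `PSL₂`. -/
theorem sq_trace_eq_of_isConj_mk {F : Type*} [Field F] {g h : SpecialLinearGroup (Fin 2) F}
    (hc : IsConj (g : ProjectiveSpecialLinearGroup (Fin 2) F)
      (h : ProjectiveSpecialLinearGroup (Fin 2) F)) :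
    g.1.trace ^ 2 = h.1.trace ^ 2 := by
  obtain ⟨c, hc⟩ := isConj_iff.1 hc
  obtain ⟨c, rfl⟩ := QuotientGroup.mk_surjective c
  have hmem : (c * g * c⁻¹)⁻¹ * h ∈ Subgroup.center (SpecialLinearGroup (Fin 2) F) :=
    QuotientGroup.eq.1 hc
  obtain ⟨r, hr, hrz⟩ := mem_center_iff.1 hmem
  have hh : h = c * g * c⁻¹ * ((c * g * c⁻¹)⁻¹ * h) := (mul_inv_cancel_left _ _).symm
  have hconj : (c * g * c⁻¹).1.trace = g.1.trace := by
    rw [coe_mul, Matrix.trace_mul_comm, ← coe_mul, inv_mul_cancel_left]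
  rw [hh, coe_mul, ← hrz, ← hconj, Matrix.scalar_apply, ← Matrix.smul_one_eq_diagonal,
    Matrix.mul_smul, mul_one, Matrix.trace_smul, smul_eq_mul, mul_pow]
  rw [Fintype.card_fin] at hr
  rw [hr, one_mul]

end Matrix.SpecialLinearGroup

theorem eq_or_neg_or_inv_of_sq_add_inv_eq {A : Type*} [Field A] {a b : A} (ha : a ≠ 0) (hb : b ≠ 0)
    (h : (a + a⁻¹) ^ 2 = (b + b⁻¹) ^ 2) : a = b ∨ a = -b ∨ a = b⁻¹ ∨ a = -b⁻¹ := by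
  field_simp at h
  have h' : (a - b) * ((a + b) * ((a * b - 1) * (a * b + 1))) = 0 := by linear_combination h
  simp only [mul_eq_zero] at h'
  rcases h' with h | h | h | h
  · exact .inl (sub_eq_zero.1 h)
  · exact .inr (.inl (eq_neg_of_add_eq_zero_left h))
  · exact .inr (.inr (.inl (eq_inv_of_mul_eq_one_left (sub_eq_zero.1 h))))
  · refine .inr (.inr (.inr ?_))
    field_simp
    linear_combination h

/-- If `m ∣ q - 1` or `m ∣ q + 1`, and `p ∤ m`, then `PSL₂(F_q)` has at least `m / 4` classes of
`p`-regular elements. -/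
theorem le_four_mul_kReg_PSL_two {F : Type*} [Field F] [Fintype F] {p m : ℕ}
    (hpm : ¬ p ∣ m) (hm : m ∣ Fintype.card F - 1 ∨ m ∣ Fintype.card F + 1) :
    m ≤ 4 * kReg p (Matrix.ProjectiveSpecialLinearGroup (Fin 2) F) := by
  classical
  set q := Fintype.card F with hq
  have hq1 : 1 < q := Fintype.one_lt_card
  have hmpos : 0 < m := Nat.pos_of_ne_zero fun h ↦ hpm (h ▸ dvd_zero p)
  let A := AlgebraicClosure F
  have hmF : (m : F) ≠ 0 := by
    have hq0 : (q : F) = 0 := by simp [hq]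
    intro h
    rcases hm with ⟨k, hk⟩ | ⟨k, hk⟩
    · have := congrArg (Nat.cast (R := F)) (show q = m * k + 1 by omega)
      simp [hq0, h] at this
    · have := congrArg (Nat.cast (R := F)) hk
      simp [hq0, h] at this
  have : NeZero (m : F) := ⟨hmF⟩
  obtain ⟨ζ, hζ⟩ := HasEnoughRootsOfUnity.exists_primitiveRoot A m
  have hcard := hζ.card_nthRootsFinset
  have key : ∀ a : A, ∃ g : Matrix.SpecialLinearGroup (Fin 2) F, g ^ m = 1 ∧
      (a ^ m = 1 → algebraMap F A g.1.trace ^ 2 = (a + a⁻¹) ^ 2) := by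
    intro a
    by_cases ham : a ^ m = 1
    swap
    · exact ⟨1, one_pow m, fun h ↦ absurd h ham⟩
    have ha : a ≠ 0 := by
      rintro rfl
      simp [hmpos.ne'] at ham
    by_cases hne : a = a⁻¹
    · refine ⟨1, one_pow m, fun _ ↦ ?_⟩
      have h2 : a * a = 1 := by
        nth_rewrite 2 [hne]
        exact mul_inv_cancel₀ ha
      rw [← hne]
      simp only [Matrix.SpecialLinearGroup.coe_one, Matrix.trace_one, Fintype.card_fin,
        Nat.cast_ofNat, map_ofNat]
      linear_combination -4 * h2
    · have hfix : (a + a⁻¹) ^ q = a + a⁻¹ := by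
        have hadd : (a + a⁻¹) ^ q = a ^ q + (a⁻¹) ^ q :=
          map_add (FiniteField.frobeniusAlgHom F A) a a⁻¹
        rw [hadd, inv_pow]
        rcases hm with ⟨k, hk⟩ | ⟨k, hk⟩
        · have : a ^ q = a := by
            rw [show q = m * k + 1 by omega, pow_succ, pow_mul, ham, one_pow, one_mul]
          rw [this]
        · have : a ^ q = a⁻¹ := by
            refine eq_inv_of_mul_eq_one_left ?_
            rw [← pow_succ, hk, pow_mul, ham, one_pow]
          rw [this, inv_inv, add_comm]
      obtain ⟨t, ht⟩ := FiniteField.exists_algebraMap_eq_of_pow_card_eq hfix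
      obtain ⟨g, hgt, hgm⟩ :=
        Matrix.SpecialLinearGroup.exists_trace_eq_and_pow_eq_one ha ham hne ht
      exact ⟨g, hgm, fun _ ↦ by rw [hgt, ht]⟩
  choose g hgm hgt using key
  let f : A → {c : ConjClasses (Matrix.ProjectiveSpecialLinearGroup (Fin 2) F) //
      ∃ x, c = ConjClasses.mk x ∧ ¬ p ∣ orderOf x} := fun a ↦
    ⟨ConjClasses.mk (g a : Matrix.ProjectiveSpecialLinearGroup (Fin 2) F), _, rfl, fun h ↦
      hpm (h.trans (orderOf_dvd_of_pow_eq_one (by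
        rw [← QuotientGroup.mk_pow, hgm, QuotientGroup.mk_one])))⟩
  have := Fintype.ofFinite {c : ConjClasses (Matrix.ProjectiveSpecialLinearGroup (Fin 2) F) //
      ∃ x, c = ConjClasses.mk x ∧ ¬ p ∣ orderOf x}
  have hle := Finset.card_le_mul_card_image_of_maps_to (f := f)
    (s := Polynomial.nthRootsFinset m (1 : A)) (t := Finset.univ) (fun _ _ ↦ Finset.mem_univ _) 4 ?_
  · rwa [hcard, Finset.card_univ, ← Nat.card_eq_fintype_card] at hle
  intro c _
  rcases Finset.eq_empty_or_nonempty {a ∈ Polynomial.nthRootsFinset m (1 : A) | f a = c} with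
    he | ⟨b, hb⟩
  · simp [he]
  refine (Finset.card_le_card (t := {b, -b, b⁻¹, -b⁻¹}) ?_).trans Finset.card_le_four
  intro a ha
  simp only [Finset.mem_filter, Polynomial.mem_nthRootsFinset hmpos] at ha hb
  have hconj := ConjClasses.mk_eq_mk_iff_isConj.1 (congrArg Subtype.val (ha.2.trans hb.2.symm))
  have htr := congrArg (algebraMap F A) (Matrix.SpecialLinearGroup.sq_trace_eq_of_isConj_mk hconj)
  rw [map_pow, map_pow, hgt a ha.1, hgt b hb.1] at htr
  have hne0 : ∀ {x : A}, x ^ m = 1 → x ≠ 0 := by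
    rintro _ hx rfl
    simp [hmpos.ne'] at hx
  simpa using eq_or_neg_or_inv_of_sq_add_inv_eq (hne0 ha.1) (hne0 hb.1) htr

/-- For `q ≥ 2` and `p` prime, one of `q - 1`, `q + 1` has a divisor prime to `p` and of size at
least `(q - 1) / gcd(2, q - 1)`. -/
theorem Nat.Prime.exists_not_dvd_and_dvd_sub_one_or_add_one {p q : ℕ} (hp : p.Prime)
    (hq : 2 ≤ q) :
    ∃ m, ¬ p ∣ m ∧ (m ∣ q - 1 ∨ m ∣ q + 1) ∧ q - 1 ≤ Nat.gcd 2 (q - 1) * m := by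
  have hgcd : 1 ≤ Nat.gcd 2 (q - 1) := Nat.gcd_pos_of_pos_left _ two_pos
  by_cases h1 : p ∣ q - 1
  swap
  · exact ⟨q - 1, h1, .inl dvd_rfl, Nat.le_mul_of_pos_left _ hgcd⟩
  by_cases h2 : p ∣ q + 1
  swap
  · exact ⟨q + 1, h2, .inr dvd_rfl,
      (Nat.le_mul_of_pos_left _ hgcd).trans (Nat.mul_le_mul_left _ (by omega))⟩
  obtain rfl : p = 2 := by
    have h : p ∣ 2 := by
      have := Nat.dvd_sub h2 h1
      rwa [show q + 1 - (q - 1) = 2 by omega] at this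
    exact (Nat.prime_dvd_prime_iff_eq hp Nat.prime_two).1 h
  rw [Nat.gcd_eq_left h1]
  by_cases h3 : 2 ∣ (q - 1) / 2
  · exact ⟨(q + 1) / 2, by omega, .inr (Nat.div_dvd_of_dvd h2), by omega⟩
  · exact ⟨(q - 1) / 2, h3, .inl (Nat.div_dvd_of_dvd h1), by omega⟩

/-- If `F` is a finite field with `q ≥ 4` elements, then for any prime `p`,
`k_{p'}(PSL_2(F_q)) ≥ q / (4e · (1 + log_q 3) · gcd(2, q - 1))`, where `e` is Euler's
number and `log_q 3 = log 3 / log q`. -/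
theorem kReg_PSL_two_ge (F : Type) [Field F] [Fintype F] (hq : 4 ≤ Fintype.card F)
    (p : ℕ) (hp : p.Prime) :
    (Fintype.card F : ℝ) /
        (4 * Real.exp 1 * (1 + Real.log 3 / Real.log (Fintype.card F)) *
          (Nat.gcd 2 (Fintype.card F - 1) : ℝ)) ≤
      (kReg p (Matrix.ProjectiveSpecialLinearGroup (Fin 2) F) : ℝ) := by
  obtain ⟨m, hpm, hm, hle⟩ :=
    hp.exists_not_dvd_and_dvd_sub_one_or_add_one (q := Fintype.card F) (by omega)
  have hk := le_four_mul_kReg_PSL_two hpm hm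
  set k := kReg p (Matrix.ProjectiveSpecialLinearGroup (Fin 2) F)
  set q := Fintype.card F
  have hd : 0 < Nat.gcd 2 (q - 1) := Nat.gcd_pos_of_pos_left _ two_pos
  set d := Nat.gcd 2 (q - 1)
  have hqR : (4 : ℝ) ≤ q := by exact_mod_cast hq
  have hdR : (0 : ℝ) < d := by exact_mod_cast hd
  have hmain : (q : ℝ) ≤ 8 * (d * k) := by
    have h := hle.trans (Nat.mul_le_mul_left d hk)
    have h' : q ≤ 8 * (d * k) := by
      rw [mul_left_comm] at h
      omega
    exact_mod_cast h'
  have hlog : 0 ≤ Real.log 3 / Real.log q :=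
    div_nonneg (Real.log_nonneg (by norm_num)) (Real.log_nonneg (by linarith))
  have hexp : (2 : ℝ) ≤ Real.exp 1 := by linarith [Real.add_one_le_exp (1 : ℝ)]
  have hden : (8 : ℝ) ≤ 4 * Real.exp 1 * (1 + Real.log 3 / Real.log q) := by nlinarith
  rw [div_le_iff₀ (by positivity)]
  have := mul_le_mul_of_nonneg_right hden (by positivity : (0 : ℝ) ≤ d * k)
  linarith
end

section
/- Let p be a prime and G a nontrivial finite group such that every normal solvable subgroup of G is trivial (O_∞(G) = 1). If the number of conjugacy classes of p-regular elements of G is at most 5, then G is almost simple; that is, there exists a normal subgroup S of G such that S is a non-abelian simple group and the centralizer C_G(S) is trivial. -/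
/-- If the average of finitely many complex roots of unity is a nonzero algebraic integer, then
the roots of unity all coincide. -/
lemma Multiset.sum_eq_zero_or_forall_eq_of_isIntegral {n : ℕ} (hn : 0 < n) (s : Multiset ℂ)
    (hs : ∀ z ∈ s, z ^ n = 1) (hint : IsIntegral ℤ (s.sum / s.card)) :
    s.sum = 0 ∨ ∃ c, ∀ z ∈ s, z = c := by
  classical
  have norm_one : ∀ z : ℂ, z ^ n = 1 → ‖z‖ = 1 := fun z hz ↦
    Complex.norm_eq_one_of_pow_eq_one hz hn.ne'
  by_cases h0 : s.sum = 0
  · exact Or.inl h0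
  right
  have : NeZero n := ⟨hn.ne'⟩
  have : IsCyclotomicExtension {n} ℚ (CyclotomicField n ℚ) :=
    CyclotomicField.isCyclotomicExtension n ℚ
  have hζ := IsCyclotomicExtension.zeta_spec n ℚ (CyclotomicField n ℚ)
  obtain ⟨f⟩ : Nonempty (CyclotomicField n ℚ →+* ℂ) := inferInstance
  have hfζ := hζ.map_of_injective f.injective
  have lift : ∀ z ∈ s, ∃ x : CyclotomicField n ℚ, f x = z ∧ x ^ n = 1 := by
    intro z hz
    obtain ⟨i, -, hi⟩ := hfζ.eq_pow_of_pow_eq_one (hs z hz)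
    refine ⟨_ ^ i, by rw [map_pow, hi], ?_⟩
    rw [← pow_mul, mul_comm, pow_mul, hζ.pow_eq_one, one_pow]
  choose! g hg using lift
  let t := s.map g
  have ht : t.map f = s := by
    rw [Multiset.map_map]
    conv_rhs => rw [← Multiset.map_id s]
    exact Multiset.map_congr rfl fun z hz ↦ (hg z hz).1
  have hcard : t.card = s.card := Multiset.card_map _ _
  have hfx : f (t.sum / s.card) = s.sum / s.card := by
    rw [map_div₀, map_multiset_sum, ht, map_natCast]
  have hcard0 : (s.card : ℝ) ≠ 0 := by
    intro h
    apply h0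
    have : s.card = 0 := by exact_mod_cast h
    rw [Multiset.card_eq_zero.mp this, Multiset.sum_zero]
  have hpos : (0 : ℝ) < s.card := lt_of_le_of_ne (by positivity) hcard0.symm
  have hxi : IsIntegral ℤ (t.sum / s.card) := by
    rw [← hfx] at hint
    exact (isIntegral_algHom_iff f.toIntAlgHom f.injective).1 hint
  have hx0 : t.sum / (s.card : CyclotomicField n ℚ) ≠ 0 := by
    intro h
    rw [h] at hfx
    rcases div_eq_zero_iff.1 (hfx.symm.trans f.map_zero) with h | h
    · exact h0 h
    · exact hcard0 (by exact_mod_cast h)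
  obtain ⟨k, hk, hx⟩ := NumberField.Embeddings.pow_eq_one_of_norm_le_one (CyclotomicField n ℚ) ℂ hx0 hxi (by
    intro φ
    rw [map_div₀, map_natCast, map_multiset_sum, norm_div, Complex.norm_natCast, div_le_one hpos]
    refine (norm_multiset_sum_le _).trans ?_
    rw [Multiset.map_map, ← hcard]
    refine (Multiset.sum_le_card_nsmul _ 1 ?_).trans (by simp)
    intro y hy
    obtain ⟨w, hw, rfl⟩ := Multiset.mem_map.1 hy
    obtain ⟨z, hz, rfl⟩ := Multiset.mem_map.1 hw
    simp only [Function.comp_apply]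
    exact (norm_one _ (by rw [← map_pow, (hg z hz).2, map_one])).le)
  set u : ℂ := s.sum / s.card with hu
  have hu1 : ‖u‖ = 1 := by
    refine Complex.norm_eq_one_of_pow_eq_one (n := k) ?_ hk.ne'
    rw [← hfx, ← map_pow, hx, map_one]
  have huu : starRingEnd ℂ u * u = 1 := by
    rw [mul_comm, Complex.mul_conj, Complex.normSq_eq_norm_sq, hu1]; simp
  have hre : ∀ z ∈ s, (starRingEnd ℂ u * z).re ≤ 1 := fun z hz ↦ by
    refine (Complex.re_le_norm _).trans ?_
    rw [norm_mul, RCLike.norm_conj, hu1, norm_one z (hs z hz), one_mul]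
  have hsum : (s.map fun z ↦ (starRingEnd ℂ u * z).re).sum = s.card := by
    have h1 : (s.map fun z ↦ (starRingEnd ℂ u * z).re).sum = (starRingEnd ℂ u * s.sum).re := by
      rw [← Multiset.map_id s, ← Multiset.sum_map_mul_left, Multiset.map_id]
      exact ((map_multiset_sum Complex.reAddGroupHom _).trans (by rw [Multiset.map_map]; rfl)).symm
    have h2 : s.sum = u * s.card := by
      rw [hu, div_mul_cancel₀]; exact_mod_cast hcard0
    rw [h1, h2, ← mul_assoc, huu]; simp
  refine ⟨u, fun z hz ↦ ?_⟩
  have hz1 : (starRingEnd ℂ u * z).re = 1 := by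
    by_contra hne
    have hlt := lt_of_le_of_ne (hre z hz) hne
    have := Multiset.sum_lt_sum (s := s) (f := fun z ↦ (starRingEnd ℂ u * z).re) (g := fun _ ↦ 1)
      hre ⟨z, hz, hlt⟩
    rw [hsum] at this
    simp at this
  have hn1 : ‖starRingEnd ℂ u * z‖ = 1 := by
    rw [norm_mul, RCLike.norm_conj, hu1, norm_one z (hs z hz), one_mul]
  have him : (starRingEnd ℂ u * z).im = 0 := by
    have := Complex.sq_norm_sub_sq_re (starRingEnd ℂ u * z)
    rw [hn1, hz1] at this
    simpa using this.symm
  have h1 : starRingEnd ℂ u * z = 1 := Complex.ext hz1 him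
  calc z = (starRingEnd ℂ u * u) * z := by rw [huu, one_mul]
    _ = u * (starRingEnd ℂ u * z) := by ring
    _ = u := by rw [h1, mul_one]

lemma Matrix.pow_eq_one_of_mem_roots_charpoly {m K : Type*} [Fintype m] [DecidableEq m] [Field K]
    {n : ℕ} (A : Matrix m m K) (hA : A ^ n = 1) {z : K} (hz : z ∈ A.charpoly.roots) :
    z ^ n = 1 := by
  have hz' : z ∈ spectrum K A :=
    Matrix.mem_spectrum_of_isRoot_charpoly (Polynomial.isRoot_of_mem_roots hz)
  have hpow := spectrum.pow_mem_pow A n hz'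
  have : Nontrivial (Matrix m m K) := by
    by_contra h
    rw [not_nontrivial_iff_subsingleton] at h
    simp [spectrum.of_subsingleton] at hz'
  rw [hA, spectrum.one_eq] at hpow
  exact hpow

lemma Matrix.isIntegral_trace_of_pow_eq_one {d n : ℕ} (hn : 0 < n)
    (A : Matrix (Fin d) (Fin d) ℂ) (hA : A ^ n = 1) : IsIntegral ℤ A.trace := by
  rw [Matrix.trace_eq_sum_roots_charpoly]
  exact IsIntegral.multiset_sum fun z hz ↦ IsIntegral.of_pow hn
    (by rw [A.pow_eq_one_of_mem_roots_charpoly hA hz]; exact isIntegral_one)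

/-- A complex matrix of finite order whose normalized trace is an algebraic integer has trace zero
or is scalar. -/
lemma Matrix.trace_eq_zero_or_eq_scalar_of_isIntegral {d n : ℕ} (hn : 0 < n)
    (A : Matrix (Fin d) (Fin d) ℂ) (hA : A ^ n = 1) (hint : IsIntegral ℤ (A.trace / d)) :
    A.trace = 0 ∨ ∃ c : ℂ, A = algebraMap ℂ _ c := by
  have hsq : Squarefree (minpoly ℂ A) := by
    have h : minpoly ℂ A ∣ Polynomial.X ^ n - Polynomial.C 1 := minpoly.dvd _ _ (by simp [hA])
    refine Squarefree.squarefree_of_dvd h ?_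
    exact (Polynomial.separable_X_pow_sub_C (1 : ℂ) (by exact_mod_cast hn.ne')
      one_ne_zero).squarefree
  have hsplit := IsAlgClosed.splits A.charpoly
  have hcard : A.charpoly.roots.card = d := by
    rw [← hsplit.natDegree_eq_card_roots]
    simp
  rw [Matrix.trace_eq_sum_roots_charpoly] at hint ⊢
  have hroots : ∀ z ∈ A.charpoly.roots, z ^ n = 1 := fun z hz ↦
    A.pow_eq_one_of_mem_roots_charpoly hA hz
  refine (Multiset.sum_eq_zero_or_forall_eq_of_isIntegral hn _ hroots (by rwa [hcard])).imp_right ?_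
  rintro ⟨c, hc⟩
  refine ⟨c, ?_⟩
  have hrep : A.charpoly.roots = Multiset.replicate d c := by
    rw [Multiset.eq_replicate]; exact ⟨hcard, hc⟩
  have hchar : A.charpoly = (Polynomial.X - Polynomial.C c) ^ d := by
    have := hsplit.eq_prod_roots_of_monic A.charpoly_monic
    rw [hrep] at this
    simpa using this
  have hdvd' : minpoly ℂ A ∣ Polynomial.X - Polynomial.C c := by
    rcases Nat.eq_zero_or_pos d with rfl | hd
    · have := A.minpoly_dvd_charpoly
      rw [hchar, pow_zero] at this
      exact this.trans (one_dvd _)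
    · rw [← hsq.dvd_pow_iff_dvd hd.ne', ← hchar]
      exact A.minpoly_dvd_charpoly
  have := (minpoly.dvd_iff).1 hdvd'
  simpa [sub_eq_zero] using this

section GroupAlgebra

variable {G : Type*} [Group G] [Finite G]

lemma MonoidAlgebra.trace_mulLeft_single {g : G} (hg : g ≠ 1) :
    LinearMap.trace ℂ _ (LinearMap.mulLeft ℂ (MonoidAlgebra.single g 1 : MonoidAlgebra ℂ G)) =
      0 := by
  classical
  have := Fintype.ofFinite G
  rw [LinearMap.trace_eq_matrix_trace ℂ (MonoidAlgebra.basis G ℂ), Matrix.trace]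
  refine Finset.sum_eq_zero fun x _ ↦ ?_
  rw [Matrix.diag_apply, LinearMap.toMatrix_apply, MonoidAlgebra.basis_apply,
    LinearMap.mulLeft_apply, MonoidAlgebra.single_mul_single]
  change (MonoidAlgebra.single (g * x) ((1 : ℂ) * 1)).coeff x = 0
  simp [hg]

lemma Matrix.trace_mulLeft_pi {n : ℕ} {d : Fin n → ℕ}
    (A : Π i, Matrix (Fin (d i)) (Fin (d i)) ℂ) :
    LinearMap.trace ℂ _ (LinearMap.mulLeft ℂ A) = ∑ i, (d i : ℂ) * (A i).trace := by
  classical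
  rw [LinearMap.trace_eq_matrix_trace ℂ (Pi.basis fun i ↦ Matrix.stdBasis ℂ (Fin (d i)) (Fin (d i))),
    Matrix.trace, Fintype.sum_sigma]
  refine Finset.sum_congr rfl fun i _ ↦ ?_
  rw [Fintype.sum_prod_type, Matrix.trace, Finset.mul_sum]
  refine Finset.sum_congr rfl fun r _ ↦ ?_
  have : ∀ s, Matrix.diag (LinearMap.toMatrix
      (Pi.basis fun i ↦ Matrix.stdBasis ℂ (Fin (d i)) (Fin (d i)))
      (Pi.basis fun i ↦ Matrix.stdBasis ℂ (Fin (d i)) (Fin (d i)))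
      (LinearMap.mulLeft ℂ A)) ⟨i, r, s⟩ = A i r r := by
    intro s
    rw [Matrix.diag_apply, LinearMap.toMatrix_apply, Pi.basis_repr, Pi.basis_apply,
      LinearMap.mulLeft_apply, Pi.mul_apply, Pi.single_eq_same, Matrix.stdBasis_eq_single]
    change (A i * Matrix.single r s (1 : ℂ) : Matrix (Fin (d i)) (Fin (d i)) ℂ) r s = _
    simp
  rw [Finset.sum_congr rfl fun s _ ↦ this s]
  simp

/-- The regular character vanishes off the identity. -/
lemma MonoidAlgebra.sum_mul_trace_eq_zero {n : ℕ} {d : Fin n → ℕ}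
    (e : MonoidAlgebra ℂ G ≃ₐ[ℂ] Π i, Matrix (Fin (d i)) (Fin (d i)) ℂ) {g : G} (hg : g ≠ 1) :
    ∑ i, (d i : ℂ) * (e (MonoidAlgebra.single g 1) i).trace = 0 := by
  rw [← Matrix.trace_mulLeft_pi, ← MonoidAlgebra.trace_mulLeft_single hg,
    ← LinearMap.trace_conj' (LinearMap.mulLeft ℂ (MonoidAlgebra.single g 1)) e.toLinearEquiv]
  congr 1
  refine LinearMap.ext fun x ↦ ?_
  simp [LinearEquiv.conj_apply]

variable {d : ℕ} (φ : MonoidAlgebra ℂ G →ₐ[ℂ] Matrix (Fin d) (Fin d) ℂ)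

omit [Finite G] in
lemma MonoidAlgebra.exists_map_eq_algebraMap_of_commute (hφ : Function.Surjective φ)
    (z : MonoidAlgebra ℂ G) (hz : ∀ h : G, Commute (MonoidAlgebra.single h 1) z) :
    ∃ c : ℂ, φ z = algebraMap ℂ _ c := by
  have hall : ∀ a : MonoidAlgebra ℂ G, Commute a z := by
    intro a
    induction a using MonoidAlgebra.induction_on with
    | of m => exact hz m
    | add x y hx hy => exact hx.add_left hy
    | smul r x hx => exact hx.smul_left r
  obtain ⟨c, hc⟩ := Matrix.mem_range_scalar_of_commute_single (M := φ z) fun i j _ ↦ by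
    obtain ⟨a, ha⟩ := hφ (Matrix.single i j 1)
    rw [← ha]
    exact (hall a).map φ
  exact ⟨c, hc.symm⟩

/-- The central character of a conjugacy class takes algebraic integer values. -/
lemma MonoidAlgebra.isIntegral_card_mul_trace_div [NeZero d] (hφ : Function.Surjective φ) (g : G) :
    IsIntegral ℤ (((conjugatesOf g).ncard : ℂ) *
      (φ (MonoidAlgebra.single g 1)).trace / d) := by
  classical
  have := Fintype.ofFinite G
  let C : Finset G := (conjugatesOf g).toFinset
  let κ : MonoidAlgebra ℤ G := ∑ x ∈ C, MonoidAlgebra.single x 1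
  let ι := MonoidAlgebra.mapRingHom G (Int.castRingHom ℂ)
  have hκ : ι κ = ∑ x ∈ C, MonoidAlgebra.single x 1 := by
    simp [κ, ι, map_sum]
  have hcomm : ∀ h : G, Commute (MonoidAlgebra.single h 1) (ι κ) := by
    intro h
    rw [hκ, Commute, SemiconjBy, Finset.mul_sum, Finset.sum_mul]
    refine Finset.sum_bij' (fun x _ ↦ h * x * h⁻¹) (fun x _ ↦ h⁻¹ * x * h) ?_ ?_ ?_ ?_ ?_
    · intro x hx
      rw [Set.mem_toFinset] at hx ⊢
      exact IsConj.trans hx (isConj_iff.2 ⟨h, rfl⟩)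
    · intro x hx
      rw [Set.mem_toFinset] at hx ⊢
      exact IsConj.trans hx (isConj_iff.2 ⟨h⁻¹, by group⟩)
    · intro x _; group
    · intro x _; group
    · intro x _
      simp [MonoidAlgebra.single_mul_single]
  obtain ⟨c, hc⟩ := MonoidAlgebra.exists_map_eq_algebraMap_of_commute φ hφ _ hcomm
  have hint : IsIntegral ℤ (algebraMap ℂ (Matrix (Fin d) (Fin d) ℂ) c) := by
    rw [← hc]
    exact (IsIntegral.of_finite ℤ κ).map (φ.toRingHom.comp ι).toIntAlgHom
  have hintc : IsIntegral ℤ c :=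
    (isIntegral_algHom_iff (algebraMap ℂ (Matrix (Fin d) (Fin d) ℂ)).toIntAlgHom
      (algebraMap ℂ (Matrix (Fin d) (Fin d) ℂ)).injective).1 hint
  have htr : ∀ x ∈ C, (φ (MonoidAlgebra.single x 1)).trace =
      (φ (MonoidAlgebra.single g 1)).trace := by
    intro x hx
    rw [Set.mem_toFinset] at hx
    obtain ⟨h, rfl⟩ := isConj_iff.1 hx
    have : (MonoidAlgebra.single (h * g * h⁻¹) 1 : MonoidAlgebra ℂ G) =
        MonoidAlgebra.single h 1 * (MonoidAlgebra.single g 1 * MonoidAlgebra.single h⁻¹ 1) := by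
      simp [MonoidAlgebra.single_mul_single, mul_assoc]
    rw [this, map_mul, Matrix.trace_mul_comm, ← map_mul, mul_assoc,
      MonoidAlgebra.single_mul_single, inv_mul_cancel, one_mul, ← MonoidAlgebra.one_def, mul_one]
  have heq : ((conjugatesOf g).ncard : ℂ) * (φ (MonoidAlgebra.single g 1)).trace = c * d := by
    have h1 : (φ (ι κ)).trace = c * d := by
      rw [hc, Matrix.algebraMap_eq_diagonal]
      simp [mul_comm]
    rw [← h1, hκ, map_sum, Matrix.trace_sum, Finset.sum_congr rfl htr,
      Set.ncard_eq_toFinset_card']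
    simp [C]
  rw [heq, mul_div_cancel_right₀ _ (by exact_mod_cast NeZero.ne d)]
  exact hintc

omit [Finite G] in
lemma MonoidAlgebra.map_single_pow_card (g : G) :
    φ (MonoidAlgebra.single g 1) ^ Nat.card G = 1 := by
  rw [← map_pow, MonoidAlgebra.single_pow, pow_card_eq_one', one_pow, ← MonoidAlgebra.one_def,
    map_one]

/-- If `g` has a number of conjugates coprime to the degree of an irreducible representation, then
the character vanishes at `g` or `g` acts as a scalar. -/
lemma MonoidAlgebra.trace_eq_zero_or_eq_algebraMap [NeZero d] (hφ : Function.Surjective φ) {g : G}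
    (hcop : (conjugatesOf g).ncard.Coprime d) :
    (φ (MonoidAlgebra.single g 1)).trace = 0 ∨
      ∃ c : ℂ, φ (MonoidAlgebra.single g 1) = algebraMap ℂ _ c := by
  have hpow := MonoidAlgebra.map_single_pow_card φ g
  refine Matrix.trace_eq_zero_or_eq_scalar_of_isIntegral Nat.card_pos _ hpow ?_
  have h1 := MonoidAlgebra.isIntegral_card_mul_trace_div φ hφ g
  have h2 := Matrix.isIntegral_trace_of_pow_eq_one Nat.card_pos _ hpow
  set χ := (φ (MonoidAlgebra.single g 1)).trace
  set m := (conjugatesOf g).ncard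
  have hd : (d : ℂ) ≠ 0 := by exact_mod_cast NeZero.ne d
  have hbez : (1 : ℂ) = m * (m.gcdA d : ℤ) + d * (m.gcdB d : ℤ) := by
    have := Nat.gcd_eq_gcd_ab m d
    rw [hcop.gcd_eq_one] at this
    exact_mod_cast this
  have : χ / d = ((m.gcdA d : ℤ) : ℂ) * (m * χ / d) + ((m.gcdB d : ℤ) : ℂ) * χ := by
    field_simp
    linear_combination χ * hbez
  rw [this]
  have hZ : ∀ k : ℤ, IsIntegral ℤ (k : ℂ) := fun k ↦ isIntegral_algebraMap (R := ℤ) (x := k)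
  exact ((hZ _).mul h1).add ((hZ _).mul h2)

end GroupAlgebra

lemma isIntegral_of_natCast_mul_eq_one {r : ℕ} {x : ℂ} (hx : IsIntegral ℤ x)
    (h : (r : ℂ) * x = 1) : r = 1 := by
  have hr : (r : ℂ) ≠ 0 := left_ne_zero_of_mul_eq_one h
  have hx' : x = algebraMap ℚ ℂ (r : ℚ)⁻¹ := by
    rw [map_inv₀, map_natCast]
    exact eq_inv_of_mul_eq_one_right h
  rw [hx'] at hx
  have hq : IsIntegral ℤ (r : ℚ)⁻¹ :=
    (isIntegral_algebraMap_iff (algebraMap ℚ ℂ).injective).1 hx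
  obtain ⟨y, hy⟩ := IsIntegrallyClosed.isIntegral_iff.1 hq
  have hr' : (r : ℚ) ≠ 0 := by exact_mod_cast hr
  have : (r : ℚ) * (y : ℚ) = 1 := by
    rw [show (y : ℚ) = (r : ℚ)⁻¹ from hy, mul_inv_cancel₀ hr']
  have hZ : (r : ℤ) * y = 1 := by exact_mod_cast this
  have := Int.isUnit_iff.1 (IsUnit.of_mul_eq_one _ hZ)
  omega

/-- **Burnside**: a finite simple group with a nontrivial conjugacy class of prime power size has
nontrivial center. -/
theorem IsSimpleGroup.center_ne_bot_of_ncard_conjugatesOf_eq_prime_pow {G : Type*} [Group G]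
    [Finite G] [IsSimpleGroup G] {r k : ℕ} (hr : r.Prime) {g : G} (hg : g ≠ 1)
    (hcard : (conjugatesOf g).ncard = r ^ k) : Subgroup.center G ≠ ⊥ := by
  classical
  intro hcenter
  have := Fintype.ofFinite G
  obtain ⟨n, d, hd, ⟨e⟩⟩ :=
    IsSemisimpleRing.exists_algEquiv_pi_matrix_of_isAlgClosed ℂ (MonoidAlgebra ℂ G)
  let φ : ∀ i, MonoidAlgebra ℂ G →ₐ[ℂ] Matrix (Fin (d i)) (Fin (d i)) ℂ := fun i ↦
    (Pi.evalAlgHom ℂ _ i).comp e.toAlgHom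
  have hφ : ∀ i, Function.Surjective (φ i) := fun i ↦
    (Function.surjective_eval i).comp e.surjective
  have hsum := MonoidAlgebra.sum_mul_trace_eq_zero e hg
  change ∑ i, (d i : ℂ) * (φ i (MonoidAlgebra.single g 1)).trace = 0 at hsum
  have hchar : ∀ i, IsIntegral ℤ (φ i (MonoidAlgebra.single g 1)).trace := fun i ↦
    Matrix.isIntegral_trace_of_pow_eq_one Nat.card_pos _ (MonoidAlgebra.map_single_pow_card _ g)
  -- A representation in which all images are trivial, or with degree or trace at `g` controlled
  have hdich : ∀ i, (∀ x, φ i (MonoidAlgebra.single x 1) = 1) ∨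
      ∃ γ : ℂ, IsIntegral ℤ γ ∧ (d i : ℂ) * (φ i (MonoidAlgebra.single g 1)).trace = r * γ := by
    intro i
    by_cases hri : r ∣ d i
    · obtain ⟨c, hc⟩ := hri
      refine Or.inr ⟨c * (φ i (MonoidAlgebra.single g 1)).trace, ?_, ?_⟩
      · exact (isIntegral_algebraMap (R := ℤ) (x := (c : ℤ))).mul (hchar i)
      · rw [← mul_assoc, ← Nat.cast_mul, ← hc]
    · have hcop : (conjugatesOf g).ncard.Coprime (d i) := by
        rw [hcard]
        exact Nat.Coprime.pow_left _ ((Nat.Prime.coprime_iff_not_dvd hr).2 hri)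
      rcases MonoidAlgebra.trace_eq_zero_or_eq_algebraMap (φ i) (hφ i) hcop with h0 | ⟨c, hc⟩
      · exact Or.inr ⟨0, isIntegral_zero, by rw [h0]; simp⟩
      · left
        let ρ : G →* Matrix (Fin (d i)) (Fin (d i)) ℂ :=
          (φ i : MonoidAlgebra ℂ G →* _).comp (MonoidAlgebra.of ℂ G)
        rcases (MonoidHom.normal_ker ρ).eq_bot_or_eq_top with hker | hker
        · exfalso
          apply hg
          rw [← Subgroup.mem_bot, ← hcenter, Subgroup.mem_center_iff]
          intro h
          apply (MonoidHom.ker_eq_bot_iff ρ).1 hker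
          rw [map_mul, map_mul]
          change ρ h * φ i (MonoidAlgebra.single g 1) = φ i (MonoidAlgebra.single g 1) * ρ h
          rw [hc]
          exact (Algebra.commutes c (ρ h)).symm
        · intro x
          have : x ∈ ρ.ker := by rw [hker]; trivial
          exact this
  have hexists : ∃ i, ∀ x, φ i (MonoidAlgebra.single x 1) = 1 := by
    let s : MonoidAlgebra ℂ G := ∑ x : G, MonoidAlgebra.single x 1
    have hl : ∀ h : G, MonoidAlgebra.single h 1 * s = s := fun h ↦ by
      simp only [s, Finset.mul_sum, MonoidAlgebra.single_mul_single, one_mul]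
      exact Equiv.sum_comp (Equiv.mulLeft h) fun x ↦ (MonoidAlgebra.single x 1 : MonoidAlgebra ℂ G)
    have hr : ∀ h : G, s * MonoidAlgebra.single h 1 = s := fun h ↦ by
      simp only [s, Finset.sum_mul, MonoidAlgebra.single_mul_single, one_mul]
      exact Equiv.sum_comp (Equiv.mulRight h) fun x ↦ (MonoidAlgebra.single x 1 : MonoidAlgebra ℂ G)
    have hs : s ≠ 0 := by
      intro h
      have h1 : s.coeff 1 = 1 := by
        simp [s, Finsupp.single_apply]
      rw [h] at h1
      simp at h1
    obtain ⟨i, hi⟩ : ∃ i, φ i s ≠ 0 := by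
      by_contra! h
      exact hs (e.injective ((funext h).trans (map_zero e).symm))
    obtain ⟨c, hc⟩ := MonoidAlgebra.exists_map_eq_algebraMap_of_commute (φ i) (hφ i) s
      fun h ↦ (hl h).trans (hr h).symm
    refine ⟨i, fun x ↦ ?_⟩
    have hc0 : c ≠ 0 := by
      rintro rfl
      exact hi (by rw [hc, map_zero])
    have h1 : φ i (MonoidAlgebra.single x 1) * φ i s = φ i s := by rw [← map_mul, hl]
    rw [hc, ← Algebra.commutes, ← Algebra.smul_def, Algebra.algebraMap_eq_smul_one] at h1
    exact smul_right_injective _ hc0 h1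
  obtain ⟨i₀, hi₀⟩ := hexists
  let ε : MonoidAlgebra ℂ G →ₐ[ℂ] ℂ := MonoidAlgebra.lift ℂ ℂ G 1
  have hlin : ∀ i, (∀ x, φ i (MonoidAlgebra.single x 1) = 1) →
      ∀ a : MonoidAlgebra ℂ G, φ i a = algebraMap ℂ _ (ε a) := by
    intro i hi a
    have : φ i = (Algebra.ofId ℂ _).comp ε := MonoidAlgebra.algHom_ext (fun x ↦ by
      simp [hi x, ε]) (by ext)
    rw [this]
    rfl
  have huniq : ∀ i, (∀ x, φ i (MonoidAlgebra.single x 1) = 1) → i = i₀ := by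
    intro i hi
    by_contra hne
    have h1 := hlin i hi (e.symm (Pi.single i 1))
    have h2 := hlin i₀ hi₀ (e.symm (Pi.single i 1))
    have h3 : φ i (e.symm (Pi.single i 1)) = 1 := by simp [φ]
    have h4 : φ i₀ (e.symm (Pi.single i 1)) = 0 := by simp [φ, Ne.symm hne]
    rw [h3, ← map_one (algebraMap ℂ _)] at h1
    rw [h4, ← map_zero (algebraMap ℂ _)] at h2
    exact one_ne_zero (((algebraMap ℂ _).injective h1).trans ((algebraMap ℂ _).injective h2).symm)
  have hd₀ : d i₀ = 1 := by
    have : Subsingleton (Fin (d i₀)) := ⟨fun j k ↦ by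
      by_contra hjk
      obtain ⟨a, ha⟩ := hφ i₀ (Matrix.single j k 1)
      rw [hlin i₀ hi₀] at ha
      have := congrFun (congrFun ha j) k
      simp [Matrix.algebraMap_matrix_apply, hjk] at this⟩
    have h1 := Fin.subsingleton_iff_le_one.1 this
    have h2 := NeZero.pos (d i₀)
    omega
  have hrest : ∀ i ∈ Finset.univ.erase i₀, ∃ γ : ℂ, IsIntegral ℤ γ ∧
      (d i : ℂ) * (φ i (MonoidAlgebra.single g 1)).trace = r * γ := fun i hi ↦
    (hdich i).resolve_left fun h ↦ Finset.ne_of_mem_erase hi (huniq i h)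
  choose! γ hγ using hrest
  rw [← Finset.add_sum_erase _ _ (Finset.mem_univ i₀), hi₀,
    Finset.sum_congr rfl fun i hi ↦ (hγ i hi).2, ← Finset.mul_sum, Matrix.trace_one,
    Fintype.card_fin, hd₀] at hsum
  refine hr.ne_one (isIntegral_of_natCast_mul_eq_one
    (x := - ∑ i ∈ Finset.univ.erase i₀, γ i) (IsIntegral.sum _ fun i hi ↦ (hγ i hi).1).neg ?_)
  push_cast at hsum
  linear_combination -hsum

lemma ncard_conjugatesOf_eq_index_centralizer {G : Type*} [Group G] (g : G) :
    (conjugatesOf g).ncard = (Subgroup.centralizer {g}).index := by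
  have horbit : MulAction.orbit (ConjAct G) g = conjugatesOf g := by
    ext h
    rw [ConjAct.mem_orbit_conjAct, isConj_comm]
    rfl
  rw [Subgroup.centralizer_eq_comap_stabilizer, ← horbit, ← MulAction.index_stabilizer]
  exact (Subgroup.index_comap_of_surjective (G := ConjAct G) (G' := G)
    (MulAction.stabilizer (ConjAct G) g) (f := ConjAct.toConjAct.toMonoidHom)
    ConjAct.toConjAct.surjective).symm

/-- **Burnside's `p^a q^b` theorem**. -/
theorem isSolvable_of_forall_prime_dvd_card {p q : ℕ} (hq : q.Prime) (G : Type*)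
    [Group G] [Finite G] (h : ∀ r : ℕ, r.Prime → r ∣ Nat.card G → r = p ∨ r = q)
    (hp : p.Prime) : Group.IsSolvable G := by
  induction hn : Nat.card G using Nat.strong_induction_on generalizing G with
  | _ n ih =>
  subst hn
  rcases subsingleton_or_nontrivial G with _ | _
  · infer_instance
  by_cases hsimple : ∃ N : Subgroup G, N.Normal ∧ N ≠ ⊥ ∧ N ≠ ⊤
  · obtain ⟨N, hN, hbot, htop⟩ := hsimple
    rw [Group.isSolvable_iff_subgroup_quotient N]
    have hmul := N.card_eq_card_quotient_mul_card_subgroup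
    have h1 : 1 < Nat.card N := N.one_lt_card_iff_ne_bot.2 hbot
    have h2 : 1 < Nat.card (G ⧸ N) := by
      have : N.index ≠ 1 := fun h ↦ htop (Subgroup.index_eq_one.1 h)
      have : N.index ≠ 0 := Subgroup.index_ne_zero_of_finite
      rw [← Subgroup.index_eq_card]
      omega
    refine ⟨ih _ ?_ N (fun r hr hrd ↦ h r hr (hrd.trans N.card_subgroup_dvd_card)) rfl,
      ih _ ?_ (G ⧸ N) (fun r hr hrd ↦ h r hr (hrd.trans N.card_quotient_dvd_card)) rfl⟩
    · rw [hmul]; exact lt_mul_left Nat.card_pos h2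
    · rw [hmul]; exact lt_mul_right Nat.card_pos h1
  push Not at hsimple
  have : IsSimpleGroup G := ⟨fun N hN ↦ or_iff_not_imp_left.2 (hsimple N hN)⟩
  by_cases hc : Subgroup.center G = ⊥
  swap
  · have hc' := hsimple _ inferInstance hc
    exact Group.isSolvable_of_comm fun a b ↦
      (Subgroup.mem_center_iff.1 (hc' ▸ Subgroup.mem_top b) a)
  exfalso
  obtain ⟨g, hg, hgq⟩ : ∃ g : G, g ≠ 1 ∧ ¬ q ∣ (Subgroup.centralizer {g}).index := by
    have : Fact q.Prime := ⟨hq⟩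
    by_cases hqd : q ∣ Nat.card G
    · obtain ⟨Q⟩ : Nonempty (Sylow q G) := inferInstance
      have : Nontrivial Q :=
        (Subgroup.nontrivial_iff_ne_bot _).2 (Q.ne_bot_of_dvd_card hqd)
      have hcn := Q.isPGroup'.center_nontrivial
      obtain ⟨⟨z, hz⟩, hz1⟩ := exists_ne (1 : Subgroup.center Q)
      refine ⟨z, fun h1 ↦ hz1 (by ext; exact h1), fun hdvd ↦ Q.not_dvd_index (hdvd.trans ?_)⟩
      refine Subgroup.index_dvd_of_le fun x hx ↦ ?_
      rw [Subgroup.mem_centralizer_singleton_iff]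
      exact congrArg Subtype.val (Subgroup.mem_center_iff.1 hz ⟨x, hx⟩)
    · obtain ⟨g, hg⟩ := exists_ne (1 : G)
      exact ⟨g, hg, fun hdvd ↦ hqd (hdvd.trans (Subgroup.index_dvd_card _))⟩
  refine IsSimpleGroup.center_ne_bot_of_ncard_conjugatesOf_eq_prime_pow hp hg
    ((ncard_conjugatesOf_eq_index_centralizer g).trans (Nat.eq_prime_pow_of_unique_prime_dvd
      Subgroup.index_ne_zero_of_finite fun {r} hr hrd ↦ ?_)) hc
  refine (h r hr (hrd.trans (Subgroup.index_dvd_card _))).resolve_right ?_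
  rintro rfl
  exact hgq hrd

lemma exists_orderOf_eq_prime_of_not_isSolvable {p : ℕ} (hp : p.Prime) {G : Type*} [Group G]
    [Finite G] {H : Subgroup G} (hH : ¬ Group.IsSolvable H) :
    ∃ x ∈ H, ∃ y ∈ H, ∃ q r : ℕ, q.Prime ∧ r.Prime ∧ q ≠ r ∧ q ≠ p ∧ r ≠ p ∧
      orderOf x = q ∧ orderOf y = r := by
  obtain ⟨q, r, hq, hr, hqr, hqp, hrp, hqd, hrd⟩ : ∃ q r : ℕ, q.Prime ∧ r.Prime ∧ q ≠ r ∧ q ≠ p ∧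
      r ≠ p ∧ q ∣ Nat.card H ∧ r ∣ Nat.card H := by
    by_contra! hcon
    apply hH
    by_cases hex : ∃ q : ℕ, q.Prime ∧ q ≠ p ∧ q ∣ Nat.card H
    · obtain ⟨q, hq, hqp, hqd⟩ := hex
      refine isSolvable_of_forall_prime_dvd_card (p := p) hq H (fun r hr hrd ↦ ?_) hp
      by_contra! hne
      exact hcon q r hq hr hne.2.symm hqp hne.1 hqd hrd
    · push Not at hex
      refine isSolvable_of_forall_prime_dvd_card (p := p) hp H (fun r hr hrd ↦ ?_) hp
      by_contra! hne
      exact hex r hr hne.1 hrd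
  have : Fact q.Prime := ⟨hq⟩
  have : Fact r.Prime := ⟨hr⟩
  obtain ⟨x, hx⟩ := exists_prime_orderOf_dvd_card' q hqd
  obtain ⟨y, hy⟩ := exists_prime_orderOf_dvd_card' r hrd
  exact ⟨x, x.2, y, y.2, q, r, hq, hr, hqr, hqp, hrp, by rwa [Subgroup.orderOf_coe],
    by rwa [Subgroup.orderOf_coe]⟩

lemma six_le_kReg {p : ℕ} {G : Type*} [Group G] [Finite G] (f : Fin 6 → G)
    (hf : ∀ i, ¬ p ∣ orderOf (f i)) (hconj : ∀ i j, i < j → ¬ IsConj (f i) (f j)) :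
    6 ≤ kReg p G := by
  let F : Fin 6 → {c : ConjClasses G // ∃ g : G, c = ConjClasses.mk g ∧ ¬ p ∣ orderOf g} :=
    fun i ↦ ⟨ConjClasses.mk (f i), f i, rfl, hf i⟩
  have hF : Function.Injective F := by
    intro i j hij
    have h : IsConj (f i) (f j) := ConjClasses.mk_eq_mk_iff_isConj.1 (congrArg Subtype.val hij)
    rcases lt_trichotomy i j with hlt | heq | hlt
    · exact absurd h (hconj i j hlt)
    · exact heq
    · exact absurd h.symm (hconj j i hlt)
  simpa [kReg] using Nat.card_le_card_of_injective F hF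

lemma IsConj.orderOf_eq {G : Type*} [Group G] {a b : G} (h : IsConj a b) :
    orderOf a = orderOf b := by
  obtain ⟨c, rfl⟩ := isConj_iff.1 h
  exact (orderOf_injective (MulAut.conj c).toMonoidHom (MulAut.conj c).injective a).symm

lemma IsConj.mem_iff {G : Type*} [Group G] {a b : G} (h : IsConj a b) (N : Subgroup G) [N.Normal] :
    a ∈ N ↔ b ∈ N := by
  obtain ⟨c, rfl⟩ := isConj_iff.1 h
  rw [mul_assoc, Subgroup.Normal.mem_comm_iff (H := N) inferInstance, inv_mul_cancel_right]

/-- Two disjoint non-solvable normal subgroups produce six classes of `p`-regular elements. -/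
lemma six_le_kReg_of_disjoint {p : ℕ} (hp : p.Prime) {G : Type*} [Group G] [Finite G]
    {M N : Subgroup G} [M.Normal] [N.Normal] (hMN : Disjoint M N) (hM : ¬ Group.IsSolvable M)
    (hN : ¬ Group.IsSolvable N) : 6 ≤ kReg p G := by
  obtain ⟨x, hx, y, hy, q, r, hq, hr, hqr, hqp, hrp, hxq, hyr⟩ :=
    exists_orderOf_eq_prime_of_not_isSolvable hp hM
  obtain ⟨u, hu, v, hv, s, t, hs, ht, hst, hsp, htp, hus, hvt⟩ :=
    exists_orderOf_eq_prime_of_not_isSolvable hp hN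
  have h1 : ∀ {g : G} {q : ℕ}, q.Prime → orderOf g = q → g ≠ 1 := by
    rintro _ _ hq h rfl
    exact hq.ne_one (h.symm.trans orderOf_one)
  have hnd : ∀ {q : ℕ}, q.Prime → q ≠ p → ¬ p ∣ q := fun hq hqp h ↦
    hqp ((Nat.prime_dvd_prime_iff_eq hp hq).1 h).symm
  have hM' : ∀ {g}, g ∈ M → g ≠ 1 → g ∉ N := fun hg hg1 hgN ↦
    hg1 (Subgroup.disjoint_def.1 hMN hg hgN)
  have hN' : ∀ {g}, g ∈ N → g ≠ 1 → g ∉ M := fun hg hg1 hgM ↦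
    hg1 (Subgroup.disjoint_def.1 hMN hgM hg)
  have hxN := hM' hx (h1 hq hxq)
  have hyN := hM' hy (h1 hr hyr)
  have huM := hN' hu (h1 hs hus)
  have hvM := hN' hv (h1 ht hvt)
  have h1M := M.one_mem
  have h1N := N.one_mem
  have hxuM : x * u ∉ M := by rwa [Subgroup.mul_mem_cancel_left _ hx]
  have hxuN : x * u ∉ N := by rwa [Subgroup.mul_mem_cancel_right _ hu]
  have hxu : ¬ p ∣ orderOf (x * u) := by
    have hcomm : Commute x u :=
      Subgroup.commute_of_normal_of_disjoint M N inferInstance inferInstance hMN x u hx hu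
    intro h
    have := h.trans hcomm.orderOf_mul_dvd_mul_orderOf
    rw [hxq, hus, hp.dvd_mul] at this
    exact this.elim (hnd hq hqp) (hnd hs hsp)
  refine six_le_kReg ![1, x, y, u, v, x * u] ?_ fun i j hij hconj ↦ ?_
  · intro i
    fin_cases i
    · simpa using hp.ne_one
    · exact hxq ▸ hnd hq hqp
    · exact hyr ▸ hnd hr hrp
    · exact hus ▸ hnd hs hsp
    · exact hvt ▸ hnd ht htp
    · exact hxu
  · have hoM := hconj.mem_iff M
    have hoN := hconj.mem_iff N
    have ho := hconj.orderOf_eq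
    fin_cases i <;> fin_cases j <;>
      first
      | exact absurd hij (by decide)
      | exact absurd (hoM.1 ‹_›) ‹_›
      | exact absurd (hoN.1 ‹_›) ‹_›
      | exact hqr (hxq.symm.trans (ho.trans hyr))
      | exact hst (hus.symm.trans (ho.trans hvt))

/-- If `S` is a non-solvable subgroup with trivial center such that every `g` either maps `S` into
itself by conjugation or to a subgroup centralizing `S`, and the second case does occur, then there
are at least six classes of `p`-regular elements. -/
lemma six_le_kReg_of_commute_conj {p : ℕ} (hp : p.Prime) {G : Type*} [Group G] [Finite G]
    {S : Subgroup G} (hS : ¬ Group.IsSolvable S)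
    (hdich : ∀ g : G, (∀ b ∈ S, g * b * g⁻¹ ∈ S) ∨ ∀ a ∈ S, ∀ b ∈ S, Commute a (g * b * g⁻¹))
    (hZ : ∀ a ∈ S, (∀ b ∈ S, Commute b a) → a = 1) {g : G} (hg : ¬ ∀ b ∈ S, g * b * g⁻¹ ∈ S) :
    6 ≤ kReg p G := by
  have hcomm := (hdich g).resolve_left hg
  let P : G → Prop := fun z ↦ ∃ h : G, ∃ s ∈ S, h * s * h⁻¹ = z
  have hPS : ∀ {s}, s ∈ S → P s := fun {s} hs ↦ ⟨1, s, hs, by simp⟩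
  have hPconj : ∀ {a b : G}, IsConj a b → (P a ↔ P b) := by
    have key : ∀ {a b : G}, IsConj a b → P a → P b := by
      rintro a b hab ⟨h, s, hs, rfl⟩
      obtain ⟨c, rfl⟩ := isConj_iff.1 hab
      exact ⟨c * h, s, hs, by group⟩
    intro a b hab
    exact ⟨key hab, key hab.symm⟩
  have hPmul : ∀ {a b}, a ∈ S → b ∈ S → a ≠ 1 → b ≠ 1 → ¬ P (a * (g * b * g⁻¹)) := by
    rintro a b ha hb ha1 hb1 ⟨h, s, hs, hx⟩
    rcases hdich h with hh | hh
    · have hmem := hh s hs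
      rw [hx, Subgroup.mul_mem_cancel_left _ ha] at hmem
      have := hZ _ hmem fun c hc ↦ hcomm c hc b hb
      exact hb1 (conj_eq_one_iff.1 this)
    · refine ha1 (hZ a ha fun c hc ↦ ?_)
      have h1 := hh c hc s hs
      rw [hx] at h1
      rw [← mul_inv_cancel_right a (g * b * g⁻¹)]
      exact h1.mul_right (hcomm c hc b hb).inv_right
  obtain ⟨x, hx, y, hy, q, r, hq, hr, hqr, hqp, hrp, hxq, hyr⟩ :=
    exists_orderOf_eq_prime_of_not_isSolvable hp hS
  have hx1 : x ≠ 1 := by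
    rintro rfl
    exact hq.ne_one (hxq.symm.trans orderOf_one)
  have hy1 : y ≠ 1 := by
    rintro rfl
    exact hr.ne_one (hyr.symm.trans orderOf_one)
  have hnd : ∀ {q : ℕ}, q.Prime → q ≠ p → ¬ p ∣ q := fun hq hqp h ↦
    hqp ((Nat.prime_dvd_prime_iff_eq hp hq).1 h).symm
  have hconj : ∀ b : G, orderOf (g * b * g⁻¹) = orderOf b := fun b ↦
    (isConj_iff.2 ⟨g, rfl⟩ : IsConj b (g * b * g⁻¹)).orderOf_eq.symm
  have hprime : ∀ {z : G} {q : ℕ}, z ∈ S → z ≠ 1 → q.Prime → orderOf z = q →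
      orderOf (z * (g * z * g⁻¹)) = q := by
    intro z q hz hz1 hq hzq
    have := Fact.mk hq
    refine orderOf_eq_prime ?_ fun h ↦ hPmul hz hz hz1 hz1 (h ▸ hPS S.one_mem)
    rw [(hcomm z hz z hz).mul_pow, conj_pow, ← hzq, pow_orderOf_eq_one]
    simp
  have hxx := hprime hx hx1 hq hxq
  have hyy := hprime hy hy1 hr hyr
  have hxy : orderOf (x * (g * y * g⁻¹)) = q * r := by
    have hcop : (orderOf x).Coprime (orderOf (g * y * g⁻¹)) := by
      rw [hconj, hxq, hyr]
      exact (Nat.coprime_primes hq hr).2 hqr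
    rw [(hcomm x hx y hy).orderOf_mul_eq_mul_orderOf_of_coprime hcop, hconj, hxq, hyr]
  have hPxx := hPmul hx hx hx1 hx1
  have hPyy := hPmul hy hy hy1 hy1
  have hPxy := hPmul hx hy hx1 hy1
  have hP1 := hPS S.one_mem
  have hPx := hPS hx
  have hPy := hPS hy
  have hq1 := hq.one_lt
  have hr1 := hr.one_lt
  have hqqr : q ≠ q * r := (lt_mul_right hq.pos hr1).ne
  have hrqr : r ≠ q * r := (lt_mul_left hr.pos hq1).ne
  refine six_le_kReg ![1, x, y, x * (g * x * g⁻¹), y * (g * y * g⁻¹), x * (g * y * g⁻¹)] ?_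
    fun i j hij hc ↦ ?_
  · intro i
    fin_cases i
    · simpa using hp.ne_one
    · exact hxq ▸ hnd hq hqp
    · exact hyr ▸ hnd hr hrp
    · exact hxx ▸ hnd hq hqp
    · exact hyy ▸ hnd hr hrp
    · change ¬ p ∣ orderOf (x * (g * y * g⁻¹))
      rw [hxy, hp.dvd_mul]
      exact not_or.2 ⟨hnd hq hqp, hnd hr hrp⟩
  · have hP := hPconj hc
    have ho := hc.orderOf_eq
    clear hc hPmul hPS hPconj hprime hconj hdich hZ
    clear_value P
    fin_cases i <;> fin_cases j <;>
      first
      | exact absurd hij (by decide)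
      | exact absurd (hP.1 ‹_›) ‹_›
      | (simp [hxq, hyr, hxx, hyy, hxy] at ho
         omega)

/-- A minimal normal subgroup `N` and a minimal nontrivial subgroup normalized by `N` satisfy the
dichotomy: a conjugate of `S` is either contained in `S` or centralizes `S`. -/
lemma conj_mem_or_commute_conj {G : Type*} [Group G] {N S : Subgroup G} [N.Normal] (hSN : S ≤ N)
    (hnorm : ∀ n ∈ N, ∀ s ∈ S, n * s * n⁻¹ ∈ S)
    (hmin : ∀ T ≤ S, (∀ n ∈ N, ∀ t ∈ T, n * t * n⁻¹ ∈ T) → T = ⊥ ∨ T = S) (g : G) :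
    (∀ b ∈ S, g * b * g⁻¹ ∈ S) ∨ ∀ a ∈ S, ∀ b ∈ S, Commute a (g * b * g⁻¹) := by
  have hN : N.Normal := inferInstance
  have hmem : ∀ t, t ∈ S ⊓ S.comap (MulAut.conj g).toMonoidHom ↔ t ∈ S ∧ g * t * g⁻¹ ∈ S :=
    fun t ↦ Iff.rfl
  have hT : ∀ n ∈ N, ∀ t ∈ S ⊓ S.comap (MulAut.conj g).toMonoidHom,
      n * t * n⁻¹ ∈ S ⊓ S.comap (MulAut.conj g).toMonoidHom := by
    intro n hn t ht
    rw [hmem] at ht ⊢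
    refine ⟨hnorm n hn t ht.1, ?_⟩
    have := hnorm _ (hN.conj_mem n hn g) _ ht.2
    simpa [mul_assoc] using this
  rcases hmin (S ⊓ S.comap (MulAut.conj g).toMonoidHom) inf_le_left hT with hT | hT
  · right
    intro a ha b hb
    have h1 : a * (g * b * g⁻¹) * a⁻¹ * (g * b * g⁻¹)⁻¹ ∈ S := by
      have := S.mul_mem ha (hnorm _ (hN.conj_mem b (hSN hb) g) _ (S.inv_mem ha))
      simpa [mul_assoc] using this
    have h2 : g⁻¹ * (a * (g * b * g⁻¹) * a⁻¹ * (g * b * g⁻¹)⁻¹) * g ∈ S := by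
      have := S.mul_mem (hnorm _ (hN.conj_mem a (hSN ha) g⁻¹) _ hb) (S.inv_mem hb)
      simpa [mul_assoc] using this
    have h3 := (hmem _).2 ⟨h2, by simpa [mul_assoc] using h1⟩
    rw [hT, Subgroup.mem_bot] at h3
    have h4 : a * (g * b * g⁻¹) * a⁻¹ * (g * b * g⁻¹)⁻¹ = 1 := by
      simpa using (conj_eq_one_iff (a := g⁻¹)).1 (by simpa using h3)
    rw [mul_inv_eq_one, mul_inv_eq_iff_eq_mul] at h4
    exact h4
  · left
    intro b hb
    exact ((hmem b).1 (hT.symm ▸ hb)).2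

/-- Let `p` be a prime and `G` a nontrivial finite group with trivial solvable radical
(every normal solvable subgroup is trivial). If `G` has at most 5 conjugacy classes of
`p`-regular elements, then `G` is almost simple: there is a normal subgroup `S` of `G`
which is a non-abelian simple group and whose centralizer in `G` is trivial. -/
theorem almost_simple_of_kReg_le_five (p : ℕ) (hp : p.Prime)
    (G : Type*) [Group G] [Finite G] [Nontrivial G]
    (hrad : ∀ N : Subgroup G, N.Normal → IsSolvable N → N = ⊥)
    (hk : kReg p G ≤ 5) :
    ∃ S : Subgroup G, S.Normal ∧ IsSimpleGroup S ∧ (∃ a b : S, a * b ≠ b * a) ∧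
      Subgroup.centralizer (S : Set G) = ⊥ := by
  obtain ⟨N, ⟨hN, hN1⟩, hNmin⟩ := wellFounded_lt.has_min {N : Subgroup G | N.Normal ∧ N ≠ ⊥}
    ⟨⊤, inferInstance, top_ne_bot⟩
  obtain ⟨S, ⟨hSN, hS1, hnorm⟩, hSmin⟩ := wellFounded_lt.has_min
    {S : Subgroup G | S ≤ N ∧ S ≠ ⊥ ∧ ∀ n ∈ N, ∀ s ∈ S, n * s * n⁻¹ ∈ S}
    ⟨N, le_rfl, hN1, fun n hn s hs ↦ hN.conj_mem s hs n⟩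
  have hmin : ∀ T ≤ S, (∀ n ∈ N, ∀ t ∈ T, n * t * n⁻¹ ∈ T) → T = ⊥ ∨ T = S := by
    intro T hT hTN
    by_contra! hne
    exact hSmin T ⟨hT.trans hSN, hne.1, hTN⟩ (lt_of_le_of_ne hT hne.2)
  have hdich := conj_mem_or_commute_conj hSN hnorm hmin
  have hnonab : ¬ ∀ a ∈ S, ∀ b ∈ S, Commute a b := by
    intro hab
    have hcomm : ∀ a ∈ S, ∀ b ∈ S, ∀ g : G, Commute a (g * b * g⁻¹) := by
      intro a ha b hb g
      rcases hdich g with h | h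
      · exact hab a ha _ (h b hb)
      · exact h a ha b hb
    have hcl : IsMulCommutative (Subgroup.closure (Group.conjugatesOfSet (S : Set G))) := by
      refine Subgroup.isMulCommutative_closure fun x hx y hy ↦ ?_
      obtain ⟨a, ha, hax⟩ := Group.mem_conjugatesOfSet_iff.1 hx
      obtain ⟨b, hb, hby⟩ := Group.mem_conjugatesOfSet_iff.1 hy
      obtain ⟨c, rfl⟩ := isConj_iff.1 hax
      obtain ⟨d, rfl⟩ := isConj_iff.1 hby
      have h := (hcomm a ha b hb (c⁻¹ * d)).map (MulAut.conj c)
      have h2 : MulAut.conj c (c⁻¹ * d * b * (c⁻¹ * d)⁻¹) = d * b * d⁻¹ := by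
        simp [mul_assoc]
      rw [h2] at h
      exact h
    have hsol : Group.IsSolvable (Subgroup.normalClosure (S : Set G)) :=
      Group.isSolvable_of_comm fun a b ↦ hcl.is_comm.comm a b
    have hbot := hrad _ Subgroup.normalClosure_normal hsol
    exact hS1 (le_bot_iff.1 (hbot ▸ Subgroup.le_normalClosure))
  have hZ : ∀ a ∈ S, (∀ b ∈ S, Commute b a) → a = 1 := by
    have hcen : S ⊓ Subgroup.centralizer (S : Set G) = ⊥ := by
      refine (hmin _ inf_le_left fun n hn t ht ↦ ⟨hnorm n hn t ht.1, ?_⟩).resolve_right fun h ↦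
        hnonab fun a ha b hb ↦ ?_
      · refine Subgroup.mem_centralizer_iff.2 fun s hs ↦ ?_
        have h1 := Subgroup.mem_centralizer_iff.1 ht.2 _ (hnorm _ (N.inv_mem hn) s hs)
        have h2 : Commute (MulAut.conj n (n⁻¹ * s * n⁻¹⁻¹)) (MulAut.conj n t) :=
          (show Commute _ _ from h1).map (MulAut.conj n)
        have h3 : MulAut.conj n (n⁻¹ * s * n⁻¹⁻¹) = s := by simp [mul_assoc]
        rw [h3] at h2
        exact h2
      · exact Subgroup.mem_centralizer_iff.1 (inf_eq_left.1 h hb) a ha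
    intro a ha hab
    exact (Subgroup.mem_bot).1 (hcen ▸ ⟨ha, Subgroup.mem_centralizer_iff.2 hab⟩)
  have hSsol : ¬ Group.IsSolvable S := by
    intro hsol
    have : Nontrivial S := (Subgroup.nontrivial_iff_ne_bot S).2 hS1
    have hlt : ⁅S, S⁆ < S := by
      rw [← S.range_subtype, MonoidHom.range_eq_map, ← Subgroup.map_commutator,
        Subgroup.map_subtype_lt_map_subtype]
      exact Group.IsSolvable.commutator_lt_top_of_nontrivial S
    have hconj : ∀ n ∈ N, ∀ t ∈ ⁅S, S⁆, n * t * n⁻¹ ∈ ⁅S, S⁆ := by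
      intro n hn t ht
      have h1 : ⁅S, S⁆ ≤ ⁅S, S⁆.comap (MulAut.conj n).toMonoidHom := by
        refine Subgroup.commutator_le.2 fun a ha b hb ↦ ?_
        rw [Subgroup.mem_comap, map_commutatorElement]
        exact Subgroup.commutator_mem_commutator (hnorm n hn a ha) (hnorm n hn b hb)
      exact h1 ht
    rcases hmin _ hlt.le hconj with h | h
    · refine hnonab fun a ha b hb ↦ commutatorElement_eq_one_iff_commute.1 ?_
      exact (Subgroup.mem_bot).1 (h ▸ Subgroup.commutator_mem_commutator ha hb)
    · exact hlt.ne h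
  have hk6 : ¬ 6 ≤ kReg p G := by omega
  have hSnormal : S.Normal := by
    refine ⟨fun b hb g ↦ ?_⟩
    by_contra hg
    exact hk6 (six_le_kReg_of_commute_conj hp hSsol hdich hZ fun h ↦ hg (h b hb))
  have hSeq : S = N := by
    by_contra hne
    exact hNmin S ⟨hSnormal, hS1⟩ (lt_of_le_of_ne hSN hne)
  refine ⟨S, hSnormal, ?_, ?_, ?_⟩
  · have : Nontrivial S := (Subgroup.nontrivial_iff_ne_bot S).2 hS1
    refine ⟨fun K hK ↦ ?_⟩
    have hKS : K.map S.subtype ≤ S := Subgroup.map_subtype_le K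
    refine (hmin _ hKS ?_).imp (fun h ↦ ?_) fun h ↦ ?_
    · rintro n hn _ ⟨k, hkK, rfl⟩
      exact ⟨_, hK.conj_mem k hkK ⟨n, hSeq ▸ hn⟩, rfl⟩
    · exact (Subgroup.map_eq_bot_iff_of_injective K S.subtype_injective).1 h
    · refine eq_top_iff.2 fun s _ ↦ ?_
      obtain ⟨k, hkK, hks⟩ : (s : G) ∈ K.map S.subtype := by
        rw [h]
        exact s.2
      exact (Subtype.ext hks : k = s) ▸ hkK
  · by_contra! h
    exact hnonab fun a ha b hb ↦ congrArg Subtype.val (h ⟨a, ha⟩ ⟨b, hb⟩)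
  · by_contra hC
    have hCsol : ¬ Group.IsSolvable (Subgroup.centralizer (S : Set G)) := fun h ↦
      hC (hrad _ inferInstance h)
    refine hk6 (six_le_kReg_of_disjoint hp (Subgroup.disjoint_def.2 ?_) hSsol hCsol)
    exact fun {x} hx hxC ↦ hZ x hx (Subgroup.mem_centralizer_iff.1 hxC)
end

section
/- Let p be an odd prime and f ≥ 1 an integer, and let q = p^f. Then the projective special linear group PSL_2(F_q) has exactly two conjugacy classes of p-singular elements, i.e., exactly two conjugacy classes consisting of elements of order divisible by p. -/
/-- `kSing p G` is the number of conjugacy classes of `p`-singular elements of `G`,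
i.e. classes of elements whose order is divisible by `p`. -/
noncomputable def kSing (p : ℕ) (G : Type*) [Group G] : ℕ :=
  Nat.card {c : ConjClasses G // ∃ g : G, c = ConjClasses.mk g ∧ p ∣ orderOf g}

namespace Matrix.SpecialLinearGroup

variable {F : Type*} [Field F]

/-- The element `!![a, b; c, d]` of `SL₂`. -/
def ofEntries (a b c d : F) (h : a * d - b * c = 1) : SpecialLinearGroup (Fin 2) F :=
  ⟨!![a, b; c, d], by rw [det_fin_two_of, h]⟩

theorem coe_ofEntries (a b c d : F) (h : a * d - b * c = 1) :
    (ofEntries a b c d h : Matrix (Fin 2) (Fin 2) F) = !![a, b; c, d] := rfl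

/-- The upper unitriangular matrix `!![1, a; 0, 1]` as an element of `SL₂`. -/
def upperUnipotent (a : F) : SpecialLinearGroup (Fin 2) F :=
  ofEntries 1 a 0 1 (by ring)

theorem coe_upperUnipotent (a : F) :
    (upperUnipotent a : Matrix (Fin 2) (Fin 2) F) = !![1, a; 0, 1] := rfl

/-- Entrywise form of an identity in `SL₂`. -/
theorem ext_fin_two {g h : SpecialLinearGroup (Fin 2) F} (h₀₀ : g 0 0 = h 0 0)
    (h₀₁ : g 0 1 = h 0 1) (h₁₀ : g 1 0 = h 1 0) (h₁₁ : g 1 1 = h 1 1) : g = h := by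
  ext i j
  fin_cases i <;> fin_cases j <;> assumption

theorem det_eq_one_fin_two (g : SpecialLinearGroup (Fin 2) F) :
    g 0 0 * g 1 1 - g 0 1 * g 1 0 = 1 := by
  rw [← det_fin_two]
  exact g.det_coe

theorem upperUnipotent_zero : upperUnipotent (0 : F) = 1 := by
  apply ext_fin_two <;> simp [coe_upperUnipotent]

theorem upperUnipotent_pow (a : F) (n : ℕ) :
    upperUnipotent a ^ n = upperUnipotent (n * a) := by
  induction n with
  | zero => simp [upperUnipotent_zero]
  | succ n ih =>
    rw [pow_succ, ih]
    apply ext_fin_two <;> simp [coe_upperUnipotent, mul_apply, Fin.sum_univ_two]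
    ring

theorem isConj_upperUnipotent_sq_mul (a : F) {s : F} (hs : s ≠ 0) :
    IsConj (upperUnipotent a) (upperUnipotent (s ^ 2 * a)) := by
  refine isConj_iff.2 ⟨ofEntries s 0 0 s⁻¹ (by simp [hs]), mul_inv_eq_iff_eq_mul.2 ?_⟩
  apply ext_fin_two <;> simp [coe_ofEntries, coe_upperUnipotent, mul_apply, Fin.sum_univ_two]
  field_simp

theorem exists_isConj_upperUnipotent_of_trace_eq_two (g : SpecialLinearGroup (Fin 2) F)
    (hg : (g : Matrix (Fin 2) (Fin 2) F).trace = 2) : ∃ a : F, IsConj (upperUnipotent a) g := by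
  have hd := det_eq_one_fin_two g
  rw [trace_fin_two] at hg
  have h₁₁ : g 1 1 = 2 - g 0 0 := by linear_combination hg
  have hsq : (g 0 0 - 1) ^ 2 = - (g 0 1 * g 1 0) := by
    rw [h₁₁] at hd
    linear_combination -hd
  by_cases hc : g 1 0 = 0
  · have ha : g 0 0 = 1 := by
      rw [hc, mul_zero, neg_zero, sq_eq_zero_iff, sub_eq_zero] at hsq
      exact hsq
    refine ⟨g 0 1, ?_⟩
    have : upperUnipotent (g 0 1) = g := by
      apply ext_fin_two <;> simp [coe_upperUnipotent, ha, hc, h₁₁]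
      norm_num
    rw [this]
  · refine ⟨-(g 1 0)⁻¹, isConj_iff.2
      ⟨ofEntries (g 0 0 - 1) (-(g 1 0)⁻¹) (g 1 0) 0 (by simp [hc]),
        mul_inv_eq_iff_eq_mul.2 ?_⟩⟩
    apply ext_fin_two <;> simp [coe_ofEntries, coe_upperUnipotent, mul_apply, Fin.sum_univ_two, h₁₁, hc]
    · linear_combination -hsq
    · field_simp
      ring
    · ring

theorem exists_isConj_upperUnipotent_of_pow_char_eq_one {p : ℕ} [Fact p.Prime] [CharP F p]
    (g : SpecialLinearGroup (Fin 2) F) (hg : g ^ p = 1) :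
    ∃ a : F, IsConj (upperUnipotent a) g := by
  apply exists_isConj_upperUnipotent_of_trace_eq_two
  have hnil : IsNilpotent ((g : Matrix (Fin 2) (Fin 2) F) - 1) := by
    refine ⟨p, ?_⟩
    rw [sub_pow_char_of_commute p (Commute.one_right _), one_pow, ← coe_pow, hg, coe_one,
      sub_self]
  have := (isNilpotent_trace_of_isNilpotent hnil).eq_zero
  rw [trace_sub, trace_one, sub_eq_zero] at this
  simpa using this

theorem mem_center_fin_two_iff {z : SpecialLinearGroup (Fin 2) F} :
    z ∈ Subgroup.center (SpecialLinearGroup (Fin 2) F) ↔ z = 1 ∨ z = -1 := by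
  rw [mem_center_iff]
  constructor
  · rintro ⟨r, hr, hz⟩
    rw [Fintype.card_fin, sq_eq_one_iff] at hr
    rcases hr with rfl | rfl
    · left; ext i j; simp [← hz]
    · right; ext i j; rw [coe_neg, coe_one, ← hz, map_neg, map_one]
  · rintro (rfl | rfl)
    · exact ⟨1, by simp⟩
    · exact ⟨-1, by simp, by rw [coe_neg, coe_one, map_neg, map_one]⟩

theorem exists_eq_upperUnipotent_of_commute {g : SpecialLinearGroup (Fin 2) F} {b : F}
    (hb : b ≠ 0) (h : Commute g (upperUnipotent b)) :
    ∃ a : F, g = upperUnipotent a ∨ g = -upperUnipotent a := by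
  have hd := det_eq_one_fin_two g
  have e (i j) : (g * upperUnipotent b) i j = (upperUnipotent b * g) i j := by rw [h.eq]
  have e₀₀ := e 0 0
  have e₀₁ := e 0 1
  simp [coe_upperUnipotent, mul_apply, Fin.sum_univ_two, hb] at e₀₀ e₀₁
  have e₁₁ : g 1 1 = g 0 0 := mul_left_cancel₀ hb (by linear_combination -e₀₁)
  rw [e₁₁, e₀₀, mul_zero, sub_zero, mul_self_eq_one_iff] at hd
  rcases hd with hd | hd
  · refine ⟨g 0 1, .inl ?_⟩
    apply ext_fin_two <;> simp [coe_upperUnipotent, *]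
  · refine ⟨-g 0 1, .inr ?_⟩
    apply ext_fin_two <;> simp [coe_upperUnipotent, *]

end Matrix.SpecialLinearGroup

namespace Matrix.ProjectiveSpecialLinearGroup

open Matrix.SpecialLinearGroup

variable {F : Type*} [Field F]

theorem mk_eq_mk_iff {g h : SpecialLinearGroup (Fin 2) F} :
    (g : ProjectiveSpecialLinearGroup (Fin 2) F) = h ↔ h = g ∨ h = -g := by
  rw [QuotientGroup.eq, mem_center_fin_two_iff, inv_mul_eq_iff_eq_mul, inv_mul_eq_iff_eq_mul]
  simp

theorem mk_neg (g : SpecialLinearGroup (Fin 2) F) :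
    ((-g : SpecialLinearGroup (Fin 2) F) : ProjectiveSpecialLinearGroup (Fin 2) F) = g :=
  mk_eq_mk_iff.2 (.inr (neg_neg g).symm)

theorem isConj_mk {g h : SpecialLinearGroup (Fin 2) F} (hgh : IsConj g h) :
    IsConj (g : ProjectiveSpecialLinearGroup (Fin 2) F) h :=
  (QuotientGroup.mk' _).map_isConj hgh

theorem mk_upperUnipotent_eq_one_iff {a : F} :
    (upperUnipotent a : ProjectiveSpecialLinearGroup (Fin 2) F) = 1 ↔ a = 0 := by
  refine ⟨fun h => ?_, fun h => by rw [h, upperUnipotent_zero]; rfl⟩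
  rw [← QuotientGroup.mk_one, mk_eq_mk_iff] at h
  rcases h with h | h
  · simpa [coe_upperUnipotent] using (congr($h 0 1)).symm
  · simpa [coe_upperUnipotent] using (congr($h 0 1)).symm

theorem orderOf_mk_upperUnipotent {p : ℕ} [Fact p.Prime] [CharP F p] {a : F} (ha : a ≠ 0) :
    orderOf (upperUnipotent a : ProjectiveSpecialLinearGroup (Fin 2) F) = p := by
  refine orderOf_eq_prime ?_ (mk_upperUnipotent_eq_one_iff.not.2 ha)
  rw [← QuotientGroup.mk_pow, upperUnipotent_pow, CharP.cast_eq_zero, zero_mul,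
    upperUnipotent_zero]
  rfl

/-- Every `p`-singular element of `PSL₂` in odd characteristic `p` is a nontrivial unipotent. -/
theorem exists_isConj_of_dvd_orderOf {p : ℕ} [Fact p.Prime] [CharP F p] (hodd : Odd p)
    (x : ProjectiveSpecialLinearGroup (Fin 2) F) (h₀ : orderOf x ≠ 0) (hx : p ∣ orderOf x) :
    ∃ a : F, a ≠ 0 ∧ IsConj (upperUnipotent a : ProjectiveSpecialLinearGroup (Fin 2) F) x := by
  obtain ⟨g, rfl⟩ := QuotientGroup.mk_surjective x
  obtain ⟨m, hm⟩ := hx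
  have hord : orderOf ((g ^ m : SpecialLinearGroup (Fin 2) F) :
      ProjectiveSpecialLinearGroup (Fin 2) F) = p := by
    rw [QuotientGroup.mk_pow, orderOf_pow_of_dvd (by rintro rfl; simp_all) (hm ▸ dvd_mul_left m p),
      hm, Nat.mul_div_cancel _ (Nat.pos_of_ne_zero (by rintro rfl; simp_all))]
  -- a sign change of `g ^ m` has order `p`
  obtain ⟨k, hk, hkp, hkg⟩ : ∃ k : SpecialLinearGroup (Fin 2) F,
      (k : ProjectiveSpecialLinearGroup (Fin 2) F) = (g ^ m : SpecialLinearGroup (Fin 2) F) ∧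
        k ^ p = 1 ∧ Commute g k := by
    have h1 := pow_orderOf_eq_one ((g ^ m : SpecialLinearGroup (Fin 2) F) :
      ProjectiveSpecialLinearGroup (Fin 2) F)
    rw [hord, ← QuotientGroup.mk_pow, ← QuotientGroup.mk_one, eq_comm, mk_eq_mk_iff] at h1
    have hcomm : Commute g (g ^ m) := Commute.self_pow g m
    rcases h1 with h1 | h1
    · exact ⟨g ^ m, rfl, h1, hcomm⟩
    · exact ⟨-g ^ m, mk_neg _, by rw [hodd.neg_pow, h1, neg_neg], hcomm.neg_right⟩
  obtain ⟨b, hb⟩ := exists_isConj_upperUnipotent_of_pow_char_eq_one k hkp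
  have hb₀ : b ≠ 0 := by
    rintro rfl
    rw [upperUnipotent_zero, isConj_one_right] at hb
    rw [← hk, hb, QuotientGroup.mk_one, orderOf_one] at hord
    exact (Fact.out : p.Prime).one_lt.ne hord
  obtain ⟨c, hc⟩ := isConj_iff.1 hb
  have hcomm : Commute (c⁻¹ * g * c) (upperUnipotent b) := by
    have : upperUnipotent b = c⁻¹ * k * c := by rw [← hc]; group
    rw [this]
    have h2 := hkg.eq
    calc c⁻¹ * g * c * (c⁻¹ * k * c) = c⁻¹ * (g * k) * c := by group
      _ = c⁻¹ * (k * g) * c := by rw [h2]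
      _ = _ := by group
  obtain ⟨a, ha⟩ := exists_eq_upperUnipotent_of_commute hb₀ hcomm
  have hmk : (upperUnipotent a : ProjectiveSpecialLinearGroup (Fin 2) F) =
      (c⁻¹ * g * c : SpecialLinearGroup (Fin 2) F) := by
    rcases ha with ha | ha
    · rw [ha]
    · rw [ha, mk_neg]
  have hconj : IsConj (upperUnipotent a : ProjectiveSpecialLinearGroup (Fin 2) F) g := by
    rw [hmk]
    exact isConj_mk (isConj_iff.2 ⟨c, by group⟩)
  refine ⟨a, ?_, hconj⟩
  rintro rfl
  rw [mk_upperUnipotent_eq_one_iff.2 rfl, isConj_one_right] at hconj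
  rw [hconj, orderOf_one] at hm
  exact (Fact.out : p.Prime).one_lt.ne' (Nat.eq_one_of_mul_eq_one_right hm.symm)

theorem isConj_mk_upperUnipotent_iff {a b : F} (h2 : (2 : F) ≠ 0) (ha : a ≠ 0) (hb : b ≠ 0) :
    IsConj (upperUnipotent a : ProjectiveSpecialLinearGroup (Fin 2) F) (upperUnipotent b) ↔
      IsSquare (a * b) := by
  constructor
  · intro h
    obtain ⟨y, hy⟩ := isConj_iff.1 h
    obtain ⟨x, rfl⟩ := QuotientGroup.mk_surjective y
    rw [mul_inv_eq_iff_eq_mul, ← QuotientGroup.mk_mul, ← QuotientGroup.mk_mul, eq_comm,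
      mk_eq_mk_iff] at hy
    have hd := det_eq_one_fin_two x
    rcases hy with hy | hy
    · have e₀₀ : _ = _ := congr($hy 0 0)
      have e₀₁ : _ = _ := congr($hy 0 1)
      simp [coe_upperUnipotent, mul_apply, Fin.sum_univ_two, hb] at e₀₀ e₀₁
      rw [e₀₀] at hd
      refine ⟨a * x 0 0, ?_⟩
      linear_combination (-(a * b)) * hd - a * x 0 0 * e₀₁
    · have e₀₀ : _ = _ := congr($hy 0 0)
      have e₁₀ : _ = _ := congr($hy 1 0)
      simp only [coe_neg, coe_mul, coe_upperUnipotent, neg_apply, mul_apply,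
        Fin.sum_univ_two] at e₀₀ e₁₀
      simp at e₀₀ e₁₀
      have e₁₀' : x 1 0 = 0 := mul_left_cancel₀ h2 (by linear_combination e₁₀)
      have e₀₀' : x 0 0 = 0 := mul_left_cancel₀ h2 (by rw [e₁₀'] at e₀₀; linear_combination e₀₀)
      simp [e₁₀', e₀₀'] at hd
  · rintro ⟨s, hs⟩
    have hs₀ : s ≠ 0 := by
      rintro rfl
      simp_all
    have := isConj_mk (isConj_upperUnipotent_sq_mul a (s := s / a) (div_ne_zero hs₀ ha))
    have hba : (s / a) ^ 2 * a = b := by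
      field_simp
      linear_combination -hs
    rwa [hba] at this

end Matrix.ProjectiveSpecialLinearGroup

open Matrix.SpecialLinearGroup Matrix.ProjectiveSpecialLinearGroup

/-- If `p` is an odd prime, `f ≥ 1`, and `F` is a finite field with `q = p^f` elements,
then `PSL_2(F_q)` has exactly two conjugacy classes of `p`-singular elements
(elements of order divisible by `p`). -/
theorem kSing_PSL_two_eq_two (p : ℕ) (hp : p.Prime) (hodd : Odd p) (f : ℕ) (hf : 1 ≤ f)
    (F : Type) [Field F] [Fintype F] (hq : Fintype.card F = p ^ f) :
    kSing p (Matrix.ProjectiveSpecialLinearGroup (Fin 2) F) = 2 := by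
  have : Fact p.Prime := ⟨hp⟩
  have : CharP F p := charP_of_card_eq_prime_pow hq
  have hchar : ringChar F ≠ 2 := by
    rw [ringChar.eq F p]
    rintro rfl
    exact absurd hodd (by decide)
  have h2 : (2 : F) ≠ 0 := Ring.two_ne_zero hchar
  obtain ⟨ε, hε⟩ := FiniteField.exists_nonsquare hchar
  have hε₀ : ε ≠ 0 := by
    rintro rfl
    simp at hε
  have hsing {a : F} (ha : a ≠ 0) :
      p ∣ orderOf (upperUnipotent a : Matrix.ProjectiveSpecialLinearGroup (Fin 2) F) :=
    (orderOf_mk_upperUnipotent ha).symm.dvd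
  rw [kSing, Nat.card_eq_two_iff]
  refine ⟨⟨_, _, rfl, hsing one_ne_zero⟩, ⟨_, _, rfl, hsing hε₀⟩, ?_, ?_⟩
  · rw [Ne, Subtype.mk.injEq, ConjClasses.mk_eq_mk_iff_isConj,
      isConj_mk_upperUnipotent_iff h2 one_ne_zero hε₀, one_mul]
    exact hε
  · refine Set.eq_univ_of_forall ?_
    rintro ⟨_, g, rfl, hg⟩
    obtain ⟨a, ha, hag⟩ := exists_isConj_of_dvd_orderOf hodd g (orderOf_pos g).ne' hg
    rw [Set.mem_insert_iff, Set.mem_singleton_iff, Subtype.mk.injEq, Subtype.mk.injEq,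
      ConjClasses.mk_eq_mk_iff_isConj, ConjClasses.mk_eq_mk_iff_isConj]
    by_cases hsq : IsSquare a
    · left
      exact hag.symm.trans ((isConj_mk_upperUnipotent_iff h2 ha one_ne_zero).2 (by simpa))
    · right
      refine hag.symm.trans ((isConj_mk_upperUnipotent_iff h2 ha hε₀).2 ?_)
      classical
      rw [← quadraticChar_one_iff_isSquare (mul_ne_zero ha hε₀), map_mul,
        quadraticChar_neg_one_iff_not_isSquare.2 hsq, quadraticChar_neg_one_iff_not_isSquare.2 hε]
      norm_num
end
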